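/- Let k be a number field and let E/k be an elliptic curve with complex multiplication by an order 𝒪 in an imaginary quadratic field K, and assume K ⊂ k. Then there is a constant C₂ > 0, depending only on E and k, such that every torsion point ξ ∈ E(k̄)_tors of exact order N (with N large enough that log log N > 0) satisfies [k(ξ):k] ≥ C₂·N/(log log N)². -/

import Mathlib

open Complex

/-- The period `m ω₁ + n ω₂` of the lattice `Λ = ℤω₁ ⊕ ℤω₂` attached to `p = (m, n)`. -/
noncomputable def latticePoint (ω₁ ω₂ : ℂ) (p : ℤ × ℤ) : ℂ :=
  (p.1 : ℂ) * ω₁ + (p.2 : ℂ) * ω₂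

/-- Membership in the lattice `Λ = ℤω₁ ⊕ ℤω₂`. -/
def InLattice (ω₁ ω₂ : ℂ) (z : ℂ) : Prop :=
  ∃ m n : ℤ, z = (m : ℂ) * ω₁ + (n : ℂ) * ω₂

/-- The Weierstrass function `℘(z; Λ) = z⁻² + Σ'_{ω ∈ Λ, ω ≠ 0} ((z − ω)⁻² − ω⁻²)`. -/
noncomputable def wp (ω₁ ω₂ : ℂ) (z : ℂ) : ℂ :=
  z ^ (-2 : ℤ) + ∑' p : {p : ℤ × ℤ // p ≠ 0},
    ((z - latticePoint ω₁ ω₂ p.1) ^ (-2 : ℤ) - (latticePoint ω₁ ω₂ p.1) ^ (-2 : ℤ))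

/-- The derivative `℘′(z; Λ) = −2 Σ_{ω ∈ Λ} (z − ω)⁻³`. -/
noncomputable def wp' (ω₁ ω₂ : ℂ) (z : ℂ) : ℂ :=
  -2 * ∑' p : ℤ × ℤ, (z - latticePoint ω₁ ω₂ p) ^ (-3 : ℤ)

/-- The lattice invariant `g₂(Λ) = 60 Σ'_{ω ∈ Λ, ω ≠ 0} ω⁻⁴`. -/
noncomputable def g2 (ω₁ ω₂ : ℂ) : ℂ :=
  60 * ∑' p : {p : ℤ × ℤ // p ≠ 0}, (latticePoint ω₁ ω₂ p.1) ^ (-4 : ℤ)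

/-- The lattice invariant `g₃(Λ) = 140 Σ'_{ω ∈ Λ, ω ≠ 0} ω⁻⁶`. -/
noncomputable def g3 (ω₁ ω₂ : ℂ) : ℂ :=
  140 * ∑' p : {p : ℤ × ℤ // p ≠ 0}, (latticePoint ω₁ ω₂ p.1) ^ (-6 : ℤ)

open scoped Classical in
set_option synthInstance.maxHeartbeats 1000000 in
/-- The degree `[k(ξ):k]` of the point `ξ` of `E(ℂ) ≅ ℂ/Λ` with parameter `z`:  the point at
infinity (`z ∈ Λ`) is rational, and a finite point has coordinates `(℘(z), ℘′(z))`. -/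
noncomputable def paramDegree (k : Subfield ℂ) (ω₁ ω₂ : ℂ) (z : ℂ) : ℕ :=
  if InLattice ω₁ ω₂ z then 1
  else Module.finrank k (IntermediateField.adjoin k {wp ω₁ ω₂ z, wp' ω₁ ω₂ z})

/-- The points of `E(ℂ) ≅ ℂ/Λ` with parameters `z` and `u` are `Gal(k̄/k)`-conjugate:  either
both are the point at infinity, or some `k`-embedding of `ℂ` carries the affine coordinates
`(℘(z), ℘′(z))` to `(℘(u), ℘′(u))`. -/
def IsConjParam (k : Subfield ℂ) (ω₁ ω₂ : ℂ) (z u : ℂ) : Prop :=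
  (InLattice ω₁ ω₂ z ∧ InLattice ω₁ ω₂ u) ∨
  (¬ InLattice ω₁ ω₂ z ∧ ¬ InLattice ω₁ ω₂ u ∧
    ∃ σ : ℂ →ₐ[k] ℂ, σ (wp ω₁ ω₂ z) = wp ω₁ ω₂ u ∧ σ (wp' ω₁ ω₂ z) = wp' ω₁ ω₂ u)

/-- The area of a fundamental parallelogram of `Λ = ℤω₁ ⊕ ℤω₂`. -/
noncomputable def covolume (ω₁ ω₂ : ℂ) : ℝ :=
  |ω₁.re * ω₂.im - ω₁.im * ω₂.re|

section

/-- Primes in `(n, 2 * n]` multiply to at most `4 ^ n`. -/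
theorem prod_primes_Ioc_le (n : ℕ) (hn : 0 < n) :
    ∏ p ∈ (Finset.Ioc n (2 * n)).filter Nat.Prime, p ≤ 4 ^ n := by
  have hdvd : (∏ p ∈ (Finset.Ioc n (2 * n)).filter Nat.Prime, p) ∣ Nat.centralBinom n := by
    apply Finset.prod_primes_dvd
    · intro p hp
      exact (Finset.mem_filter.mp hp).2.prime
    · intro p hp
      obtain ⟨hp1, hp2⟩ := Finset.mem_filter.mp hp
      rw [Finset.mem_Ioc] at hp1
      have h1 : p ∣ (2 * n).factorial := hp2.dvd_factorial.mpr hp1.2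
      have h2 : ¬ p ∣ n.factorial := fun h => by
        have := hp2.dvd_factorial.mp h
        omega
      have h3 : Nat.centralBinom n * n.factorial * n.factorial = (2 * n).factorial := by
        have := Nat.choose_mul_factorial_mul_factorial (show n ≤ 2 * n by omega)
        rw [show 2 * n - n = n by omega] at this
        rw [Nat.centralBinom_eq_two_mul_choose]
        exact this
      rw [← h3] at h1
      rcases hp2.dvd_mul.mp h1 with h | h
      · rcases hp2.dvd_mul.mp h with h | h
        · exact h
        · exact absurd h h2
      · exact absurd h h2
  refine (Nat.le_of_dvd (Nat.centralBinom_pos n) hdvd).trans ?_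
  rw [Nat.centralBinom_eq_two_mul_choose]
  calc (2 * n).choose n ≤ 2 ^ (2 * n) := Nat.choose_le_two_pow _ _
    _ = 4 ^ n := by rw [pow_mul]; norm_num

theorem sum_inv_primes_dyadic_le (i : ℕ) (hi : 0 < i) :
    ∑ p ∈ (Finset.Ioc (2 ^ i) (2 ^ (i + 1))).filter Nat.Prime, (1 : ℝ) / p ≤ 2 / i := by
  set S := (Finset.Ioc (2 ^ i) (2 ^ (i + 1))).filter Nat.Prime with hS
  have h1 : ∏ p ∈ S, p ≤ 4 ^ (2 ^ i) := by
    have := prod_primes_Ioc_le (2 ^ i) (by positivity)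
    rwa [show 2 * 2 ^ i = 2 ^ (i + 1) by ring] at this
  have h2 : (2 ^ i) ^ S.card ≤ ∏ p ∈ S, p := by
    apply Finset.pow_card_le_prod
    intro p hp
    exact (Finset.mem_Ioc.mp (Finset.mem_filter.mp hp).1).1.le
  have h3 : i * S.card ≤ 2 * 2 ^ i := by
    have := h2.trans h1
    rw [← pow_mul, show (4 : ℕ) = 2 ^ 2 by norm_num, ← pow_mul] at this
    exact (Nat.pow_le_pow_iff_right (by norm_num)).mp this
  have h4 : ∑ p ∈ S, (1 : ℝ) / p ≤ S.card • ((1 : ℝ) / 2 ^ i) := by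
    apply Finset.sum_le_card_nsmul
    intro p hp
    have := (Finset.mem_Ioc.mp (Finset.mem_filter.mp hp).1).1.le
    apply one_div_le_one_div_of_le (by positivity)
    exact_mod_cast this
  refine h4.trans ?_
  rw [nsmul_eq_mul, mul_one_div, div_le_div_iff₀ (by positivity) (by positivity)]
  have : ((i * S.card : ℕ) : ℝ) ≤ ((2 * 2 ^ i : ℕ) : ℝ) := by exact_mod_cast h3
  push_cast at this
  linarith

theorem sum_inv_primes_le (m : ℕ) :
    ∑ p ∈ (Finset.Icc 1 (2 ^ (m + 1))).filter Nat.Prime, (1 : ℝ) / p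
      ≤ 1 / 2 + 2 * ∑ i ∈ Finset.range m, (1 : ℝ) / (i + 1) := by
  induction m with
  | zero =>
    have : (Finset.Icc 1 (2 ^ (0 + 1))).filter Nat.Prime = {2} := by decide
    rw [this]
    simp
  | succ m ih =>
    have hsplit : (Finset.Icc 1 (2 ^ (m + 1 + 1))).filter Nat.Prime
        = (Finset.Icc 1 (2 ^ (m + 1))).filter Nat.Prime ∪
          (Finset.Ioc (2 ^ (m + 1)) (2 ^ (m + 1 + 1))).filter Nat.Prime := by
      ext p
      simp only [Finset.mem_filter, Finset.mem_union, Finset.mem_Icc, Finset.mem_Ioc]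
      have : 2 ^ (m + 1) ≤ 2 ^ (m + 1 + 1) := Nat.pow_le_pow_right (by norm_num) (by omega)
      constructor
      · rintro ⟨⟨h1, h2⟩, h3⟩
        rcases le_or_gt p (2 ^ (m + 1)) with h | h
        · exact Or.inl ⟨⟨h1, h⟩, h3⟩
        · exact Or.inr ⟨⟨h, h2⟩, h3⟩
      · rintro (⟨⟨h1, h2⟩, h3⟩ | ⟨⟨h1, h2⟩, h3⟩)
        · exact ⟨⟨h1, h2.trans this⟩, h3⟩
        · exact ⟨⟨h3.one_le, h2⟩, h3⟩
    have hdisj : Disjoint ((Finset.Icc 1 (2 ^ (m + 1))).filter Nat.Prime)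
          ((Finset.Ioc (2 ^ (m + 1)) (2 ^ (m + 1 + 1))).filter Nat.Prime) := by
      rw [Finset.disjoint_left]
      intro p hp hq
      simp only [Finset.mem_filter, Finset.mem_Icc, Finset.mem_Ioc] at hp hq
      omega
    rw [hsplit, Finset.sum_union hdisj, Finset.sum_range_succ]
    have := sum_inv_primes_dyadic_le (m + 1) (by omega)
    push_cast at this
    have e : (2 : ℝ) / (m + 1) = 2 * (1 / (m + 1)) := by ring
    rw [e] at this
    linarith

theorem sum_inv_range_le (m : ℕ) :
    ∑ i ∈ Finset.range m, (1 : ℝ) / (i + 1) ≤ 1 + Real.log m := by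
  have := harmonic_le_one_add_log m
  simpa [harmonic] using this

theorem sum_inv_mul_pred_le (S : Finset ℕ) (hS : ∀ p ∈ S, 2 ≤ p) :
    ∑ p ∈ S, (1 : ℝ) / (p * (p - 1)) ≤ 1 := by
  have key : ∀ n : ℕ, ∑ p ∈ Finset.Icc 2 (n + 1), (1 : ℝ) / (p * (p - 1)) = 1 - 1 / (n + 1) := by
    intro n
    induction n with
    | zero => simp
    | succ n ih =>
      rw [Finset.sum_Icc_succ_top (by omega), ih]
      push_cast
      have : (n : ℝ) + 1 ≠ 0 := by positivity
      have : (n : ℝ) + 1 + 1 ≠ 0 := by positivity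
      field_simp
      ring
  have hsub : S ⊆ Finset.Icc 2 (S.sup id + 1) := by
    intro p hp
    rw [Finset.mem_Icc]
    have : p ≤ S.sup id := Finset.le_sup (f := id) hp
    exact ⟨hS p hp, by omega⟩
  refine (Finset.sum_le_sum_of_subset_of_nonneg hsub ?_).trans ?_
  · intro p hp _
    have := (Finset.mem_Icc.mp hp).1
    have : (2 : ℝ) ≤ p := by exact_mod_cast this
    have h1 : 0 < (p : ℝ) - 1 := by linarith
    positivity
  · rw [key]
    have : 0 ≤ (1 : ℝ) / ((S.sup id : ℕ) + 1) := by positivity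
    linarith

theorem div_totient_le_exp (N : ℕ) (hN : 0 < N) :
    (N : ℝ) ≤ Nat.totient N * Real.exp (∑ p ∈ N.primeFactors, (1 : ℝ) / (p - 1)) := by
  have h1 : (Nat.totient N : ℝ) = N * ∏ p ∈ N.primeFactors, (1 - (p : ℝ)⁻¹) := by
    have := congrArg (Rat.cast : ℚ → ℝ) (Nat.totient_eq_mul_prod_factors N)
    push_cast at this
    exact this
  rw [h1, Real.exp_sum, mul_assoc, ← Finset.prod_mul_distrib]
  have : (1 : ℝ) ≤ ∏ p ∈ N.primeFactors, ((1 - (p : ℝ)⁻¹) * Real.exp (1 / (p - 1))) := by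
    refine (Finset.prod_const_one (s := N.primeFactors)).symm.le.trans
      (Finset.prod_le_prod (fun _ _ => zero_le_one) ?_)
    · intro p hp
      have hp2 : (2 : ℝ) ≤ p := by exact_mod_cast (Nat.prime_of_mem_primeFactors hp).two_le
      have e1 : 0 < (p : ℝ) - 1 := by linarith
      have e2 := Real.add_one_le_exp (1 / ((p : ℝ) - 1))
      have e3 : 0 < 1 - (p : ℝ)⁻¹ := by
        rw [sub_pos]; exact inv_lt_one_of_one_lt₀ (by linarith)
      calc (1 : ℝ) = (1 - (p : ℝ)⁻¹) * (1 / (p - 1) + 1) := by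
            have : (p : ℝ) ≠ 0 := by linarith
            field_simp
            ring
        _ ≤ _ := by gcongr
  exact le_mul_of_one_le_right (by positivity) this

theorem card_primeFactors_le_log (N : ℕ) (hN : 0 < N) : N.primeFactors.card ≤ Nat.log 2 N := by
  apply Nat.le_log_of_pow_le (by norm_num)
  calc 2 ^ N.primeFactors.card ≤ ∏ p ∈ N.primeFactors, p :=
        Finset.pow_card_le_prod _ _ _ fun p hp => (Nat.prime_of_mem_primeFactors hp).two_le
    _ ≤ N := Nat.le_of_dvd hN (Nat.prod_primeFactors_dvd N)

theorem sum_primeFactors_le (N : ℕ) (hN : 0 < N) (m : ℕ)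
    (hlog : Nat.log 2 N ≤ 2 ^ (m + 1)) :
    ∑ p ∈ N.primeFactors, (1 : ℝ) / (p - 1) ≤ 9 / 2 + 2 * Real.log m := by
  rw [← Finset.sum_filter_add_sum_filter_not N.primeFactors (fun p => p ≤ 2 ^ (m + 1))]
  have h1 : ∑ p ∈ N.primeFactors with p ≤ 2 ^ (m + 1), (1 : ℝ) / (p - 1)
      ≤ 1 + (1 / 2 + 2 * (1 + Real.log m)) := by
    have e : ∀ p ∈ N.primeFactors.filter (fun p => p ≤ 2 ^ (m + 1)),
        (1 : ℝ) / (p - 1) = 1 / (p * (p - 1)) + 1 / p := by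
      intro p hp
      have hp2 : (2 : ℝ) ≤ p := by
        exact_mod_cast (Nat.prime_of_mem_primeFactors (Finset.mem_filter.mp hp).1).two_le
      have e1 : (p : ℝ) - 1 ≠ 0 := by linarith
      have e2 : (p : ℝ) ≠ 0 := by linarith
      field_simp
      ring
    rw [Finset.sum_congr rfl e, Finset.sum_add_distrib]
    apply add_le_add
    · apply sum_inv_mul_pred_le
      intro p hp
      exact (Nat.prime_of_mem_primeFactors (Finset.mem_filter.mp hp).1).two_le
    · have h2 := sum_inv_primes_le m
      have h3 := sum_inv_range_le m
      refine le_trans (Finset.sum_le_sum_of_subset_of_nonneg (t :=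
        (Finset.Icc 1 (2 ^ (m + 1))).filter Nat.Prime) ?_ ?_) (h2.trans (by linarith))
      · intro p hp
        obtain ⟨hp1, hp2⟩ := Finset.mem_filter.mp hp
        have := Nat.prime_of_mem_primeFactors hp1
        exact Finset.mem_filter.mpr ⟨Finset.mem_Icc.mpr ⟨this.one_le, hp2⟩, this⟩
      · intros; positivity
  have h2 : ∑ p ∈ N.primeFactors with ¬ p ≤ 2 ^ (m + 1), (1 : ℝ) / (p - 1) ≤ 1 := by
    have : ∑ p ∈ N.primeFactors with ¬ p ≤ 2 ^ (m + 1), (1 : ℝ) / (p - 1)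
        ≤ (N.primeFactors.filter (fun p => ¬ p ≤ 2 ^ (m + 1))).card • ((1 : ℝ) / 2 ^ (m + 1)) := by
      apply Finset.sum_le_card_nsmul
      intro p hp
      have := (Finset.mem_filter.mp hp).2
      apply one_div_le_one_div_of_le (by positivity)
      have h : 2 ^ (m + 1) + 1 ≤ p := by omega
      have h' : ((2 ^ (m + 1) + 1 : ℕ) : ℝ) ≤ p := by exact_mod_cast h
      push_cast at h'
      linarith
    refine this.trans ?_
    rw [nsmul_eq_mul, mul_one_div, div_le_one (by positivity)]
    have h : (N.primeFactors.filter (fun p => ¬ p ≤ 2 ^ (m + 1))).card ≤ 2 ^ (m + 1) :=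
      (Finset.card_filter_le _ _).trans ((card_primeFactors_le_log N hN).trans hlog)
    exact_mod_cast h
  linarith

theorem exists_totient_lower_bound : ∃ C : ℝ, 0 < C ∧ ∀ N : ℕ, 0 < N →
    0 < Real.log (Real.log N) →
      C * N / Real.log (Real.log N) ^ 2 ≤ (Nat.totient N : ℝ) := by
  set δ := Real.log (Real.log 3) with hδ
  have hlog3 : 1 < Real.log 3 := by
    rw [Real.lt_log_iff_exp_lt (by norm_num)]
    exact Real.exp_one_lt_d9.trans (by norm_num)
  have hδ0 : 0 < δ := Real.log_pos hlog3
  have hl2 : 0 < Real.log 2 := Real.log_pos (by norm_num)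
  set A := |Real.log (1 / Real.log 2)| with hA
  set K := ((δ + A) / Real.log 2 + 1) / δ with hK
  have hK0 : 0 < K := by positivity
  refine ⟨1 / (Real.exp (9 / 2) * K ^ 2), by positivity, ?_⟩
  intro N hN hll
  have hN3 : 3 ≤ N := by
    by_contra h
    have : N = 1 ∨ N = 2 := by omega
    rcases this with rfl | rfl
    · simp at hll
    · have h1 : Real.log (2 : ℕ) ≤ 1 := by
        have := Real.log_two_lt_d9
        push_cast
        linarith
      have := Real.log_nonpos (Real.log_nonneg (by norm_num)) h1
      linarith
  set x := Real.log (Real.log N) with hx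
  have hlogN : Real.log 3 ≤ Real.log N := Real.log_le_log (by norm_num) (by exact_mod_cast hN3)
  have hxδ : δ ≤ x := Real.log_le_log (by linarith) hlogN
  set s := Nat.log 2 N with hs
  set m := Nat.log 2 s + 1 with hm
  have hs1 : 1 ≤ s := Nat.log_pos (by norm_num) (by omega)
  have hsm : s ≤ 2 ^ (m + 1) := by
    have := Nat.lt_pow_succ_log_self (b := 2) (by norm_num) s
    calc s ≤ 2 ^ m := this.le
      _ ≤ 2 ^ (m + 1) := Nat.pow_le_pow_right (by norm_num) (by omega)
  have hsum := sum_primeFactors_le N hN m hsm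
  have hmain := div_totient_le_exp N hN
  have hm_le : (m : ℝ) ≤ K * x := by
    have e1 : (s : ℝ) * Real.log 2 ≤ Real.log N := by
      rw [← Real.log_pow]
      apply Real.log_le_log (by positivity)
      exact_mod_cast Nat.pow_log_le_self 2 (by omega)
    have e2 : ((Nat.log 2 s : ℕ) : ℝ) * Real.log 2 ≤ Real.log s := by
      rw [← Real.log_pow]
      apply Real.log_le_log (by positivity)
      exact_mod_cast Nat.pow_log_le_self 2 (by omega)
    have e3 : Real.log s ≤ x + A := by
      have : (s : ℝ) ≤ Real.log N * (1 / Real.log 2) := by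
        rw [mul_one_div, le_div_iff₀ hl2]
        exact e1
      have h0 : (0 : ℝ) < s := by exact_mod_cast hs1
      have := Real.log_le_log h0 this
      rw [Real.log_mul (by linarith) (by positivity)] at this
      exact this.trans (by gcongr; exact le_abs_self _)
    have e4 : (m : ℝ) ≤ (x + A) / Real.log 2 + 1 := by
      rw [hm]
      push_cast
      gcongr
      rw [le_div_iff₀ hl2]
      linarith
    have hA0 : 0 ≤ A := abs_nonneg _
    refine e4.trans ?_
    rw [hK, div_mul_eq_mul_div, le_div_iff₀ hδ0, add_mul, add_mul, div_mul_eq_mul_div,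
      div_mul_eq_mul_div]
    have : (x + A) * δ ≤ (δ + A) * x := by nlinarith
    have : (x + A) * δ / Real.log 2 ≤ (δ + A) * x / Real.log 2 := by gcongr
    linarith
  have hm0 : (0 : ℝ) < m := by rw [hm]; positivity
  have h5 : (N : ℝ) ≤ Nat.totient N * (Real.exp (9 / 2) * (K * x) ^ 2) := by
    refine hmain.trans ?_
    have : Real.exp (∑ p ∈ N.primeFactors, (1 : ℝ) / (p - 1))
        ≤ Real.exp (9 / 2) * (m : ℝ) ^ 2 := by
      refine (Real.exp_le_exp.mpr hsum).trans (le_of_eq ?_)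
      rw [Real.exp_add, mul_comm 2, Real.exp_mul, Real.exp_log hm0]
      norm_num
    refine (mul_le_mul_of_nonneg_left this (by positivity)).trans ?_
    gcongr
  rw [div_mul_eq_mul_div, one_mul, div_div, div_le_iff₀ (by positivity)]
  calc (N : ℝ) ≤ _ := h5
    _ = _ := by ring

end

section

namespace WeierstrassCurve.Affine.Point

variable {F : Type*} [Field F] {W : WeierstrassCurve.Affine F}

/-- The `x`-coordinate of a point, with the junk value `0` at the origin. -/
def xc : W.Point → F
  | .zero => 0
  | .some x _ _ => x

/-- The `y`-coordinate of a point, with the junk value `0` at the origin. -/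
def yc : W.Point → F
  | .zero => 0
  | .some _ y _ => y

@[simp] theorem xc_zero : xc (0 : W.Point) = 0 := rfl
@[simp] theorem yc_zero : yc (0 : W.Point) = 0 := rfl
@[simp] theorem xc_some {x y : F} (h : W.Nonsingular x y) : xc (.some x y h) = x := rfl
@[simp] theorem yc_some {x y : F} (h : W.Nonsingular x y) : yc (.some x y h) = y := rfl

theorem ext_coord {P Q : W.Point} (hP : P ≠ 0) (hQ : Q ≠ 0) (hx : P.xc = Q.xc)
    (hy : P.yc = Q.yc) : P = Q := by
  rcases P with _ | ⟨x, y, h⟩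
  · exact absurd rfl hP
  rcases Q with _ | ⟨x', y', h'⟩
  · exact absurd rfl hQ
  simp only [xc_some, yc_some] at hx hy
  subst hx hy
  rfl

@[simp] theorem xc_neg (P : W.Point) : (-P).xc = P.xc := by
  rcases P with _ | ⟨x, y, h⟩ <;> rfl

variable [W.IsShortNF]

theorem negY_of_short (x y : F) : W.negY x y = -y := by
  simp [negY]

@[simp] theorem yc_neg (P : W.Point) : (-P).yc = -P.yc := by
  rcases P with _ | ⟨x, y, h⟩
  · change (0 : F) = -0
    simp
  · exact negY_of_short x y

theorem equation_coord {P : W.Point} (hP : P ≠ 0) :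
    P.yc ^ 2 = P.xc ^ 3 + W.a₄ * P.xc + W.a₆ := by
  rcases P with _ | ⟨x, y, h⟩
  · exact absurd rfl hP
  have := (W.equation_iff x y).mp h.1
  simpa [a₁_of_isShortNF, a₂_of_isShortNF, a₃_of_isShortNF] using this

theorem eq_or_eq_neg_of_xc_eq {P Q : W.Point} (hP : P ≠ 0) (hQ : Q ≠ 0)
    (hx : P.xc = Q.xc) : P = Q ∨ P = -Q := by
  have h : (P.yc - Q.yc) * (P.yc + Q.yc) = 0 := by
    have h1 := equation_coord hP
    have h2 := equation_coord hQ
    rw [hx] at h1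
    linear_combination h1 - h2
  rcases mul_eq_zero.mp h with h | h
  · exact Or.inl (ext_coord hP hQ hx (sub_eq_zero.mp h))
  · have hQ' : -Q ≠ 0 := fun h => hQ (by rw [← neg_neg Q, h, neg_zero])
    refine Or.inr (ext_coord hP hQ' (by rw [xc_neg, hx]) ?_)
    rw [yc_neg]
    linear_combination h

/-- The chord-and-tangent description of the sum of two points on a short Weierstrass curve. -/
theorem exists_slope [DecidableEq F] {P Q : W.Point} (hP : P ≠ 0) (hQ : Q ≠ 0)
    (hPQ : P + Q ≠ 0) : ∃ ℓ : F,
      (P + Q).xc = ℓ ^ 2 - P.xc - Q.xc ∧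
      (P + Q).yc = -(ℓ * ((P + Q).xc - P.xc) + P.yc) ∧
      (∀ X : F, (ℓ * (X - P.xc) + P.yc) ^ 2 - (X ^ 3 + W.a₄ * X + W.a₆)
        = -((X - P.xc) * (X - Q.xc) * (X - (P + Q).xc))) ∧
      P.yc - Q.yc = ℓ * (P.xc - Q.xc) ∧
      (P.xc = Q.xc → P = Q ∧ ℓ * (2 * P.yc) = 3 * P.xc ^ 2 + W.a₄ ∧ 2 * P.yc ≠ 0) := by
  rcases P with _ | ⟨x₁, y₁, h₁⟩
  · exact absurd rfl hP
  rcases Q with _ | ⟨x₂, y₂, h₂⟩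
  · exact absurd rfl hQ
  have hxy : ¬(x₁ = x₂ ∧ y₁ = W.negY x₂ y₂) := fun h => hPQ (add_of_Y_eq h.1 h.2)
  refine ⟨W.slope x₁ x₂ y₁ y₂, ?_⟩
  have hsum := add_some hxy (h₁ := h₁) (h₂ := h₂)
  rw [hsum]
  simp only [xc_some, yc_some]
  have hX : W.addX x₁ x₂ (W.slope x₁ x₂ y₁ y₂) = W.slope x₁ x₂ y₁ y₂ ^ 2 - x₁ - x₂ := by
    simp [addX]
  refine ⟨hX, ?_, ?_, ?_, ?_⟩
  · rw [addY, negY_of_short, negAddY]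
  · intro X
    have := congrArg (Polynomial.eval X) (addPolynomial_slope h₁.1 h₂.1 hxy)
    rw [addPolynomial_eq, Cubic.toPoly] at this
    simp only [a₁_of_isShortNF, a₂_of_isShortNF, a₃_of_isShortNF, Polynomial.eval_neg,
      Polynomial.eval_add, Polynomial.eval_mul, Polynomial.eval_C, Polynomial.eval_pow,
      Polynomial.eval_X, Polynomial.eval_sub] at this
    linear_combination this
  · by_cases hx : x₁ = x₂
    · have hy : y₁ ≠ W.negY x₂ y₂ := fun h => hxy ⟨hx, h⟩
      have := Y_eq_of_Y_ne h₁.1 h₂.1 hx hy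
      rw [this, hx]
      ring
    · rw [slope_of_X_ne hx, div_mul_cancel₀ _ (sub_ne_zero.mpr hx)]
  · intro hx
    have hy : y₁ ≠ W.negY x₂ y₂ := fun h => hxy ⟨hx, h⟩
    have hyy := Y_eq_of_Y_ne h₁.1 h₂.1 hx hy
    subst hx hyy
    refine ⟨rfl, ?_⟩
    have h2 : (2 : F) * y₁ ≠ 0 := by
      rw [negY_of_short] at hy
      intro h
      apply hy
      linear_combination h
    refine ⟨?_, h2⟩
    rw [slope_of_Y_ne rfl hy, negY_of_short]
    simp only [a₁_of_isShortNF, a₂_of_isShortNF]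
    rw [show y₁ - -y₁ = 2 * y₁ by ring, div_mul_cancel₀ _ h2]
    ring

end WeierstrassCurve.Affine.Point

end

section

/-- The line through two points near the origin, in the coordinates `t = x / y`, `w = 1 / y`. -/
theorem exists_line_param {F : Type*} [Field F] {a b t₁ w₁ t₂ w₂ ℓ A B : F} (hw₁ : w₁ ≠ 0)
    (e₁ : w₁ = t₁ ^ 3 + a * t₁ * w₁ ^ 2 + b * w₁ ^ 3)
    (e₂ : w₂ = t₂ ^ 3 + a * t₂ * w₂ ^ 2 + b * w₂ ^ 3)
    (hA : A = 1 - a * t₂ * (w₁ + w₂) - b * (w₁ ^ 2 + w₁ * w₂ + w₂ ^ 2)) (hA0 : A ≠ 0)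
    (hB : B = t₁ ^ 2 + t₁ * t₂ + t₂ ^ 2 + a * w₁ ^ 2)
    (hl : w₂ - w₁ = ℓ * (t₁ * w₂ - t₂ * w₁))
    (hne : t₁ = t₂ → w₁ = w₂ → ℓ * (2 * w₁) = B) :
    ℓ * (w₁ - B / A * t₁) = -(B / A) ∧ w₁ - B / A * t₁ ≠ 0 ∧
      (1 - ℓ * t₁) * (w₁ - B / A * t₁) = w₁ := by
  have key : (w₁ - w₂) * A = (t₁ - t₂) * B := by
    rw [hA, hB]
    linear_combination e₁ - e₂
  obtain ⟨l, hl'⟩ : ∃ l, l = B / A := ⟨_, rfl⟩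
  have hlA : l * A = B := by rw [hl', div_mul_cancel₀ _ hA0]
  rw [← hl']
  have h1 : ℓ * (w₁ - l * t₁) = -l := by
    by_cases ht : t₁ = t₂
    · have hw : w₁ = w₂ := by
        rw [ht, sub_self, zero_mul] at key
        exact sub_eq_zero.mp ((mul_eq_zero.mp key).resolve_right hA0)
      have h2 := hne ht hw
      subst ht hw
      have h3 : (w₁ * A - t₁ * B) = -2 * w₁ := by
        rw [hA, hB]
        linear_combination 3 * e₁
      apply mul_right_cancel₀ hA0
      linear_combination (-ℓ * t₁ + 1) * hlA + ℓ * h3 - h2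
    · apply mul_right_cancel₀ (sub_ne_zero.mpr ht)
      have h2 : l * (t₁ - t₂) = w₁ - w₂ := by
        apply mul_right_cancel₀ hA0
        linear_combination (t₁ - t₂) * hlA - key
      linear_combination (1 - ℓ * t₁) * h2 - hl
  refine ⟨h1, ?_, by linear_combination (-t₁) * h1⟩
  intro h0
  rw [h0, mul_zero] at h1
  have : l = 0 := by linear_combination h1
  rw [this] at h0
  exact hw₁ (by linear_combination h0)

/-- The third intersection point of a line with a cubic, in the coordinates `t = x / y`,
`w = 1 / y`. -/
theorem third_point_param {F : Type*} [Field F] {a b x₁ y₁ x₂ y₂ x₃ y₃ ℓ l ν : F}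
    (hy₁ : y₁ ≠ 0) (hy₂ : y₂ ≠ 0) (hx₃ : x₃ = ℓ ^ 2 - x₁ - x₂) (hy₃ : y₃ = ℓ * (x₃ - x₁) + y₁)
    (h12 : y₁ - y₂ = ℓ * (x₁ - x₂))
    (hX : ∀ X : F, (ℓ * (X - x₁) + y₁) ^ 2 - (X ^ 3 + a * X + b)
      = -((X - x₁) * (X - x₂) * (X - x₃)))
    (h1 : ℓ * ν = -l) (h2 : (y₁ - ℓ * x₁) * ν = 1) (hS : 1 + a * l ^ 2 + b * l ^ 3 ≠ 0) :
    y₃ ≠ 0 ∧ 1 / y₃ = l * (x₃ / y₃) + ν ∧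
      x₁ / y₁ + x₂ / y₂ + x₃ / y₃
        = -(ν * (2 * a * l + 3 * b * l ^ 2) / (1 + a * l ^ 2 + b * l ^ 3)) := by
  have hν : ν ≠ 0 := fun h => by rw [h, mul_zero] at h2; exact zero_ne_one h2
  obtain ⟨μ, hμ⟩ : ∃ μ, μ = y₁ - ℓ * x₁ := ⟨_, rfl⟩
  rw [← hμ] at h2
  have hl : l = -(ℓ * ν) := by linear_combination h1
  have hy1 : y₁ = ℓ * x₁ + μ := by rw [hμ]; ring
  have hy2 : y₂ = ℓ * x₂ + μ := by rw [hμ]; linear_combination -h12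
  have hy3 : y₃ = ℓ * x₃ + μ := by rw [hμ, hy₃]; ring
  have hE1 : x₁ + x₂ + x₃ = ℓ ^ 2 := by rw [hx₃]; ring
  have hE3 : x₁ * x₂ * x₃ = μ ^ 2 - b := by
    have := hX 0
    rw [hμ]
    linear_combination -this
  have hE2 : x₁ * x₂ + x₁ * x₃ + x₂ * x₃ = a - 2 * ℓ * μ := by
    have := hX 1
    have e : y₁ = ℓ * x₁ + μ := hy1
    rw [e] at this
    linear_combination this + hE1 + hE3
  have hprod : y₁ * y₂ * y₃ = μ ^ 3 + a * ℓ ^ 2 * μ - b * ℓ ^ 3 := by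
    rw [hy1, hy2, hy3]
    linear_combination ℓ ^ 3 * hE3 + ℓ ^ 2 * μ * hE2 + ℓ * μ ^ 2 * hE1
  have hprod' : y₁ * y₂ * y₃ * ν ^ 3 = 1 + a * l ^ 2 + b * l ^ 3 := by
    rw [hprod, hl]
    linear_combination (μ ^ 2 * ν ^ 2 + μ * ν + 1 + a * ℓ ^ 2 * ν ^ 2) * h2
  have hy30 : y₃ ≠ 0 := fun h => hS (by rw [← hprod', h]; ring)
  have hnum : x₁ * y₂ * y₃ + x₂ * y₁ * y₃ + x₃ * y₁ * y₂ = 2 * a * ℓ * μ - 3 * b * ℓ ^ 2 := by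
    rw [hy1, hy2, hy3]
    linear_combination 3 * ℓ ^ 2 * hE3 + 2 * ℓ * μ * hE2 + μ ^ 2 * hE1
  refine ⟨hy30, ?_, ?_⟩
  · rw [eq_comm, ← mul_left_inj' hy30, add_mul, mul_assoc, div_mul_cancel₀ _ hy30,
      div_mul_cancel₀ _ hy30, hl]
    rw [hy3]
    linear_combination h2
  · have e1 : x₁ / y₁ + x₂ / y₂ + x₃ / y₃
        = (x₁ * y₂ * y₃ + x₂ * y₁ * y₃ + x₃ * y₁ * y₂) / (y₁ * y₂ * y₃) := by
      field_simp
    rw [e1, hnum, ← hprod', ← neg_div, div_eq_div_iff (mul_ne_zero (mul_ne_zero hy₁ hy₂) hy30)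
      (mul_ne_zero (mul_ne_zero (mul_ne_zero hy₁ hy₂) hy30) (pow_ne_zero 3 hν)), hl]
    linear_combination (y₁ * y₂ * y₃) * (2 * a * ℓ * ν ^ 2) * h2

end

section

namespace WeierstrassCurve.Affine.Point

variable {F : Type*} [Field F] [DecidableEq F] {Γ₀ : Type*} [LinearOrderedCommGroupWithZero Γ₀]

/-- Good reduction of a short Weierstrass curve at a valuation of residue characteristic not `2`. -/
structure GoodAt (v : Valuation F Γ₀) (W : WeierstrassCurve.Affine F) : Prop where
  a₄_le : v W.a₄ ≤ 1
  a₆_le : v W.a₆ ≤ 1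
  two : v 2 = 1
  disc : v (4 * W.a₄ ^ 3 + 27 * W.a₆ ^ 2) = 1

/-- The points reducing to the origin. -/
def InKer (v : Valuation F Γ₀) {W : WeierstrassCurve.Affine F} (P : W.Point) : Prop :=
  P = 0 ∨ 1 < v P.xc

/-- The local parameter `x / y` at the origin. -/
def tc {W : WeierstrassCurve.Affine F} (P : W.Point) : F := P.xc / P.yc

omit [DecidableEq F] in
theorem natCast_le_one (v : Valuation F Γ₀) (n : ℕ) : v (n : F) ≤ 1 := by
  induction n with
  | zero => simp
  | succ n ih =>
    rw [Nat.cast_succ]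
    exact v.map_add_le ih (by simp)

omit [DecidableEq F] in
theorem intCast_le_one (v : Valuation F Γ₀) (n : ℤ) : v (n : F) ≤ 1 := by
  obtain ⟨m, rfl | rfl⟩ := n.eq_nat_or_neg
  · rw [Int.cast_natCast]; exact natCast_le_one v m
  · rw [Int.cast_neg, v.map_neg, Int.cast_natCast]; exact natCast_le_one v m

variable {v : Valuation F Γ₀} {W : WeierstrassCurve.Affine F}

omit [DecidableEq F] in
@[simp] theorem tc_zero : tc (0 : W.Point) = 0 := by simp [tc]

omit [DecidableEq F] in
theorem InKer.neg {P : W.Point} (h : InKer v P) : InKer v (-P) := by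
  rcases h with rfl | h
  · exact Or.inl neg_zero
  · right; rwa [xc_neg]

variable [W.IsShortNF]

omit [DecidableEq F] in
@[simp] theorem tc_neg (P : W.Point) : tc (-P) = -tc P := by
  rw [tc, xc_neg, yc_neg, div_neg, tc]

omit [DecidableEq F] in
/-- Size of the coordinates of a point reducing to the origin. -/
theorem coord_of_lt (hW : GoodAt v W) {P : W.Point} (hP : P ≠ 0) (h : 1 < v P.xc) :
    P.yc ≠ 0 ∧ P.xc ≠ 0 ∧ v (P.yc ^ 2) = v (P.xc ^ 3) ∧
      v (P.yc ^ 2 / P.xc ^ 3 - 1) < 1 := by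
  have hx0 : P.xc ≠ 0 := fun h0 => by rw [h0, v.map_zero] at h; exact not_lt_zero h
  have hx1 : 0 < v P.xc := zero_lt_one.trans h
  have heq := equation_coord hP
  have h2 : v (W.a₄ * P.xc + W.a₆) < v (P.xc ^ 3) := by
    have e3 : v P.xc < v (P.xc ^ 3) := by
      rw [map_pow]
      exact lt_self_pow₀ h (by norm_num)
    apply v.map_add_lt
    · rw [map_mul]
      exact (mul_le_of_le_one_left' hW.a₄_le).trans_lt e3
    · exact hW.a₆_le.trans_lt (h.trans e3)
  have h3 : v (P.yc ^ 2) = v (P.xc ^ 3) := by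
    rw [heq, add_assoc, v.map_add_eq_of_lt_left h2]
  refine ⟨?_, hx0, h3, ?_⟩
  · intro h0
    rw [h0] at h3
    rw [zero_pow two_ne_zero, v.map_zero, map_pow] at h3
    exact pow_ne_zero 3 ((v.ne_zero_iff).mpr hx0) h3.symm
  · have : P.yc ^ 2 / P.xc ^ 3 - 1 = (W.a₄ * P.xc + W.a₆) / P.xc ^ 3 := by
      rw [heq]; field_simp; ring
    rw [this, map_div₀, div_lt_one₀ (by rw [map_pow]; exact pow_pos hx1 _)]
    exact h2

omit [DecidableEq F] in
/-- Size of the local parameters of a point reducing to the origin. -/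
theorem param_of_lt (hW : GoodAt v W) {P : W.Point} (hP : P ≠ 0) (h : 1 < v P.xc) :
    v (tc P) < 1 ∧ tc P ≠ 0 ∧ v (1 / P.yc) = v (tc P) ^ 3 ∧ v P.xc * v (tc P) ^ 2 = 1 ∧
      1 / P.yc = tc P ^ 3 + W.a₄ * tc P * (1 / P.yc) ^ 2 + W.a₆ * (1 / P.yc) ^ 3 := by
  obtain ⟨hy, hx, hv, _⟩ := coord_of_lt hW hP h
  have hxv : v P.xc ≠ 0 := (v.ne_zero_iff).mpr hx
  have hyv : v P.yc ≠ 0 := (v.ne_zero_iff).mpr hy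
  rw [map_pow, map_pow] at hv
  have e4 : v P.xc * v (tc P) ^ 2 = 1 := by
    rw [tc, map_div₀, div_pow, hv]
    field_simp
  refine ⟨?_, div_ne_zero hx hy, ?_, e4, ?_⟩
  · by_contra hge
    rw [not_lt] at hge
    have : 1 < v P.xc * v (tc P) ^ 2 := lt_of_lt_of_le h (le_mul_of_one_le_right' (one_le_pow₀ hge))
    rw [e4] at this
    exact lt_irrefl _ this
  · rw [tc, map_div₀, map_div₀, map_one, div_pow, ← hv]
    field_simp
  · have := equation_coord hP
    rw [tc]
    field_simp
    linear_combination this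

/-- The local parameter is additive up to smaller terms. -/
theorem add_param (hW : GoodAt v W) {P Q : W.Point} (hP : P ≠ 0) (hQ : Q ≠ 0) (hPQ : P + Q ≠ 0)
    (hPx : 1 < v P.xc) (hQx : 1 < v Q.xc) :
    1 < v (P + Q).xc ∧ v (tc (P + Q) - tc P - tc Q) < max (v (tc P)) (v (tc Q)) := by
  obtain ⟨ht1, ht10, hw1, _, he1⟩ := param_of_lt hW hP hPx
  obtain ⟨ht2, ht20, hw2, _, he2⟩ := param_of_lt hW hQ hQx
  obtain ⟨hy1, hx1, _⟩ := coord_of_lt hW hP hPx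
  obtain ⟨hy2, hx2, _⟩ := coord_of_lt hW hQ hQx
  obtain ⟨ℓ, hx3, hy3, hX, h12, htan⟩ := exists_slope hP hQ hPQ
  set t₁ := tc P with ht₁
  set t₂ := tc Q with ht₂
  set w₁ := 1 / P.yc with hw₁
  set w₂ := 1 / Q.yc with hw₂
  have hw10 : w₁ ≠ 0 := one_div_ne_zero hy1
  have hw20 : w₂ ≠ 0 := one_div_ne_zero hy2
  have hyw1 : P.yc = 1 / w₁ := by rw [hw₁, one_div_one_div]
  have hyw2 : Q.yc = 1 / w₂ := by rw [hw₂, one_div_one_div]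
  have hxw1 : P.xc = t₁ / w₁ := by rw [hw₁, ht₁, tc]; field_simp
  have hxw2 : Q.xc = t₂ / w₂ := by rw [hw₂, ht₂, tc]; field_simp
  set m := max (v t₁) (v t₂) with hm
  have hm1 : m < 1 := max_lt ht1 ht2
  have hm0 : 0 < m := lt_of_lt_of_le (zero_lt_iff.mpr ((v.ne_zero_iff).mpr ht10)) (le_max_left _ _)
  have hm32 : m ^ 3 ≤ m ^ 2 := pow_le_pow_of_le_one hm0.le hm1.le (by norm_num)
  have hm21 : m ^ 2 < m := by
    have := pow_lt_pow_right_of_lt_one₀ hm0 hm1 (show 1 < 2 by norm_num)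
    rwa [pow_one] at this
  have hw1m : v w₁ ≤ m ^ 3 := by rw [hw1]; exact pow_le_pow_left₀ zero_le (le_max_left _ _) _
  have hw2m : v w₂ ≤ m ^ 3 := by rw [hw2]; exact pow_le_pow_left₀ zero_le (le_max_right _ _) _
  have ht1m : v t₁ ≤ m := le_max_left _ _
  have ht2m : v t₂ ≤ m := le_max_right _ _
  have hm3lt : m ^ 3 < 1 := hm32.trans_lt (hm21.trans hm1)
  set A := 1 - W.a₄ * t₂ * (w₁ + w₂) - W.a₆ * (w₁ ^ 2 + w₁ * w₂ + w₂ ^ 2) with hA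
  set B := t₁ ^ 2 + t₁ * t₂ + t₂ ^ 2 + W.a₄ * w₁ ^ 2 with hB
  have hww : ∀ {x y : F}, v x ≤ m ^ 3 → v y ≤ m ^ 3 → v (x * y) ≤ m ^ 3 := by
    intro x y hx hy
    rw [map_mul]
    exact (mul_le_of_le_one_left' (hx.trans hm3lt.le)).trans hy
  have hAv : v A = 1 := by
    have : v (W.a₄ * t₂ * (w₁ + w₂) + W.a₆ * (w₁ ^ 2 + w₁ * w₂ + w₂ ^ 2)) < 1 := by
      apply v.map_add_lt
      · rw [map_mul, map_mul]
        refine (mul_le_of_le_one_left' (mul_le_one' hW.a₄_le ht2.le)).trans_lt ?_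
        exact (v.map_add_le hw1m hw2m).trans_lt hm3lt
      · rw [map_mul]
        refine (mul_le_of_le_one_left' hW.a₆_le).trans_lt ?_
        refine (v.map_add_le (v.map_add_le ?_ (hww hw1m hw2m)) ?_).trans_lt hm3lt
        · rw [pow_two]; exact hww hw1m hw1m
        · rw [pow_two]; exact hww hw2m hw2m
    rw [hA, sub_sub, v.map_sub_eq_of_lt_left (by rwa [map_one]), map_one]
  have hA0 : A ≠ 0 := fun h => by rw [h, v.map_zero] at hAv; exact zero_ne_one hAv
  have hBv : v B ≤ m ^ 2 := by
    have htt : ∀ {x y : F}, v x ≤ m → v y ≤ m → v (x * y) ≤ m ^ 2 := by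
      intro x y hx hy
      rw [map_mul, pow_two]
      exact mul_le_mul' hx hy
    refine v.map_add_le (v.map_add_le (v.map_add_le ?_ (htt ht1m ht2m)) ?_) ?_
    · rw [pow_two]; exact htt ht1m ht1m
    · rw [pow_two]; exact htt ht2m ht2m
    · rw [map_mul]
      refine (mul_le_of_le_one_left' hW.a₄_le).trans ?_
      rw [pow_two]
      exact (hww hw1m hw1m).trans hm32
  have hl : w₂ - w₁ = ℓ * (t₁ * w₂ - t₂ * w₁) := by
    rw [hyw1, hyw2, hxw1, hxw2] at h12
    field_simp at h12
    linear_combination h12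
  have hne : t₁ = t₂ → w₁ = w₂ → ℓ * (2 * w₁) = B := by
    intro htt hww'
    obtain ⟨_, h4, _⟩ := htan (by rw [hxw1, hxw2, htt, hww'])
    rw [hyw1, hxw1] at h4
    rw [hB, ← htt]
    field_simp at h4
    linear_combination h4
  obtain ⟨r1, r2, r3⟩ := exists_line_param hw10 he1 he2 hA hA0 hB hl hne
  set l := B / A with hl_def
  set ν := w₁ - l * t₁ with hν
  have hlv : v l ≤ m ^ 2 := by rw [hl_def, map_div₀, hAv, div_one]; exact hBv
  have hνv : v ν ≤ m ^ 3 := by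
    refine v.map_sub_le hw1m ?_
    rw [map_mul, pow_succ]
    exact mul_le_mul' hlv ht1m
  have hm2lt : m ^ 2 < 1 := hm21.trans hm1
  have hSv : v (1 + W.a₄ * l ^ 2 + W.a₆ * l ^ 3) = 1 := by
    have hl1 : v l < 1 := hlv.trans_lt hm2lt
    have : v (W.a₄ * l ^ 2 + W.a₆ * l ^ 3) < 1 := by
      apply v.map_add_lt
      · rw [map_mul, map_pow]
        exact (mul_le_of_le_one_left' hW.a₄_le).trans_lt (pow_lt_one₀ zero_le hl1 (by norm_num))
      · rw [map_mul, map_pow]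
        exact (mul_le_of_le_one_left' hW.a₆_le).trans_lt (pow_lt_one₀ zero_le hl1 (by norm_num))
    rw [add_assoc, v.map_add_eq_of_lt_left (by rwa [map_one]), map_one]
  have hS : 1 + W.a₄ * l ^ 2 + W.a₆ * l ^ 3 ≠ 0 := fun h => by
    rw [h, v.map_zero] at hSv; exact zero_ne_one hSv
  have h2 : (P.yc - ℓ * P.xc) * ν = 1 := by
    rw [hyw1, hxw1]
    field_simp
    linear_combination r3
  obtain ⟨s1, s2, s3⟩ := third_point_param hy1 hy2 hx3 rfl h12 hX r1 h2 hS
  have hyPQ : (P + Q).yc = -(ℓ * ((P + Q).xc - P.xc) + P.yc) := hy3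
  set y₃ := ℓ * ((P + Q).xc - P.xc) + P.yc with hy₃
  have htPQ : tc (P + Q) = -((P + Q).xc / y₃) := by rw [tc, hyPQ, div_neg]
  have herr : v (tc (P + Q) - tc P - tc Q) ≤ m ^ 3 := by
    have : tc (P + Q) - tc P - tc Q
        = ν * (2 * W.a₄ * l + 3 * W.a₆ * l ^ 2) / (1 + W.a₄ * l ^ 2 + W.a₆ * l ^ 3) := by
      rw [htPQ]
      have s3' : tc P + tc Q + (P + Q).xc / y₃ = _ := s3
      linear_combination -s3'
    rw [this, map_div₀, hSv, div_one, map_mul]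
    refine le_trans (mul_le_of_le_one_right' ?_) hνv
    have hl1 : v l ≤ 1 := hlv.trans hm2lt.le
    refine v.map_add_le ?_ ?_
    · rw [map_mul, map_mul]
      exact mul_le_one' (mul_le_one' (by exact_mod_cast natCast_le_one v 2) hW.a₄_le) hl1
    · rw [map_mul, map_mul, map_pow]
      exact mul_le_one' (mul_le_one' (by exact_mod_cast natCast_le_one v 3) hW.a₆_le)
        (pow_le_one₀ zero_le hl1)
  have ht3 : v ((P + Q).xc / y₃) ≤ m := by
    have : (P + Q).xc / y₃ = -((tc (P + Q) - tc P - tc Q) + (t₁ + t₂)) := by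
      rw [ht₁, ht₂, htPQ]; ring
    rw [this, v.map_neg]
    exact v.map_add_le (herr.trans (hm32.trans hm21.le)) (v.map_add_le ht1m ht2m)
  refine ⟨?_, herr.trans_lt (hm32.trans_lt hm21)⟩
  have hy3v : 1 < v y₃ := by
    have h5 : v (1 / y₃) < 1 := by
      rw [s2]
      apply v.map_add_lt
      · rw [map_mul]
        exact (mul_le_of_le_one_left' (hlv.trans hm2lt.le)).trans_lt (ht3.trans_lt hm1)
      · exact hνv.trans_lt hm3lt
    rw [one_div, map_inv₀] at h5
    exact (inv_lt_one₀ (zero_lt_iff.mpr ((v.ne_zero_iff).mpr s1))).mp h5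
  by_contra hle
  rw [not_lt] at hle
  have h6 := equation_coord hPQ
  rw [hyPQ] at h6
  have h7 : v ((-y₃) ^ 2) ≤ 1 := by
    rw [h6]
    refine v.map_add_le (v.map_add_le ?_ ?_) hW.a₆_le
    · rw [map_pow]; exact pow_le_one₀ zero_le hle
    · rw [map_mul]; exact mul_le_one' hW.a₄_le hle
  rw [neg_sq, map_pow] at h7
  exact absurd (one_lt_pow₀ hy3v (by norm_num)) (not_lt.mpr h7)

end WeierstrassCurve.Affine.Point

end

section

namespace WeierstrassCurve.Affine.Point

variable {F : Type*} [Field F] [DecidableEq F] {Γ₀ : Type*} [LinearOrderedCommGroupWithZero Γ₀]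
  {v : Valuation F Γ₀} {W : WeierstrassCurve.Affine F} [W.IsShortNF]

omit [DecidableEq F] [W.IsShortNF] in
theorem InKer.lt {P : W.Point} (h : InKer v P) (hP : P ≠ 0) : 1 < v P.xc :=
  h.resolve_left hP

omit [DecidableEq F] in
theorem InKer.tc_ne_zero (hW : GoodAt v W) {P : W.Point} (h : InKer v P) (hP : P ≠ 0) :
    tc P ≠ 0 :=
  (param_of_lt hW hP (h.lt hP)).2.1

omit [DecidableEq F] in
theorem InKer.tc_lt_one (hW : GoodAt v W) {P : W.Point} (h : InKer v P) (hP : P ≠ 0) :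
    v (tc P) < 1 :=
  (param_of_lt hW hP (h.lt hP)).1

omit [DecidableEq F] in
theorem InKer.xc_mul_tc_sq (hW : GoodAt v W) {P : W.Point} (h : InKer v P) (hP : P ≠ 0) :
    v P.xc * v (tc P) ^ 2 = 1 :=
  (param_of_lt hW hP (h.lt hP)).2.2.2.1

theorem InKer.add (hW : GoodAt v W) {P Q : W.Point} (hP : InKer v P) (hQ : InKer v Q) :
    InKer v (P + Q) := by
  rcases eq_or_ne P 0 with rfl | hP0
  · rwa [zero_add]
  rcases eq_or_ne Q 0 with rfl | hQ0
  · rwa [add_zero]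
  rcases eq_or_ne (P + Q) 0 with h0 | h0
  · exact Or.inl h0
  · exact Or.inr (add_param hW hP0 hQ0 h0 (hP.lt hP0) (hQ.lt hQ0)).1

/-- The subgroup of the points reducing to the origin. -/
def kerSubgroup (hW : GoodAt v W) : AddSubgroup W.Point where
  carrier := {P | InKer v P}
  zero_mem' := Or.inl rfl
  add_mem' h h' := h.add hW h'
  neg_mem' h := h.neg

theorem InKer.tc_add_lt (hW : GoodAt v W) {P Q : W.Point} (hP : InKer v P) (hQ : InKer v Q)
    (hP0 : P ≠ 0) : v (tc (P + Q) - tc P - tc Q) < max (v (tc P)) (v (tc Q)) := by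
  have hpos : 0 < max (v (tc P)) (v (tc Q)) :=
    lt_of_lt_of_le (zero_lt_iff.mpr ((v.ne_zero_iff).mpr (hP.tc_ne_zero hW hP0))) (le_max_left _ _)
  rcases eq_or_ne Q 0 with rfl | hQ0
  · simpa using hpos
  rcases eq_or_ne (P + Q) 0 with h0 | h0
  · rw [eq_neg_of_add_eq_zero_right h0]
    simpa using zero_lt_iff.mpr ((v.ne_zero_iff).mpr (hP.tc_ne_zero hW hP0))
  · exact (add_param hW hP0 hQ0 h0 (hP.lt hP0) (hQ.lt hQ0)).2

theorem InKer.tc_nsmul_lt (hW : GoodAt v W) {P : W.Point} (hP : InKer v P) (hP0 : P ≠ 0)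
    (n : ℕ) : v (tc (n • P) - n * tc P) < v (tc P) := by
  have hpos : 0 < v (tc P) := zero_lt_iff.mpr ((v.ne_zero_iff).mpr (hP.tc_ne_zero hW hP0))
  induction n with
  | zero => simpa using hpos
  | succ n ih =>
    have hn : v (tc (n • P)) ≤ v (tc P) := by
      have : tc (n • P) = (tc (n • P) - n * tc P) + n * tc P := by ring
      rw [this]
      refine v.map_add_le ih.le ?_
      rw [map_mul]
      exact mul_le_of_le_one_left' (natCast_le_one v n)
    have hk : InKer v (n • P) := (kerSubgroup hW).nsmul_mem hP n
    have h1 := hP.tc_add_lt hW hk hP0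
    rw [max_eq_left hn] at h1
    have : tc ((n + 1) • P) - ((n + 1 : ℕ) : F) * tc P
        = (tc (P + n • P) - tc P - tc (n • P)) + (tc (n • P) - n * tc P) := by
      rw [succ_nsmul, add_comm (n • P) P]; push_cast; ring
    rw [this]
    exact v.map_add_lt h1 ih

theorem InKer.tc_nsmul_eq (hW : GoodAt v W) {P : W.Point} (hP : InKer v P)
    {n : ℕ} (hn : v (n : F) = 1) : v (tc (n • P)) = v (tc P) := by
  rcases eq_or_ne P 0 with rfl | hP0
  · simp
  have h1 := hP.tc_nsmul_lt hW hP0 n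
  have : tc (n • P) = n * tc P + (tc (n • P) - n * tc P) := by ring
  have h2 : v (n * tc P) = v (tc P) := by rw [map_mul, hn, one_mul]
  rw [this, v.map_add_eq_of_lt_left (by rwa [h2]), h2]

theorem InKer.eq_zero_of_nsmul (hW : GoodAt v W) {P : W.Point} (hP : InKer v P)
    {n : ℕ} (hn : v (n : F) = 1) (h : n • P = 0) : P = 0 := by
  by_contra hP0
  have h1 := hP.tc_nsmul_eq hW hn
  rw [h, tc_zero, v.map_zero] at h1
  exact hP.tc_ne_zero hW hP0 ((v.zero_iff).mp h1.symm)

theorem InKer.xc_nsmul_eq (hW : GoodAt v W) {P : W.Point} (hP : InKer v P) (hP0 : P ≠ 0)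
    {n : ℕ} (hn : v (n : F) = 1) : v (n • P).xc = v P.xc := by
  have hk : InKer v (n • P) := (kerSubgroup hW).nsmul_mem hP n
  have hn0 : n • P ≠ 0 := fun h => hP0 (hP.eq_zero_of_nsmul hW hn h)
  have h1 := hP.xc_mul_tc_sq hW hP0
  have h2 := hk.xc_mul_tc_sq hW hn0
  rw [hP.tc_nsmul_eq hW hn, ← h1] at h2
  refine mul_right_cancel₀ ?_ h2
  exact pow_ne_zero _ ((v.ne_zero_iff).mpr (hP.tc_ne_zero hW hP0))

omit [DecidableEq F] in
theorem InKer.xc_mul_tc_sq_sub_one (hW : GoodAt v W) {P : W.Point} (h : InKer v P) (hP : P ≠ 0) :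
    v (P.xc * tc P ^ 2 - 1) < 1 := by
  obtain ⟨hy, hx, h1, h2⟩ := coord_of_lt hW hP (h.lt hP)
  have : P.xc * tc P ^ 2 - 1 = -(P.yc ^ 2 / P.xc ^ 3 - 1) * (P.xc ^ 3 / P.yc ^ 2) := by
    rw [tc]; field_simp; ring
  rw [this, map_mul, v.map_neg, map_div₀, ← h1, div_self, mul_one]
  · exact h2
  · exact (v.ne_zero_iff).mpr (pow_ne_zero _ hy)

omit [DecidableEq F] in
/-- Coordinates of a point not reducing to the origin are integral. -/
theorem integral_of_not_inKer (hW : GoodAt v W) {P : W.Point} (h : ¬ InKer v P) :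
    P ≠ 0 ∧ v P.xc ≤ 1 ∧ v P.yc ≤ 1 := by
  have h0 : P ≠ 0 := fun h0 => h (Or.inl h0)
  have hx : v P.xc ≤ 1 := not_lt.mp fun h1 => h (Or.inr h1)
  refine ⟨h0, hx, ?_⟩
  by_contra hle
  rw [not_le] at hle
  have h7 : v (P.yc ^ 2) ≤ 1 := by
    rw [equation_coord h0]
    refine v.map_add_le (v.map_add_le ?_ ?_) hW.a₆_le
    · rw [map_pow]; exact pow_le_one₀ zero_le hx
    · rw [map_mul]; exact mul_le_one' hW.a₄_le hx
  rw [map_pow] at h7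
  exact absurd (one_lt_pow₀ hle (by norm_num)) (not_lt.mpr h7)

/-- Two points with the same reduction differ by a point reducing to the origin. -/
theorem inKer_sub (hW : GoodAt v W) {P Q : W.Point} (hP : ¬ InKer v P) (hQ : ¬ InKer v Q)
    (hx : v (P.xc - Q.xc) < 1) (hy : v (P.yc - Q.yc) < 1) : InKer v (P - Q) := by
  obtain ⟨hP0, hPx, hPy⟩ := integral_of_not_inKer hW hP
  obtain ⟨hQ0, hQx, hQy⟩ := integral_of_not_inKer hW hQ
  by_contra hK
  obtain ⟨hR0, hRx, hRy⟩ := integral_of_not_inKer hW hK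
  rw [sub_eq_add_neg] at hR0 hRx
  obtain ⟨ℓ, h1, -, hX, h2, -⟩ := exists_slope hP0 (neg_ne_zero.mpr hQ0) hR0
  rw [xc_neg] at h1 hX h2
  rw [yc_neg, sub_neg_eq_add] at h2
  have hℓ : v ℓ ≤ 1 := by
    by_contra hle
    rw [not_le] at hle
    have : v (ℓ ^ 2) ≤ 1 := by
      have : ℓ ^ 2 = (P + -Q).xc + P.xc + Q.xc := by rw [h1]; ring
      rw [this]
      exact v.map_add_le (v.map_add_le hRx hPx) hQx
    rw [map_pow] at this
    exact absurd (one_lt_pow₀ hle (by norm_num)) (not_lt.mpr this)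
  have h20 : (2 : F) ≠ 0 := fun h => by
    have := hW.two; rw [h, v.map_zero] at this; exact zero_ne_one this
  have hmul : ∀ {a b : F}, v a ≤ 1 → v b < 1 → v (a * b) < 1 := fun ha hb => by
    rw [map_mul]; exact (mul_le_of_le_one_left' ha).trans_lt hb
  have hy2 : v P.yc < 1 := by
    have : 2 * P.yc = (P.yc - Q.yc) + ℓ * (P.xc - Q.xc) := by rw [← h2]; ring
    have h3 : v (2 * P.yc) < 1 := by
      rw [this]; exact v.map_add_lt hy (hmul hℓ hx)
    rwa [map_mul, hW.two, one_mul] at h3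
  have hf : v (P.xc ^ 3 + W.a₄ * P.xc + W.a₆) < 1 := by
    rw [← equation_coord hP0, pow_two]; exact hmul hPy hy2
  have hf' : v (3 * P.xc ^ 2 + W.a₄) < 1 := by
    have e : 3 * P.xc ^ 2 + W.a₄ = 2 * ℓ * P.yc + (P.xc - ℓ ^ 2 + (P.xc + Q.xc)) * (P.xc - Q.xc) := by
      have e1 := hX 1
      have e2 := hX (-1)
      rw [h1] at e1 e2
      have e3 : (2 : F) * (3 * P.xc ^ 2 + W.a₄) = 2 * (2 * ℓ * P.yc + (P.xc - ℓ ^ 2 + (P.xc + Q.xc)) * (P.xc - Q.xc)) := by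
        linear_combination e2 - e1
      exact mul_left_cancel₀ h20 e3
    rw [e]
    apply v.map_add_lt
    · refine hmul ?_ hy2
      rw [map_mul, hW.two, one_mul]; exact hℓ
    · refine hmul ?_ hx
      refine v.map_add_le (v.map_sub_le ?_ ?_) (v.map_add_le hPx hQx)
      · exact hPx
      · rw [map_pow]; exact pow_le_one₀ zero_le hℓ
  have hdisc : 4 * W.a₄ ^ 3 + 27 * W.a₆ ^ 2
      = (4 * W.a₄ ^ 2 + P.xc * (6 * W.a₄ * P.xc - 9 * W.a₆)) * (3 * P.xc ^ 2 + W.a₄)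
        - 3 * (6 * W.a₄ * P.xc - 9 * W.a₆) * (P.xc ^ 3 + W.a₄ * P.xc + W.a₆) := by
    ring
  have hn : ∀ n : ℕ, ∀ {x : F}, v x ≤ 1 → v ((n : F) * x) ≤ 1 := fun n x hx => by
    rw [map_mul]; exact mul_le_one' (natCast_le_one v n) hx
  have hmul' : ∀ {a b : F}, v a ≤ 1 → v b ≤ 1 → v (a * b) ≤ 1 := fun ha hb => by
    rw [map_mul]; exact mul_le_one' ha hb
  have hg : v (6 * W.a₄ * P.xc - 9 * W.a₆) ≤ 1 := by
    refine v.map_sub_le ?_ (by exact_mod_cast hn 9 hW.a₆_le)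
    exact hmul' (by exact_mod_cast hn 6 hW.a₄_le) hPx
  have := hW.disc
  rw [hdisc] at this
  refine absurd this (ne_of_lt ?_)
  apply v.map_sub_lt
  · refine hmul (v.map_add_le ?_ (hmul' hPx hg)) hf'
    rw [map_mul, map_pow]
    exact mul_le_one' (by exact_mod_cast natCast_le_one v 4) (pow_le_one₀ zero_le hW.a₄_le)
  · exact hmul (by exact_mod_cast hn 3 hg) hf

theorem inKer_sub_or_add (hW : GoodAt v W) {P Q : W.Point} (hP : ¬ InKer v P)
    (hQ : ¬ InKer v Q) (hx : v (P.xc - Q.xc) < 1) : InKer v (P - Q) ∨ InKer v (P + Q) := by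
  obtain ⟨hP0, hPx, hPy⟩ := integral_of_not_inKer hW hP
  obtain ⟨hQ0, hQx, hQy⟩ := integral_of_not_inKer hW hQ
  have h : v (P.yc - Q.yc) * v (P.yc + Q.yc) < 1 := by
    rw [← map_mul]
    have : (P.yc - Q.yc) * (P.yc + Q.yc)
        = (P.xc ^ 2 + P.xc * Q.xc + Q.xc ^ 2 + W.a₄) * (P.xc - Q.xc) := by
      linear_combination equation_coord hP0 - equation_coord hQ0
    rw [this, map_mul]
    refine (mul_le_of_le_one_left' ?_).trans_lt hx
    refine v.map_add_le (v.map_add_le (v.map_add_le ?_ ?_) ?_) hW.a₄_le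
    · rw [map_pow]; exact pow_le_one₀ zero_le hPx
    · rw [map_mul]; exact mul_le_one' hPx hQx
    · rw [map_pow]; exact pow_le_one₀ zero_le hQx
  by_cases h1 : v (P.yc - Q.yc) < 1
  · exact Or.inl (inKer_sub hW hP hQ hx h1)
  · right
    have h2 : v (P.yc + Q.yc) < 1 := by
      by_contra h2
      rw [not_lt] at h1 h2
      exact absurd h (not_lt.mpr (one_le_mul h1 h2))
    rw [← sub_neg_eq_add P Q]
    refine inKer_sub hW hP (fun h => hQ (by simpa using h.neg)) (by rwa [xc_neg]) ?_
    rwa [yc_neg, sub_neg_eq_add]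

/-- The difference of the abscissas of points with essentially different reductions is a unit. -/
theorem map_xc_sub_eq_one (hW : GoodAt v W) {P Q : W.Point} (hP : ¬ InKer v P)
    (hQ : ¬ InKer v Q) (h1 : ¬ InKer v (P - Q)) (h2 : ¬ InKer v (P + Q)) :
    v (P.xc - Q.xc) = 1 := by
  refine le_antisymm ?_ (not_lt.mp fun h => (inKer_sub_or_add hW hP hQ h).elim h1 h2)
  exact v.map_sub_le (integral_of_not_inKer hW hP).2.1 (integral_of_not_inKer hW hQ).2.1

end WeierstrassCurve.Affine.Point

end

section

namespace WeierstrassCurve.Affine.Point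

variable {F : Type*} [Field F] [DecidableEq F] {Γ₀ : Type*} [LinearOrderedCommGroupWithZero Γ₀]
  {v : Valuation F Γ₀} {W : WeierstrassCurve.Affine F}

omit [DecidableEq F] in
theorem map_intCast_eq_one {p : ℕ} (hp : p.Prime) (hvp : v (p : F) < 1) {n : ℤ}
    (hn : ¬ (p : ℤ) ∣ n) : v (n : F) = 1 := by
  obtain ⟨a, b, hab⟩ : IsCoprime (p : ℤ) n :=
    ((Nat.prime_iff_prime_int.mp hp).coprime_iff_not_dvd).mpr hn
  have h : (1 : F) = (a : F) * (p : F) + (b : F) * (n : F) := by exact_mod_cast congrArg (Int.cast : ℤ → F) hab.symm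
  refine le_antisymm (intCast_le_one v n) (not_lt.mp fun hlt => ?_)
  have : v (1 : F) < 1 := by
    rw [h]
    apply v.map_add_lt
    · rw [map_mul]; exact (mul_le_of_le_one_left' (intCast_le_one v a)).trans_lt hvp
    · rw [map_mul]; exact (mul_le_of_le_one_left' (intCast_le_one v b)).trans_lt hlt
  rw [v.map_one] at this
  exact lt_irrefl _ this

omit [DecidableEq F] in
theorem map_natCast_eq_one {p : ℕ} (hp : p.Prime) (hvp : v (p : F) < 1) {n : ℕ}
    (hn : ¬ p ∣ n) : v (n : F) = 1 := by
  have := map_intCast_eq_one (v := v) hp hvp (n := n) (by exact_mod_cast hn)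
  exact_mod_cast this

omit [DecidableEq F] in
theorem dvd_of_map_intCast_lt_one {p : ℕ} (hp : p.Prime) (hvp : v (p : F) < 1) {n : ℤ}
    (hn : v (n : F) < 1) : (p : ℤ) ∣ n := by
  by_contra h
  exact absurd (map_intCast_eq_one hp hvp h) hn.ne

omit [DecidableEq F] in
theorem map_mul_sub_one_lt {a b : F} (ha : v (a - 1) < 1) (hb : v (b - 1) < 1) :
    v (a * b - 1) < 1 := by
  have h1 : v a = 1 := by
    have : a = 1 + (a - 1) := by ring
    rw [this, v.map_add_eq_of_lt_left (by rwa [v.map_one]), v.map_one]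
  have : a * b - 1 = a * (b - 1) + (a - 1) := by ring
  rw [this]
  refine v.map_add_lt ?_ ha
  rwa [map_mul, h1, one_mul]

omit [DecidableEq F] in
theorem map_prod_sub_one_lt {ι : Type*} (s : Finset ι) (f : ι → F)
    (h : ∀ i ∈ s, v (f i - 1) < 1) : v (∏ i ∈ s, f i - 1) < 1 := by
  classical
  induction s using Finset.induction_on with
  | empty => simp
  | insert i s hi ih =>
    rw [Finset.prod_insert hi]
    exact map_mul_sub_one_lt (h i (Finset.mem_insert_self _ _))
      (ih fun j hj => h j (Finset.mem_insert_of_mem hj))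

omit [DecidableEq F] in
theorem map_eq_one_of_sub_one_lt {a : F} (ha : v (a - 1) < 1) : v a = 1 := by
  have : a = 1 + (a - 1) := by ring
  rw [this, v.map_add_eq_of_lt_left (by rwa [v.map_one]), v.map_one]

omit [DecidableEq F] in
theorem map_sub_one_lt_of_mul {a b : F} (hb : v (b - 1) < 1) (hab : v (a * b - 1) < 1) :
    v (a - 1) < 1 := by
  have h1 := map_eq_one_of_sub_one_lt hb
  have h2 : v ((a - 1) * b) < 1 := by
    have : (a - 1) * b = (a * b - 1) - (b - 1) := by ring
    rw [this]; exact v.map_sub_lt hab hb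
  rwa [map_mul, h1, mul_one] at h2

/-- The effect on abscissas of an endomorphism `α` with finite kernel acting as `a` on the
tangent space. -/
def IsoFormula (α : W.Point →+ W.Point) (a : F) : Prop :=
  ∃ S : Finset W.Point, (∀ τ, τ ∈ S ↔ α τ = 0) ∧ ∀ P v₀ : W.Point, α P ≠ 0 → α (2 • v₀) ≠ 0 →
    a ^ 2 * ((α P).xc - (α v₀).xc) * ∏ τ ∈ S with τ ≠ 0, (P.xc - τ.xc)
      = ∏ τ ∈ S, (P.xc - (v₀ + τ).xc)

variable [W.IsShortNF]

theorem not_inKer_of_add (hW : GoodAt v W) {P Q : W.Point} {n : ℕ} (hn : v (n : F) = 1)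
    (hQ : n • Q = 0) {m : ℕ} (hmQ : m • Q ≠ 0) (hP : m • P = 0) : ¬ InKer v (Q + P) := by
  intro h
  have h1 : InKer v (m • (Q + P)) := (kerSubgroup hW).nsmul_mem h m
  rw [nsmul_add, hP, add_zero] at h1
  refine hmQ (h1.eq_zero_of_nsmul hW hn ?_)
  rw [smul_comm, hQ, nsmul_zero]

section Multiplication

variable {p q : ℕ}

/-- The data used to study the multiplication by the residue characteristic `p`, with the help
of an auxiliary point of order `q`. -/
structure MulData (v : Valuation F Γ₀) (W : WeierstrassCurve.Affine F) (p q : ℕ)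
    (S : Finset W.Point) (Q : W.Point) : Prop where
  good : GoodAt v W
  prime : p.Prime
  lt : v (p : F) < 1
  primeq : q.Prime
  five_le : 5 ≤ q
  ne : p ≠ q
  ne_zero : Q ≠ 0
  smul : q • Q = 0
  mem : ∀ τ, τ ∈ S ↔ p • τ = 0
  iso : ∀ P v₀ : W.Point, p • P ≠ 0 → p • 2 • v₀ ≠ 0 →
    (p : F) ^ 2 * ((p • P).xc - (p • v₀).xc) * ∏ τ ∈ S with τ ≠ 0, (P.xc - τ.xc)
      = ∏ τ ∈ S, (P.xc - (v₀ + τ).xc)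

variable {S : Finset W.Point} {Q : W.Point}

omit [W.IsShortNF] in
theorem MulData.mapq (h : MulData v W p q S Q) : v (q : F) = 1 :=
  map_natCast_eq_one h.prime h.lt fun hd => h.ne ((Nat.prime_dvd_prime_iff_eq h.prime h.primeq).mp hd)

omit [W.IsShortNF] in
theorem MulData.smul_ne_zero (h : MulData v W p q S Q) {n : ℕ} (hn : ¬ q ∣ n) : n • Q ≠ 0 := by
  intro h0
  have h1 := addOrderOf_eq_prime_iff (p := q) (x := Q) (hp := ⟨h.primeq⟩) |>.mpr ⟨h.smul, h.ne_zero⟩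
  exact hn (h1 ▸ addOrderOf_dvd_of_nsmul_eq_zero h0)

omit [W.IsShortNF] in
theorem MulData.not_dvd (h : MulData v W p q S Q) {n : ℕ} (hn : n ≠ 0) (hn5 : n < 5) : ¬ q ∣ p * n := by
  rw [h.primeq.dvd_mul, not_or]
  refine ⟨fun hd => h.ne ((Nat.prime_dvd_prime_iff_eq h.primeq h.prime).mp hd).symm, fun hd => ?_⟩
  have := Nat.le_of_dvd (Nat.pos_of_ne_zero hn) hd
  have := h.five_le
  omega

theorem MulData.not_inKer (h : MulData v W p q S Q) {n : ℕ} (hn : n ≠ 0) (hn5 : n < 5)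
    {τ : W.Point} (hτ : p • τ = 0) : ¬ InKer v (n • Q + τ) := by
  refine not_inKer_of_add h.good h.mapq (m := p) ?_ ?_ hτ
  · rw [smul_comm, h.smul, nsmul_zero]
  · rw [smul_smul]
    exact h.smul_ne_zero (h.not_dvd hn hn5)

theorem MulData.not_inKer_smul (h : MulData v W p q S Q) {n : ℕ} (hn : n ≠ 0) (hn5 : n < 5) :
    ¬ InKer v (p • n • Q) := by
  intro h1
  refine h.smul_ne_zero (h.not_dvd hn hn5) ?_
  rw [mul_smul]
  refine h1.eq_zero_of_nsmul h.good h.mapq ?_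
  rw [smul_comm q p, smul_comm q n, h.smul, nsmul_zero, nsmul_zero]

omit [DecidableEq F] [W.IsShortNF] in
theorem map_sub_of_inKer_right {P τ : W.Point} (hP : v P.xc ≤ 1) (hτ : 1 < v τ.xc) :
    v (P.xc - τ.xc) = v τ.xc := by
  rw [v.map_sub_swap, v.map_sub_eq_of_lt_left (hP.trans_lt hτ)]

open Classical in
theorem MulData.prod_aux (h : MulData v W p q S Q) :
    v (∏ τ ∈ S with τ ≠ 0, (Q.xc - τ.xc)) = ∏ τ ∈ S with τ ≠ 0 ∧ InKer v τ, v τ.xc := by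
  have hQ : ¬ InKer v Q := by simpa using h.not_inKer (n := 1) (by simp) (by simp) (nsmul_zero p)
  rw [map_prod, ← Finset.filter_filter,
    ← Finset.prod_filter_mul_prod_filter_not (S.filter (· ≠ 0)) (fun τ => InKer v τ)]
  have h1 : ∏ τ ∈ (S.filter (· ≠ 0)) with ¬ InKer v τ, v (Q.xc - τ.xc) = 1 := by
    refine Finset.prod_eq_one fun τ hτ => ?_
    simp only [Finset.mem_filter] at hτ
    have hτS := (h.mem τ).mp hτ.1.1
    refine map_xc_sub_eq_one h.good hQ hτ.2 ?_ ?_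
    · rw [sub_eq_add_neg]
      simpa using h.not_inKer (n := 1) (τ := -τ) (by simp) (by simp) (by rw [smul_neg, hτS, neg_zero])
    · simpa using h.not_inKer (n := 1) (τ := τ) (by simp) (by simp) hτS
  rw [h1, mul_one]
  refine Finset.prod_congr rfl fun τ hτ => ?_
  simp only [Finset.mem_filter] at hτ
  exact map_sub_of_inKer_right (integral_of_not_inKer h.good hQ).2.1 (hτ.2.lt hτ.1.2)

theorem MulData.smul_not (h : MulData v W p q S Q) {n : ℕ} (hn : n ≠ 0) (hn5 : n < 5) :
    p • n • Q ≠ 0 := fun h0 => h.not_inKer_smul hn hn5 (Or.inl h0)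

open Classical in
theorem MulData.prod_eq (h : MulData v W p q S Q) :
    v (p : F) ^ 2 * ∏ τ ∈ S with τ ≠ 0 ∧ InKer v τ, v τ.xc = 1 := by
  have hQ : ¬ InKer v Q := by simpa using h.not_inKer (n := 1) (by simp) (by simp) (nsmul_zero p)
  have e := congrArg v (h.iso Q (2 • Q) (by simpa using h.smul_not (n := 1) (by simp) (by simp))
    (by rw [smul_smul 2 2]; exact h.smul_not (n := 2 * 2) (by simp) (by simp)))
  rw [map_mul, map_mul, h.prod_aux, map_pow] at e
  have h1 : v ((p • Q).xc - (p • 2 • Q).xc) = 1 := by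
    refine map_xc_sub_eq_one h.good (by simpa using h.not_inKer_smul (n := 1) (by simp) (by simp))
      (h.not_inKer_smul (by simp) (by simp)) ?_ ?_
    · intro hk
      have h2 : p • Q - p • 2 • Q = -(p • 1 • Q) := by rw [← nsmul_sub, ← smul_neg]; congr 1; abel
      rw [h2] at hk
      exact h.not_inKer_smul (n := 1) (by simp) (by simp) (by simpa using hk.neg)
    · intro hk
      have h2 : p • Q + p • 2 • Q = p • 3 • Q := by rw [← nsmul_add]; abel_nf
      rw [h2] at hk
      exact h.not_inKer_smul (n := 3) (by simp) (by simp) hk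
  have h2 : v (∏ τ ∈ S, (Q.xc - (2 • Q + τ).xc)) = 1 := by
    rw [map_prod]
    refine Finset.prod_eq_one fun τ hτ => ?_
    have hτS := (h.mem τ).mp hτ
    refine map_xc_sub_eq_one h.good hQ (h.not_inKer (by simp) (by simp) hτS) ?_ ?_
    · intro hk
      have h2 : Q - (2 • Q + τ) = -(1 • Q + τ) := by abel
      rw [h2] at hk
      exact h.not_inKer (n := 1) (by simp) (by simp) hτS (by simpa using hk.neg)
    · intro hk
      have h2 : Q + (2 • Q + τ) = 3 • Q + τ := by abel
      rw [h2] at hk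
      exact h.not_inKer (n := 3) (by simp) (by simp) hτS hk
  rwa [h1, h2, mul_one] at e

/-- There is a nonzero `p`-torsion point reducing to the origin. -/
theorem MulData.exists_ker (h : MulData v W p q S Q) : ∃ τ : W.Point, τ ≠ 0 ∧ p • τ = 0 ∧ InKer v τ := by
  classical
  by_contra! hc
  have e := h.prod_eq
  rw [Finset.filter_false_of_mem, Finset.prod_empty, mul_one] at e
  · exact absurd e (pow_lt_one₀ zero_le h.lt (by norm_num)).ne
  · intro τ hτ h2
    exact hc τ h2.1 ((h.mem τ).mp hτ) h2.2

omit [W.IsShortNF] in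
theorem MulData.map_two (h : MulData v W p q S Q) : v ((2 : ℕ) : F) = 1 := by
  exact_mod_cast h.good.two

/-- The points reducing to the origin are divisible by `p` among themselves. -/
theorem MulData.exists_smul_eq (h : MulData v W p q S Q) {β : W.Point} (hβ : InKer v β)
    {v₀ : W.Point} (hv : p • v₀ = β) : ∃ ζ : W.Point, InKer v ζ ∧ p • ζ = β := by
  classical
  rcases eq_or_ne β 0 with rfl | hβ0
  · exact ⟨0, Or.inl rfl, nsmul_zero p⟩
  have hQ : ¬ InKer v Q := by simpa using h.not_inKer (n := 1) (by simp) (by simp) (nsmul_zero p)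
  by_contra! hc
  have e := congrArg v (h.iso Q v₀ (by simpa using h.smul_not (n := 1) (by simp) (by simp)) (by
    rw [smul_comm, hv]
    exact fun h0 => hβ0 (hβ.eq_zero_of_nsmul h.good h.map_two h0)))
  rw [map_mul, map_mul, h.prod_aux, map_pow, hv, mul_right_comm, h.prod_eq, one_mul,
    map_sub_of_inKer_right (integral_of_not_inKer h.good (by
      simpa using h.not_inKer_smul (n := 1) (by simp) (by simp))).2.1 (hβ.lt hβ0), map_prod] at e
  have h1 : ∏ τ ∈ S, v (Q.xc - (v₀ + τ).xc) ≤ 1 := by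
    refine Finset.prod_le_one' fun τ hτ => ?_
    have hτS := (h.mem τ).mp hτ
    have : ¬ InKer v (v₀ + τ) := fun hk => hc _ hk (by rw [nsmul_add, hτS, add_zero, hv])
    exact v.map_sub_le (integral_of_not_inKer h.good hQ).2.1 (integral_of_not_inKer h.good this).2.1
  rw [← e] at h1
  exact absurd (hβ.lt hβ0) (not_lt.mpr h1)

open Classical in
/-- Growth of the abscissa of a point reducing to the origin under multiplication by `p`. -/
theorem MulData.growth (h : MulData v W p q S Q) {η : W.Point} (hη : InKer v η)
    (hpη : p • η ≠ 0) :
    v η.xc * ∏ τ ∈ S with τ ≠ 0 ∧ InKer v τ, min (v η.xc) (v τ.xc) ≤ v (p • η).xc := by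
  have hη0 : η ≠ 0 := fun h0 => hpη (by rw [h0, nsmul_zero])
  have hQp : ¬ InKer v (p • Q) := by simpa using h.not_inKer_smul (n := 1) (by simp) (by simp)
  have hpk : InKer v (p • η) := (kerSubgroup h.good).nsmul_mem hη p
  have e := congrArg v (h.iso η Q hpη (h.smul_not (by simp) (by simp)))
  set s := v η.xc with hs
  have hs1 : 1 < s := hη.lt hη0
  have hs0 : 0 < s := zero_lt_one.trans hs1
  have h1 : v (∏ τ ∈ S, (η.xc - (Q + τ).xc)) = s ^ S.card := by
    rw [map_prod, Finset.prod_congr rfl, Finset.prod_const]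
    intro τ hτ
    have := h.not_inKer (n := 1) (τ := τ) (by simp) (by simp) ((h.mem τ).mp hτ)
    rw [one_nsmul] at this
    exact v.map_sub_eq_of_lt_left ((integral_of_not_inKer h.good this).2.1.trans_lt hs1)
  have hS0 : (0 : W.Point) ∈ S := (h.mem 0).mpr (nsmul_zero p)
  have h2 : v (∏ τ ∈ S with τ ≠ 0, (η.xc - τ.xc)) * s
      = (∏ τ ∈ S with τ ≠ 0 ∧ InKer v τ, v (η.xc - τ.xc)) * (s ^ (S.filter (fun τ => ¬ (τ ≠ 0 ∧ InKer v τ))).card) := by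
    rw [map_prod, ← Finset.filter_filter,
      ← Finset.prod_filter_mul_prod_filter_not (S.filter (· ≠ 0)) (fun τ => InKer v τ), mul_assoc]
    congr 1
    have : S.filter (fun τ => ¬ (τ ≠ 0 ∧ InKer v τ)) = insert 0 ((S.filter (· ≠ 0)).filter (fun τ => ¬ InKer v τ)) := by
      ext τ
      simp only [Finset.mem_filter, Finset.mem_insert]
      by_cases hτ : τ = 0
      · simp [hτ, hS0]
      · simp [hτ]
    rw [this, Finset.card_insert_of_notMem (by simp), pow_succ]
    congr 1
    rw [Finset.prod_congr rfl, Finset.prod_const]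
    intro τ hτ
    simp only [Finset.mem_filter] at hτ
    exact v.map_sub_eq_of_lt_left ((integral_of_not_inKer h.good hτ.2).2.1.trans_lt hs1)
  have h3 : v ((p • η).xc - (p • Q).xc) = v (p • η).xc :=
    v.map_sub_eq_of_lt_left ((integral_of_not_inKer h.good hQp).2.1.trans_lt (hpk.lt hpη))
  set K := S.filter (fun τ => τ ≠ 0 ∧ InKer v τ) with hK
  have hcard : s ^ S.card = s ^ K.card * s ^ (S.filter (fun τ => ¬ (τ ≠ 0 ∧ InKer v τ))).card := by
    rw [← pow_add, hK, Finset.card_filter_add_card_filter_not]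
  rw [map_mul, map_mul, map_pow, h1, h3, hcard] at e
  have hspos : 0 < s ^ (S.filter (fun τ => ¬ (τ ≠ 0 ∧ InKer v τ))).card := pow_pos hs0 _
  have e2 : v (p : F) ^ 2 * v (p • η).xc * (∏ τ ∈ K, v (η.xc - τ.xc)) = s ^ K.card * s := by
    refine mul_right_cancel₀ hspos.ne' ?_
    rw [mul_assoc _ (∏ τ ∈ K, v (η.xc - τ.xc)), ← h2, ← mul_assoc, e]
    ac_rfl
  have e3 : v (p • η).xc * (∏ τ ∈ K, v (η.xc - τ.xc)) = s * ∏ τ ∈ K, (s * v τ.xc) := by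
    rw [Finset.prod_mul_distrib, Finset.prod_const]
    calc _ = (v (p : F) ^ 2 * ∏ τ ∈ K, v τ.xc) * (v (p • η).xc * (∏ τ ∈ K, v (η.xc - τ.xc))) := by
          rw [h.prod_eq, one_mul]
      _ = (v (p : F) ^ 2 * v (p • η).xc * (∏ τ ∈ K, v (η.xc - τ.xc))) * ∏ τ ∈ K, v τ.xc := by ac_rfl
      _ = _ := by rw [e2]; ac_rfl
  have h4 : (∏ τ ∈ K, min s (v τ.xc)) * (∏ τ ∈ K, v (η.xc - τ.xc)) ≤ ∏ τ ∈ K, (s * v τ.xc) := by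
    rw [← Finset.prod_mul_distrib]
    refine Finset.prod_le_prod' fun τ _ => ?_
    rw [← min_mul_max s (v τ.xc)]
    exact mul_le_mul_right (v.map_sub _ _) _
  have h5 : (∏ τ ∈ K, v (η.xc - τ.xc)) ≠ 0 := by
    intro h0
    rw [h0, mul_zero, eq_comm, mul_eq_zero] at e2
    exact e2.elim (pow_pos hs0 _).ne' hs0.ne'
  refine le_of_mul_le_mul_right ?_ (zero_lt_iff.mpr h5)
  rw [e3, mul_assoc]
  exact mul_le_mul_right h4 _

end Multiplication

end WeierstrassCurve.Affine.Point

end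

section

namespace WeierstrassCurve.Affine.Point

variable {F : Type*} [Field F] [DecidableEq F] {Γ₀ : Type*} [LinearOrderedCommGroupWithZero Γ₀]
  {v : Valuation F Γ₀} {W : WeierstrassCurve.Affine F} [W.IsShortNF]
  {p q : ℕ} {S : Finset W.Point} {Q : W.Point}

omit [W.IsShortNF] in
theorem MulData.ne_of_lt (h : MulData v W p q S Q) {τ : W.Point} (hτ : τ ≠ 0) (hpτ : p • τ = 0)
    {i j : ℕ} (hi : i < p) (hj : j < p) (hij : i • τ = j • τ) : i = j := by
  have h1 : addOrderOf τ = p :=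
    (addOrderOf_eq_prime_iff (hp := ⟨h.prime⟩)).mpr ⟨hpτ, hτ⟩
  rw [nsmul_inj_mod, h1, Nat.mod_eq_of_lt hi, Nat.mod_eq_of_lt hj] at hij
  exact hij

open Classical in
/-- The multiples of a `p`-torsion point in the kernel of reduction. -/
theorem MulData.pow_le_prod (h : MulData v W p q S Q) {τ : W.Point} (hτ : InKer v τ) (hτ0 : τ ≠ 0)
    (hpτ : p • τ = 0) (f : Γ₀ → Γ₀) (hf : ∀ x, 1 ≤ x → 1 ≤ f x) :
    f (v τ.xc) ^ (p - 1) ≤ ∏ σ ∈ S with σ ≠ 0 ∧ InKer v σ, f (v σ.xc) := by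
  have hsub : (Finset.Ico 1 p).image (fun j => j • τ) ⊆ S.filter (fun σ => σ ≠ 0 ∧ InKer v σ) := by
    intro σ hσ
    simp only [Finset.mem_image, Finset.mem_Ico] at hσ
    obtain ⟨j, ⟨hj1, hj2⟩, rfl⟩ := hσ
    simp only [Finset.mem_filter]
    refine ⟨(h.mem _).mpr (by rw [smul_comm, hpτ, nsmul_zero]), fun h0 => ?_,
      (kerSubgroup h.good).nsmul_mem hτ j⟩
    have := h.ne_of_lt hτ0 hpτ hj2 h.prime.pos (by rw [h0, zero_nsmul])
    omega
  have hinj : Set.InjOn (fun j => j • τ) (Finset.Ico 1 p : Set ℕ) := by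
    intro i hi j hj hij
    simp only [Finset.coe_Ico, Set.mem_Ico] at hi hj
    exact h.ne_of_lt hτ0 hpτ hi.2 hj.2 hij
  have hprod : ∏ σ ∈ (Finset.Ico 1 p).image (fun j => j • τ), f (v σ.xc) = f (v τ.xc) ^ (p - 1) := by
    rw [Finset.prod_image hinj, Finset.prod_congr rfl, Finset.prod_const, Nat.card_Ico]
    intro j hj
    rw [Finset.mem_Ico] at hj
    rw [hτ.xc_nsmul_eq h.good hτ0]
    refine map_natCast_eq_one h.prime h.lt fun hd => ?_
    have := Nat.le_of_dvd (by omega) hd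
    omega
  rw [← hprod]
  refine Finset.prod_le_prod_of_subset_of_one_le' hsub fun σ hσ _ => hf _ ?_
  simp only [Finset.mem_filter] at hσ
  exact (hσ.2.2.lt hσ.2.1).le

theorem MulData.le_smul (h : MulData v W p q S Q) {η : W.Point} (hη : InKer v η)
    (hpη : p • η ≠ 0) : v η.xc ≤ v (p • η).xc := by
  classical
  refine le_trans (le_mul_of_one_le_right' ?_) (h.growth hη hpη)
  refine Finset.one_le_prod' fun σ hσ => ?_
  simp only [Finset.mem_filter] at hσ
  have hη0 : η ≠ 0 := fun h0 => hpη (by rw [h0, nsmul_zero])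
  exact le_min (hη.lt hη0).le (hσ.2.2.lt hσ.2.1).le

theorem MulData.le_pow_smul (h : MulData v W p q S Q) {η : W.Point} (hη : InKer v η) (n : ℕ)
    (hpη : p ^ n • η ≠ 0) : v η.xc ≤ v (p ^ n • η).xc := by
  induction n with
  | zero => simp
  | succ n ih =>
    rw [pow_succ', mul_smul] at hpη ⊢
    exact (ih fun h0 => hpη (by rw [h0, nsmul_zero])).trans
      (h.le_smul ((kerSubgroup h.good).nsmul_mem hη _) hpη)

theorem MulData.order_bound (h : MulData v W p q S Q) (n : ℕ) {ξ : W.Point} (hξ : InKer v ξ)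
    (h1 : p ^ n • ξ ≠ 0) (h2 : p ^ (n + 1) • ξ = 0) :
    v (p : F) ^ 2 * v ξ.xc ^ (p ^ n * (p - 1)) ≤ 1 := by
  classical
  have hp1 : 1 ≤ p := h.prime.one_lt.le
  induction n generalizing ξ with
  | zero =>
    rw [pow_zero, one_smul] at h1
    rw [zero_add, pow_one] at h2
    rw [pow_zero, one_mul, ← h.prod_eq]
    exact mul_le_mul_right (h.pow_le_prod hξ h1 h2 id fun x hx => hx) _
  | succ n ih =>
    have hpξ : p • ξ ≠ 0 := fun h0 => h1 (by rw [pow_succ, mul_smul, h0, nsmul_zero])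
    have hξ0 : ξ ≠ 0 := fun h0 => h1 (by rw [h0, nsmul_zero])
    refine le_trans (mul_le_mul_right ?_ _) (ih (ξ := p • ξ) ((kerSubgroup h.good).nsmul_mem hξ p)
      (by rwa [smul_smul, ← pow_succ]) (by rwa [smul_smul, ← pow_succ]))
    rw [pow_succ' p n, mul_assoc, pow_mul]
    refine pow_le_pow_left₀ zero_le ?_ _
    refine le_trans ?_ (h.growth hξ hpξ)
    have hτ := h.pow_le_prod (τ := p ^ (n + 1) • ξ) ((kerSubgroup h.good).nsmul_mem hξ _) h1
      (by rwa [smul_smul, ← pow_succ']) (fun x => min (v ξ.xc) x)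
      (fun x hx => le_min (hξ.lt hξ0).le hx)
    rw [min_eq_left (h.le_pow_smul hξ _ h1)] at hτ
    obtain ⟨m, rfl⟩ := Nat.exists_eq_add_of_le' hp1
    rw [Nat.add_sub_cancel] at hτ
    rw [pow_succ']
    exact mul_le_mul_right hτ _

/-- Lower bound for the local parameter of a point of order `p ^ (n + 1)` reducing to the
origin. -/
theorem MulData.le_tc_pow (h : MulData v W p q S Q) {n : ℕ} {ξ : W.Point} (hξ : InKer v ξ)
    (h1 : p ^ n • ξ ≠ 0) (h2 : p ^ (n + 1) • ξ = 0) :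
    v (p : F) ≤ v (tc ξ) ^ (p ^ n * (p - 1)) := by
  have hξ0 : ξ ≠ 0 := fun h0 => h1 (by rw [h0, nsmul_zero])
  have e1 := h.order_bound n hξ h1 h2
  have e2 := congrArg (· ^ (p ^ n * (p - 1))) (hξ.xc_mul_tc_sq h.good hξ0)
  simp only [mul_pow, one_pow] at e2
  set φ := p ^ n * (p - 1)
  rw [← pow_le_pow_iff_left₀ zero_le zero_le two_ne_zero, pow_right_comm]
  calc v (p : F) ^ 2 = v (p : F) ^ 2 * (v ξ.xc ^ φ * (v (tc ξ) ^ 2) ^ φ) := by rw [e2, mul_one]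
    _ = (v (p : F) ^ 2 * v ξ.xc ^ φ) * (v (tc ξ) ^ 2) ^ φ := by rw [mul_assoc]
    _ ≤ _ := mul_le_of_le_one_left' e1

end WeierstrassCurve.Affine.Point

end

section

section Group

variable {G : Type*} [AddCommGroup G] {p : ℕ}

theorem zsmul_of_torsion_card (hp : p.Prime) (E : AddSubgroup G) (hE : ∀ x, x ∈ E ↔ p • x = 0)
    (hcard : Nat.card E = p ^ 2) {A : AddSubgroup G} {τ : G} (hτ : τ ∈ A) (hτ0 : τ ≠ 0)
    (hpτ : p • τ = 0) (hA : ¬ E ≤ A) {x : G} (hx : x ∈ A) (hpx : p • x = 0) :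
    ∃ i : ℤ, x = i • τ := by
  have hfin : Finite E := Nat.finite_of_card_ne_zero (by rw [hcard]; exact pow_ne_zero _ hp.ne_zero)
  have hord : addOrderOf τ = p := (addOrderOf_eq_prime_iff (hp := ⟨hp⟩)).mpr ⟨hpτ, hτ0⟩
  have hle : AddSubgroup.zmultiples τ ≤ A ⊓ E := by
    rw [AddSubgroup.zmultiples_le]
    exact ⟨hτ, (hE τ).mpr hpτ⟩
  have hfin' : Finite (A ⊓ E : AddSubgroup G) :=
    Finite.of_injective _ (AddSubgroup.inclusion_injective (inf_le_right : A ⊓ E ≤ E))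
  have hdvd : Nat.card (A ⊓ E : AddSubgroup G) ∣ p ^ 2 := by
    rw [← hcard]; exact AddSubgroup.card_dvd_of_le inf_le_right
  obtain ⟨k, hk, hk'⟩ := (Nat.dvd_prime_pow hp).mp hdvd
  have hk1 : k ≤ 1 := by
    by_contra hk1
    obtain rfl : k = 2 := by omega
    refine hA ?_
    have := AddSubgroup.eq_of_le_of_card_ge (inf_le_right : A ⊓ E ≤ E) (by rw [hk', hcard])
    rw [← this]
    exact inf_le_left
  have heq := AddSubgroup.eq_of_le_of_card_ge hle (by
    rw [hk', Nat.card_zmultiples, hord]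
    calc p ^ k ≤ p ^ 1 := Nat.pow_le_pow_right hp.pos hk1
      _ = p := pow_one p)
  have : x ∈ AddSubgroup.zmultiples τ := by
    rw [heq]; exact ⟨hx, (hE x).mpr hpx⟩
  obtain ⟨i, hi⟩ := AddSubgroup.mem_zmultiples_iff.mp this
  exact ⟨i, hi.symm⟩

theorem zsmul_of_pow_torsion (hp : p.Prime) {A : AddSubgroup G} {ζ : G} {n : ℕ} (hζ : ζ ∈ A)
    (h1 : p ^ n • ζ ≠ 0) (h2 : p ^ (n + 1) • ζ = 0)
    (hA : ∀ x ∈ A, p • x = 0 → ∃ i : ℤ, x = i • p ^ n • ζ) (j : ℕ) (hj : j ≤ n + 1) {x : G}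
    (hx : x ∈ A) (hpx : p ^ j • x = 0) : ∃ i : ℤ, x = i • ζ := by
  induction j generalizing x with
  | zero => exact ⟨0, by simpa using hpx⟩
  | succ j ih =>
    obtain ⟨i, hi⟩ := ih (by omega) (A.nsmul_mem hx p) (by rwa [smul_smul, ← pow_succ])
    have h3 : i • p ^ n • ζ = 0 := by
      rw [smul_comm, ← hi, smul_smul, ← pow_succ]
      obtain ⟨m, hm⟩ := Nat.exists_eq_add_of_le hj
      rw [hm, pow_add, mul_comm, mul_smul, hpx, smul_zero]
    have hord : addOrderOf (p ^ n • ζ) = p := by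
      refine (addOrderOf_eq_prime_iff (hp := ⟨hp⟩)).mpr ⟨?_, h1⟩
      rwa [smul_smul, ← pow_succ']
    obtain ⟨i', rfl⟩ : (p : ℤ) ∣ i := by
      rw [← hord]; exact addOrderOf_dvd_iff_zsmul_eq_zero.mpr h3
    obtain ⟨l, hl⟩ := hA (x - i' • ζ) (A.sub_mem hx (A.zsmul_mem hζ i')) (by
      rw [nsmul_sub, hi, mul_smul, natCast_zsmul, sub_self])
    refine ⟨l * (p ^ n : ℕ) + i', ?_⟩
    rw [add_smul, mul_smul, natCast_zsmul, ← hl, sub_add_cancel]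

end Group

namespace WeierstrassCurve.Affine.Point

variable {F : Type*} [Field F] [DecidableEq F] {Γ₀ : Type*} [LinearOrderedCommGroupWithZero Γ₀]
  {v : Valuation F Γ₀} {W : WeierstrassCurve.Affine F} 
  {p q : ℕ} {S : Finset W.Point} {Q : W.Point} {α : W.Point →+ W.Point} {c : F} {T D : ℤ}

/-- The data used to study the reduction of a curve with a complex multiplication `α` whose
action on the tangent space is `c`. -/
structure CMData (v : Valuation F Γ₀) (W : WeierstrassCurve.Affine F) (p q : ℕ)
    (S : Finset W.Point) (Q : W.Point) (α : W.Point →+ W.Point) (c : F) (T D : ℤ) : Prop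
    extends MulData v W p q S Q where
  quad : c ^ 2 - T * c + D = 0
  quad_apply : ∀ P, α (α P) - T • α P + D • P = 0
  isoC : IsoFormula α c
  norm : ¬ (p : ℤ) ∣ D
  trace : ¬ (p : ℤ) ∣ T
  disc : ¬ (p : ℤ) ∣ T ^ 2 - 4 * D
  normq : ¬ (q : ℤ) ∣ D
  div : ∀ P : W.Point, ∃ R, p • R = P
  card : S.card = p ^ 2
  scalar : ∀ b : ℤ, ∃ P : W.Point, p • P = 0 ∧ α P ≠ b • P

variable (h : CMData v W p q S Q α c T D)

include h

theorem CMData.map_c : v c = 1 := by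
  have hD := map_intCast_eq_one h.prime h.lt h.norm
  have hc : v c ≤ 1 := by
    by_contra hlt
    rw [not_le] at hlt
    have e : c * c = T * c - D := by linear_combination h.quad
    have e1 : v (T * c - D) ≤ v c := by
      refine v.map_sub_le ?_ (hD.le.trans hlt.le)
      rw [map_mul]; exact mul_le_of_le_one_left' (intCast_le_one v T)
    rw [← e, map_mul] at e1
    exact absurd (lt_mul_of_one_lt_right (zero_lt_one.trans hlt) hlt) (not_lt.mpr e1)
  refine le_antisymm hc ?_
  rw [← hD]
  have e : (D : F) = c * (T - c) := by linear_combination h.quad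
  rw [e, map_mul]
  exact mul_le_of_le_one_right' (v.map_sub_le (intCast_le_one v T) hc)

theorem CMData.eq_zero_of_apply {τ : W.Point} (hτ : α τ = 0) : D.natAbs • τ = 0 := by
  have h1 := h.quad_apply τ
  rw [hτ, _root_.map_zero, smul_zero, sub_zero, zero_add] at h1
  obtain h2 | h2 := D.natAbs_eq
  · rwa [h2, natCast_zsmul] at h1
  · rwa [h2, neg_smul, natCast_zsmul, neg_eq_zero] at h1

theorem CMData.map_natAbs : v (D.natAbs : F) = 1 :=
  map_natCast_eq_one h.prime h.lt (by rw [← Int.natCast_dvd]; exact h.norm)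

variable [W.IsShortNF]

omit h in
theorem InKer.tc_zsmul_lt (hW : GoodAt v W) {P : W.Point} (hP : InKer v P) (hP0 : P ≠ 0)
    (n : ℤ) : v (tc (n • P) - n * tc P) < v (tc P) := by
  obtain ⟨m, rfl | rfl⟩ := n.eq_nat_or_neg
  · have := hP.tc_nsmul_lt hW hP0 m
    rwa [natCast_zsmul, Int.cast_natCast]
  · have := hP.tc_nsmul_lt hW hP0 m
    rw [neg_smul, natCast_zsmul, tc_neg, Int.cast_neg, Int.cast_natCast, neg_mul, ← neg_sub',
      v.map_neg]
    exact this

omit h in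
/-- The abscissa of a multiple of a point reducing to the origin. -/
theorem InKer.xc_zsmul (hW : GoodAt v W) {P : W.Point} (hP : InKer v P) (hP0 : P ≠ 0)
    {n : ℤ} (hn : v (n : F) = 1) : v (n ^ 2 * ((n • P).xc / P.xc) - 1) < 1 := by
  have hk : InKer v (n • P) := (kerSubgroup hW).zsmul_mem hP n
  have ht0 := hP.tc_ne_zero hW hP0
  have hn0' : (n : F) ≠ 0 := fun h0 => by rw [h0, v.map_zero] at hn; exact zero_ne_one hn
  have h1 : v (tc (n • P) / (n * tc P) - 1) < 1 := by
    have h1 := hP.tc_zsmul_lt hW hP0 n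
    have e : tc (n • P) / (n * tc P) - 1 = (tc (n • P) - n * tc P) / (n * tc P) := by
      field_simp
    rw [e, map_div₀, map_mul, hn, one_mul]
    exact (div_lt_one₀ (zero_lt_iff.mpr ((v.ne_zero_iff).mpr ht0))).mpr h1
  have hn0 : n • P ≠ 0 := by
    intro h0
    rw [h0, tc_zero, zero_div, zero_sub, v.map_neg, v.map_one] at h1
    exact lt_irrefl _ h1
  have hx0 := (coord_of_lt hW hP0 (hP.lt hP0)).2.1
  have h2 := map_mul_sub_one_lt (hP.xc_mul_tc_sq_sub_one hW hP0) (map_mul_sub_one_lt h1 h1)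
  refine map_sub_one_lt_of_mul h2 ?_
  have e : n ^ 2 * ((n • P).xc / P.xc) *
      (P.xc * tc P ^ 2 * (tc (n • P) / (n * tc P) * (tc (n • P) / (n * tc P))))
      = (n • P).xc * tc (n • P) ^ 2 := by
    field_simp
  rw [e]
  exact hk.xc_mul_tc_sq_sub_one hW hn0

omit [W.IsShortNF] in
theorem CMData.apply_aux : α (2 • Q) ≠ 0 ∧ D.natAbs • Q ≠ 0 := by
  have hq : ¬ q ∣ D.natAbs := by rw [← Int.natCast_dvd]; exact h.normq
  refine ⟨fun h0 => ?_, h.smul_ne_zero hq⟩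
  have h1 := h.eq_zero_of_apply h0
  rw [smul_smul] at h1
  refine h.smul_ne_zero (fun hd => ?_) h1
  rcases h.primeq.dvd_mul.mp hd with hd | hd
  · exact hq hd
  · have := Nat.le_of_dvd (by norm_num) hd
    have := h.five_le
    omega

/-- The effect of `α` on the points reducing to the origin. -/
theorem CMData.xc_apply {P : W.Point} (hP : InKer v P) (hP0 : P ≠ 0) :
    InKer v (α P) ∧ v (c ^ 2 * ((α P).xc / P.xc) - 1) < 1 := by
  obtain ⟨C, hC, hiso⟩ := h.isoC
  have hαP : α P ≠ 0 := fun h0 =>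
    hP0 (hP.eq_zero_of_nsmul h.good h.map_natAbs (h.eq_zero_of_apply h0))
  have e := hiso P Q hαP h.apply_aux.1
  have hx1 := hP.lt hP0
  have hx0 := (coord_of_lt h.good hP0 hx1).2.1
  have hone : ∀ x : F, v x ≤ 1 → v ((P.xc - x) / P.xc - 1) < 1 := by
    intro x hx
    have e : (P.xc - x) / P.xc - 1 = -(x / P.xc) := by field_simp; ring
    rw [e, v.map_neg, map_div₀]
    exact (div_lt_one₀ (zero_lt_one.trans hx1)).mpr (hx.trans_lt hx1)
  have h1 : v (∏ τ ∈ C with τ ≠ 0, ((P.xc - τ.xc) / P.xc) - 1) < 1 := by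
    refine map_prod_sub_one_lt _ _ fun τ hτ => hone _ ?_
    rw [Finset.mem_filter] at hτ
    refine (integral_of_not_inKer h.good fun hk => hτ.2 ?_).2.1
    exact hk.eq_zero_of_nsmul h.good h.map_natAbs (h.eq_zero_of_apply ((hC τ).mp hτ.1))
  have h2 : v (∏ τ ∈ C, ((P.xc - (Q + τ).xc) / P.xc) - 1) < 1 := by
    refine map_prod_sub_one_lt _ _ fun τ hτ => hone _ ?_
    refine (integral_of_not_inKer h.good ?_).2.1
    exact not_inKer_of_add h.good h.mapq h.smul h.apply_aux.2 (h.eq_zero_of_apply ((hC τ).mp hτ))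
  have hC0 : (0 : W.Point) ∈ C := (hC 0).mpr (_root_.map_zero α)
  have hcard : C.card = (C.filter (· ≠ 0)).card + 1 := by
    have : C.filter (· ≠ 0) = C.erase 0 := by
      ext τ; simp [Finset.mem_erase, and_comm]
    rw [this, Finset.card_erase_add_one hC0]
  have e2 : (c ^ 2 * (((α P).xc - (α Q).xc) / P.xc)) * ∏ τ ∈ C with τ ≠ 0, ((P.xc - τ.xc) / P.xc)
      = ∏ τ ∈ C, ((P.xc - (Q + τ).xc) / P.xc) := by
    rw [Finset.prod_div_distrib, Finset.prod_div_distrib, Finset.prod_const, Finset.prod_const,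
      hcard, ← e, pow_succ]
    generalize (∏ τ ∈ C with τ ≠ 0, (P.xc - τ.xc)) = Y
    field_simp
    ring
  have h3 := map_sub_one_lt_of_mul h1 (by rwa [e2])
  have hαQ : v (α Q).xc ≤ 1 := by
    refine (integral_of_not_inKer h.good fun hk => h.apply_aux.1 ?_).2.1
    rw [map_nsmul, hk.eq_zero_of_nsmul h.good h.mapq (by rw [← map_nsmul, h.smul, _root_.map_zero]),
      nsmul_zero]
  have h4 : v (c ^ 2 * ((α P).xc / P.xc) - 1) < 1 := by
    have e3 : c ^ 2 * ((α P).xc / P.xc) - 1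
        = (c ^ 2 * (((α P).xc - (α Q).xc) / P.xc) - 1) + c ^ 2 * ((α Q).xc / P.xc) := by
      field_simp; ring
    rw [e3]
    refine v.map_add_lt h3 ?_
    rw [map_mul, map_pow, h.map_c, one_pow, one_mul, map_div₀]
    exact (div_lt_one₀ (zero_lt_one.trans hx1)).mpr (hαQ.trans_lt hx1)
  refine ⟨Or.inr ?_, h4⟩
  have h5 := map_eq_one_of_sub_one_lt h4
  rw [map_mul, map_pow, h.map_c, one_pow, one_mul, map_div₀] at h5
  rw [div_eq_one_iff_eq (zero_lt_one.trans hx1).ne'] at h5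
  rwa [h5]

theorem CMData.inKer_apply {P : W.Point} (hP : InKer v P) : InKer v (α P) := by
  rcases eq_or_ne P 0 with rfl | hP0
  · rw [_root_.map_zero]; exact hP
  · exact (h.xc_apply hP hP0).1

theorem CMData.map_sub_lt {ζ : W.Point} (hζ : InKer v ζ) (hζ0 : ζ ≠ 0) {b : ℤ}
    (hb : α ζ = b • ζ) (hbp : (p : ℤ) ∣ b ^ 2 - T * b + D) : v (c - b) < 1 := by
  have hpb : v (b : F) = 1 := map_intCast_eq_one h.prime h.lt fun hd => h.norm (by
    have e : D = (b ^ 2 - T * b + D) - b * (b - T) := by ring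
    rw [e]
    exact Int.dvd_sub hbp (Dvd.dvd.mul_right hd _))
  have h1 := (h.xc_apply hζ hζ0).2
  have h2 := hζ.xc_zsmul h.good hζ0 hpb
  rw [hb] at h1
  have h3 := map_eq_one_of_sub_one_lt h2
  rw [map_mul, map_pow, hpb, one_pow, one_mul] at h3
  have h4 : v (c ^ 2 - b ^ 2) < 1 := by
    have h5 : v ((c ^ 2 - b ^ 2) * ((b • ζ).xc / ζ.xc)) < 1 := by
      have e : (c ^ 2 - b ^ 2) * ((b • ζ).xc / ζ.xc)
        = (c ^ 2 * ((b • ζ).xc / ζ.xc) - 1) - (b ^ 2 * ((b • ζ).xc / ζ.xc) - 1) := by ring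
      rw [e]; exact v.map_sub_lt h1 h2
    rwa [map_mul, h3, mul_one] at h5
  obtain ⟨m, hm⟩ := hbp
  have hm' : (b : F) ^ 2 - T * b + D = p * m := by exact_mod_cast congrArg (Int.cast : ℤ → F) hm
  have h6 : v (T * (c - b)) < 1 := by
    have e : T * (c - b) = (c ^ 2 - b ^ 2) + p * m := by linear_combination hm' - h.quad
    rw [e]
    refine v.map_add_lt h4 ?_
    rw [map_mul]
    exact (mul_le_of_le_one_right' (intCast_le_one v m)).trans_lt h.lt
  rwa [map_mul, map_intCast_eq_one h.prime h.lt h.trace, one_mul] at h6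

theorem CMData.exists_pow_smul_eq {τ : W.Point} (hτ : InKer v τ) (n : ℕ) :
    ∃ ζ : W.Point, InKer v ζ ∧ p ^ n • ζ = τ := by
  induction n with
  | zero => exact ⟨τ, hτ, by simp⟩
  | succ n ih =>
    obtain ⟨ζ, hζ, hζ'⟩ := ih
    obtain ⟨v₀, hv₀⟩ := h.div ζ
    obtain ⟨ζ₁, h1, h2⟩ := h.exists_smul_eq hζ hv₀
    exact ⟨ζ₁, h1, by rw [pow_succ, mul_smul, h2, hζ']⟩

theorem CMData.inKer_of_all (hall : ∀ P : W.Point, p • P = 0 → InKer v P) (n : ℕ)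
    {ξ : W.Point} (hξ : p ^ n • ξ = 0) : InKer v ξ := by
  induction n generalizing ξ with
  | zero => left; simpa using hξ
  | succ n ih =>
    have h1 : InKer v (p • ξ) := ih (by rwa [smul_smul, ← pow_succ])
    obtain ⟨ζ, hζ, hζ'⟩ := h.exists_smul_eq h1 rfl
    have h2 : InKer v (ξ - ζ) := hall _ (by rw [nsmul_sub, hζ', sub_self])
    have := h2.add h.good hζ
    rwa [sub_add_cancel] at this

/-- The `p`-power torsion points reducing to the origin contain an eigenspace of `α`. -/
theorem CMData.eigenspace (n : ℕ) :
    (∀ ξ : W.Point, p ^ (n + 1) • ξ = 0 → InKer v ξ) ∨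
    ∃ b : ℤ, ((p : ℤ) ^ (n + 1)) ∣ b ^ 2 - T * b + D ∧ v (c - b) < 1 ∧
      ∀ ξ : W.Point, p ^ (n + 1) • ξ = 0 → α ξ = b • ξ → InKer v ξ := by
  by_cases hall : ∀ P : W.Point, p • P = 0 → InKer v P
  · exact Or.inl fun ξ => h.inKer_of_all hall _
  right
  let E : AddSubgroup W.Point := (nsmulAddMonoidHom p : W.Point →+ W.Point).ker
  have hE : ∀ x, x ∈ E ↔ p • x = 0 := fun x => by
    simp [E, AddMonoidHom.mem_ker]
  have hcard : Nat.card E = p ^ 2 := by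
    rw [← h.card, ← Nat.card_eq_finsetCard]
    exact Nat.card_congr (Equiv.subtypeEquivRight fun x => by rw [hE, h.mem])
  obtain ⟨τ, hτ0, hpτ, hτ⟩ := h.exists_ker
  have hker : ∀ x ∈ kerSubgroup h.good, p • x = 0 → ∃ i : ℤ, x = i • τ := fun x hx hpx =>
    zsmul_of_torsion_card h.prime E hE hcard (A := kerSubgroup h.good) hτ hτ0 hpτ
      (fun hle => hall fun P hP => hle ((hE P).mpr hP)) hx hpx
  obtain ⟨ζ, hζ, hζτ⟩ := h.exists_pow_smul_eq hτ n
  have h1 : p ^ n • ζ ≠ 0 := by rwa [hζτ]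
  have h2 : p ^ (n + 1) • ζ = 0 := by rw [pow_succ', mul_smul, hζτ, hpτ]
  obtain ⟨b, hb⟩ := zsmul_of_pow_torsion h.prime (A := kerSubgroup h.good) hζ h1 h2
    (by rwa [hζτ]) (n + 1) le_rfl (x := α ζ) (h.inKer_apply hζ) (by rw [← map_nsmul, h2, _root_.map_zero])
  have hζ0 : ζ ≠ 0 := fun h0 => h1 (by rw [h0, nsmul_zero])
  have hbp : ((p : ℤ) ^ (n + 1)) ∣ b ^ 2 - T * b + D := by
    have hord : addOrderOf ζ = p ^ (n + 1) := addOrderOf_eq_prime_pow (hp := ⟨h.prime⟩) h1 h2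
    have h3 := h.quad_apply ζ
    rw [hb, map_zsmul, hb, smul_smul, smul_smul, ← sub_smul, ← add_smul] at h3
    have := addOrderOf_dvd_iff_zsmul_eq_zero.mpr h3
    rw [hord] at this
    rw [pow_two]
    exact_mod_cast this
  refine ⟨b, hbp, h.map_sub_lt hζ hζ0 hb ((dvd_pow_self _ (by omega)).trans hbp), ?_⟩
  let A : AddSubgroup W.Point := (α - zsmulAddGroupHom b).ker
  have hA : ∀ x, x ∈ A ↔ α x = b • x := fun x => by
    simp [A, AddMonoidHom.mem_ker, sub_eq_zero]
  have hτA : τ ∈ A := by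
    rw [hA, ← hζτ, map_nsmul, hb, smul_comm]
  intro ξ hξ hξb
  obtain ⟨i, rfl⟩ := zsmul_of_pow_torsion h.prime (A := A) ((hA ζ).mpr hb) h1 h2 (by
    rw [hζτ]
    refine fun x hx hpx => zsmul_of_torsion_card h.prime E hE hcard (A := A) hτA hτ0 hpτ
      (fun hle => ?_) hx hpx
    obtain ⟨P, hP, hP'⟩ := h.scalar b
    exact hP' ((hA P).mp (hle ((hE P).mpr hP)))) (n + 1) le_rfl ((hA ξ).mpr hξb) hξ
  exact (kerSubgroup h.good).zsmul_mem hζ i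

end WeierstrassCurve.Affine.Point

end

section

namespace WeierstrassCurve.Affine.Point

variable {F : Type*} [Field F] [DecidableEq F] {Γ₀ : Type*} [LinearOrderedCommGroupWithZero Γ₀]
  {v v' : Valuation F Γ₀} {W : WeierstrassCurve.Affine F} [W.IsShortNF]
  {p q : ℕ} {S : Finset W.Point} {Q : W.Point} {α : W.Point →+ W.Point} {c : F} {T D : ℤ}

theorem CMData.exists_inKer (h : CMData v W p q S Q α c T D) (h' : CMData v' W p q S Q α c T D)
    (hvv' : ∀ b : ℤ, v (c - b) < 1 → v' (c - (T - b : ℤ)) < 1) {n : ℕ} {ξ : W.Point}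
    (h1 : p ^ n • ξ ≠ 0) (h2 : p ^ (n + 1) • ξ = 0) :
    ∃ i j : ℤ, p ^ n • (i • α ξ + j • ξ) ≠ 0 ∧
      (InKer v (i • α ξ + j • ξ) ∨ InKer v' (i • α ξ + j • ξ)) := by
  obtain hall | ⟨b, hbN, hbv, hb⟩ := h.eigenspace n
  · exact ⟨0, 1, by simpa using h1, Or.inl (by simpa using hall ξ h2)⟩
  have hpN : (p : ℤ) ∣ (p : ℤ) ^ (n + 1) := dvd_pow_self _ (by omega)
  have hprime : Prime (p : ℤ) := Nat.prime_iff_prime_int.mp h.prime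
  have hdiff : ¬ (p : ℤ) ∣ T - 2 * b := by
    intro hd
    refine h.disc ?_
    have e : T ^ 2 - 4 * D = (T - 2 * b) * (T - 2 * b) - (b ^ 2 - T * b + D) * 4 := by ring
    rw [e]
    exact dvd_sub (hd.mul_right _) ((hpN.trans hbN).mul_right _)
  have hzero : ∀ m : ℤ, ((p : ℤ) ^ (n + 1)) ∣ m → m • ξ = 0 := by
    rintro m ⟨l, rfl⟩
    rw [mul_comm, mul_smul]
    have : ((p : ℤ) ^ (n + 1)) • ξ = 0 := by
      rw [← h2, ← natCast_zsmul, Nat.cast_pow]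
    rw [this, smul_zero]
  have hzero' : ∀ m : ℤ, ((p : ℤ) ^ (n + 1)) ∣ m → ∀ j : ℤ, m • (α ξ + j • ξ) = 0 := by
    intro m hm j
    rw [smul_add, ← map_zsmul, hzero m hm, smul_comm, hzero m hm, smul_zero, add_zero,
      _root_.map_zero]
  have htors : ∀ j : ℤ, p ^ (n + 1) • (α ξ + j • ξ) = 0 := by
    intro j
    have := hzero' _ dvd_rfl j
    rwa [← Nat.cast_pow, natCast_zsmul] at this
  have heig : ∀ x y : ℤ, x + y = T → ((p : ℤ) ^ (n + 1)) ∣ D - x * y →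
      α (α ξ + (-y) • ξ) = x • (α ξ + (-y) • ξ) := by
    intro x y hxy hd
    have e := h.quad_apply ξ
    have e2 := hzero _ hd
    rw [← hxy] at e
    rw [_root_.map_add, map_zsmul, ← sub_eq_zero]
    have e3 : α (α ξ) + -y • α ξ - x • (α ξ + -y • ξ)
        = (α (α ξ) - (x + y) • α ξ + D • ξ) - (D - x * y) • ξ := by
      module
    rw [e3, e, e2, sub_zero]
  have hbN' : ((p : ℤ) ^ (n + 1)) ∣ D - b * (T - b) := by
    have e : D - b * (T - b) = b ^ 2 - T * b + D := by ring
    rwa [e]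
  have hne : p ^ n • (α ξ + (-(T - b)) • ξ) ≠ 0 ∨ p ^ n • (α ξ + (-b) • ξ) ≠ 0 := by
    by_contra hcon
    rw [not_or, not_not, not_not] at hcon
    have e : (T - 2 * b) • (p ^ n • ξ)
        = p ^ n • (α ξ + (-b) • ξ) - p ^ n • (α ξ + (-(T - b)) • ξ) := by
      module
    rw [hcon.1, hcon.2, sub_zero] at e
    have hord : addOrderOf (p ^ n • ξ) = p :=
      (addOrderOf_eq_prime_iff (hp := ⟨h.prime⟩)).mpr ⟨by rwa [smul_smul, ← pow_succ'], h1⟩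
    refine hdiff ?_
    have := addOrderOf_dvd_iff_zsmul_eq_zero.mpr e
    rwa [hord] at this
  obtain hne | hne := hne
  · refine ⟨1, -(T - b), by rwa [one_smul], Or.inl ?_⟩
    rw [one_smul]
    exact hb _ (htors _) (heig b (T - b) (by ring) hbN')
  · refine ⟨1, -b, by rwa [one_smul], Or.inr ?_⟩
    rw [one_smul]
    obtain hall | ⟨b', hbN2, hbv', hb'⟩ := h'.eigenspace n
    · exact hall _ (htors _)
    have h5 : (p : ℤ) ∣ b' - (T - b) := by
      refine dvd_of_map_intCast_lt_one (v := v') h'.prime h'.lt ?_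
      have e : ((b' - (T - b) : ℤ) : F) = (c - (T - b : ℤ)) - (c - b') := by push_cast; ring
      rw [e]
      exact v'.map_sub_lt (hvv' b hbv) hbv'
    have h6 : ¬ (p : ℤ) ∣ b' - b := by
      intro hd
      refine hdiff ?_
      have e : T - 2 * b = (b' - b) - (b' - (T - b)) := by ring
      rw [e]; exact dvd_sub hd h5
    have h7 : ((p : ℤ) ^ (n + 1)) ∣ (b' - (T - b)) * (b' - b) := by
      have e : (b' - (T - b)) * (b' - b) = (b' ^ 2 - T * b' + D) - (D - b * (T - b)) := by ring
      rw [e]; exact dvd_sub hbN2 hbN'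
    have h8 : ((p : ℤ) ^ (n + 1)) ∣ b' - (T - b) :=
      (IsCoprime.pow_left ((Prime.coprime_iff_not_dvd hprime).mpr h6)).dvd_of_dvd_mul_right h7
    refine hb' _ (htors _) ?_
    rw [heig (T - b) b (by ring) (by rwa [mul_comm])]
    have := hzero' _ h8 (-b)
    rw [sub_smul, sub_eq_zero] at this
    exact this.symm

/-- Some point in the module generated by `ξ` has large ramification at one of two conjugate
valuations. -/
theorem CMData.exists_le_tc_pow (h : CMData v W p q S Q α c T D)
    (h' : CMData v' W p q S Q α c T D)
    (hvv' : ∀ b : ℤ, v (c - b) < 1 → v' (c - (T - b : ℤ)) < 1) {n : ℕ} {ξ : W.Point}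
    (h1 : p ^ n • ξ ≠ 0) (h2 : p ^ (n + 1) • ξ = 0) :
    ∃ i j : ℤ, ∃ u : Valuation F Γ₀, (u = v ∨ u = v') ∧ u (tc (i • α ξ + j • ξ)) < 1 ∧
      u p ≤ u (tc (i • α ξ + j • ξ)) ^ (p ^ n * (p - 1)) := by
  obtain ⟨i, j, h3, h4⟩ := h.exists_inKer h' hvv' h1 h2
  have h5 : p ^ (n + 1) • (i • α ξ + j • ξ) = 0 := by
    rw [smul_add, smul_comm _ i, smul_comm _ j, ← map_nsmul, h2, _root_.map_zero, smul_zero,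
      smul_zero, zero_add]
  have h0 : i • α ξ + j • ξ ≠ 0 := fun h0 => h3 (by rw [h0, nsmul_zero])
  obtain h4 | h4 := h4
  · exact ⟨i, j, v, Or.inl rfl, h4.tc_lt_one h.good h0, h.le_tc_pow h4 h3 h5⟩
  · exact ⟨i, j, v', Or.inr rfl, h4.tc_lt_one h'.good h0, h'.le_tc_pow h4 h3 h5⟩

end WeierstrassCurve.Affine.Point

end

section

section Extension

open Cardinal in
theorem IsAlgClosed.exists_ringEquiv_algebraMap {R K L : Type*} [CommRing R] [Nontrivial R]
    [Countable R] [Field K] [Field L] [IsAlgClosed K] [IsAlgClosed L] [Algebra R K] [Algebra R L]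
    [FaithfulSMul R K] [FaithfulSMul R L] (hK : ℵ₀ < Cardinal.mk K) (e : K ≃ L) :
    ∃ σ : K ≃+* L, ∀ r, σ (algebraMap R K r) = algebraMap R L r := by
  obtain ⟨s, hs⟩ := exists_isTranscendenceBasis R K
  obtain ⟨t, ht⟩ := exists_isTranscendenceBasis R L
  have hR : Cardinal.mk R ≤ ℵ₀ := mk_le_aleph0_iff.mpr inferInstance
  have hL : ℵ₀ < Cardinal.mk L := by
    have := Cardinal.lift_mk_eq'.mpr ⟨e⟩
    rw [← aleph0_lt_lift, this, aleph0_lt_lift] at hK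
    exact hK
  have h1 : Cardinal.mk K = Cardinal.mk s := by
    simpa using IsAlgClosed.cardinal_eq_cardinal_transcendence_basis_of_aleph0_lt _ hs hR hK
  have h2 : Cardinal.mk L = Cardinal.mk t := by
    simpa using IsAlgClosed.cardinal_eq_cardinal_transcendence_basis_of_aleph0_lt _ ht hR hL
  obtain ⟨e₁⟩ := Cardinal.eq.mp h1
  obtain ⟨e₂⟩ := Cardinal.eq.mp h2
  let := IsAlgClosed.isAlgClosure_of_transcendence_basis _ hs
  let := IsAlgClosed.isAlgClosure_of_transcendence_basis _ ht
  let e' : Algebra.adjoin R (Set.range ((↑) : s → K)) ≃ₐ[R]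
      Algebra.adjoin R (Set.range ((↑) : t → L)) :=
    (hs.1.aevalEquiv.symm.trans (MvPolynomial.renameEquiv R ((e₁.symm.trans e).trans e₂))).trans
      ht.1.aevalEquiv
  refine ⟨IsAlgClosure.equivOfEquiv K L e'.toRingEquiv, fun r => ?_⟩
  have h1 := IsAlgClosure.equivOfEquiv_algebraMap K L (hSR := e'.toRingEquiv) (algebraMap R _ r)
  have h2 : e'.toRingEquiv (algebraMap R _ r) = algebraMap R _ r := e'.commutes r
  rw [h2] at h1
  exact h1

/-- Two embeddings of a countable domain in `ℂ` differ by a field automorphism of `ℂ`. -/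
theorem Complex.exists_ringEquiv_comp_eq {R : Type*} [CommRing R] [Nontrivial R] [Countable R]
    {f g : R →+* ℂ} (hf : Function.Injective f) (hg : Function.Injective g) :
    ∃ σ : ℂ ≃+* ℂ, ∀ r, σ (f r) = g r :=
  @IsAlgClosed.exists_ringEquiv_algebraMap R ℂ ℂ _ _ _ _ _ _ _ f.toAlgebra g.toAlgebra
    (@FaithfulSMul.mk _ _ f.toAlgebra.toSMul fun {a b} h => hf (by
      have h1 : f a * 1 = f b * 1 := h 1
      simpa using h1))
    (@FaithfulSMul.mk _ _ g.toAlgebra.toSMul fun {a b} h => hg (by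
      have h1 : g a * 1 = g b * 1 := h 1
      simpa using h1))
    (by rw [Cardinal.mk_complex]; exact Cardinal.aleph0_lt_continuum) (Equiv.refl ℂ)

variable {k : Subfield ℂ} 

theorem Complex.exists_algEquiv_comp_eq {R : Type*} [CommRing R] [Nontrivial R] [Countable R]
    [Algebra k R] {f g : R →ₐ[k] ℂ} (hf : Function.Injective f) (hg : Function.Injective g) :
    ∃ σ : ℂ ≃ₐ[k] ℂ, ∀ r, σ (f r) = g r := by
  obtain ⟨σ, hσ⟩ := Complex.exists_ringEquiv_comp_eq (f := f.toRingHom) (g := g.toRingHom) hf hg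
  refine ⟨AlgEquiv.ofRingEquiv (f := σ) fun x => ?_, hσ⟩
  have := hσ (algebraMap k R x)
  simpa using this

variable [NumberField k]

theorem countable_of_algebraic (K L : Type*) [Field K] [Field L] [Algebra K L] [Countable K]
    [Algebra.IsAlgebraic K L] : Countable L := by
  rw [← Cardinal.mk_le_aleph0_iff, ← Cardinal.lift_le_aleph0]
  refine (Algebra.IsAlgebraic.lift_cardinalMk_le_max K L).trans ?_
  simp

theorem NumberField.countable (K : Type*) [Field K] [NumberField K] : Countable K :=
  countable_of_algebraic ℚ K

instance : Countable k := NumberField.countable k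

theorem Complex.exists_algEquiv_of_transcendental {x y : ℂ} (hx : Transcendental k x)
    (hy : Transcendental k y) : ∃ σ : ℂ ≃ₐ[k] ℂ, σ x = y := by
  have : Countable (Polynomial k) := by
    rw [← Cardinal.mk_le_aleph0_iff]
    exact Polynomial.cardinalMk_le_max.trans (max_le (Cardinal.mk_le_aleph0_iff.mpr inferInstance) le_rfl)
  obtain ⟨σ, hσ⟩ := Complex.exists_algEquiv_comp_eq (k := k) (f := Polynomial.aeval x)
    (g := Polynomial.aeval y) (transcendental_iff_injective.mp hx) (transcendental_iff_injective.mp hy)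
  exact ⟨σ, by simpa using hσ Polynomial.X⟩

open IntermediateField in
/-- Automorphisms of `ℂ` over a number field act transitively on conjugates. -/
theorem Complex.exists_algEquiv_of_aeval_minpoly (M : IntermediateField k ℂ)
    [FiniteDimensional k M] {x y : ℂ} (hx : IsIntegral M x)
    (hy : Polynomial.aeval y (minpoly M x) = 0) :
    ∃ σ : ℂ ≃ₐ[k] ℂ, (∀ m ∈ M, σ m = m) ∧ σ x = y := by
  have : FiniteDimensional M M⟮x⟯ := adjoin.finiteDimensional hx
  have : FiniteDimensional k M⟮x⟯ := FiniteDimensional.trans k M M⟮x⟯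
  have : Countable M⟮x⟯ := countable_of_algebraic k M⟮x⟯
  have hroot : y ∈ (minpoly M x).aroots ℂ :=
    (Polynomial.mem_aroots).mpr ⟨minpoly.ne_zero hx, hy⟩
  let g : M⟮x⟯ →ₐ[M] ℂ := (algHomAdjoinIntegralEquiv M hx).symm ⟨y, hroot⟩
  obtain ⟨σ, hσ⟩ := Complex.exists_algEquiv_comp_eq (k := k) (f := (M⟮x⟯.val).restrictScalars k)
    (g := g.restrictScalars k) Subtype.val_injective g.toRingHom.injective
  refine ⟨σ, fun m hm => ?_, ?_⟩
  · have := hσ (algebraMap M M⟮x⟯ ⟨m, hm⟩)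
    simpa using this
  · have h1 := hσ (AdjoinSimple.gen M x)
    have h2 : g (AdjoinSimple.gen M x) = y :=
      algHomAdjoinIntegralEquiv_symm_apply_gen M hx ⟨y, hroot⟩
    have h3 : (g.restrictScalars k) (AdjoinSimple.gen M x) = y := h2
    rw [h3] at h1
    simpa using h1

theorem Complex.isAlgebraic_of_finite_orbit {x : ℂ} {s : Set ℂ} (hs : s.Finite)
    (h : ∀ σ : ℂ ≃ₐ[k] ℂ, σ x ∈ s) : IsAlgebraic k x := by
  by_contra hx
  have hinj : Function.Injective fun n : ℕ => x + n := fun a b hab => by simpa using hab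
  refine Set.infinite_range_of_injective hinj (hs.subset ?_)
  rintro _ ⟨n, rfl⟩
  have hn : Transcendental k (x + n) := by
    intro hn
    refine hx ?_
    have := hn.sub (isAlgebraic_algebraMap (R := k) (A := ℂ) (n : k))
    simpa using this
  obtain ⟨σ, hσ⟩ := Complex.exists_algEquiv_of_transcendental (k := k) hx hn
  exact Set.mem_of_eq_of_mem hσ.symm (h σ)

/-- The fixed field of the automorphisms of `ℂ` over a number field. -/
theorem Complex.mem_of_forall_algEquiv (M : IntermediateField k ℂ)
    [FiniteDimensional k M] {x : ℂ} (h : ∀ σ : ℂ ≃ₐ[k] ℂ, (∀ m ∈ M, σ m = m) → σ x = x)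
    (hx : IsAlgebraic k x) : x ∈ M := by
  have hinteg : IsIntegral M x := (hx.isIntegral).tower_top
  have hsep : (minpoly M x).Separable := (minpoly.irreducible hinteg).separable
  have hsplit : ((minpoly M x).map (algebraMap M ℂ)).Splits :=
    IsAlgClosed.splits _
  have hdeg : (minpoly M x).natDegree = 1 := by
    have h1 := Polynomial.card_rootSet_eq_natDegree (K := ℂ) hsep hsplit
    have h2 : (minpoly M x).rootSet ℂ = {x} := by
      refine Set.eq_singleton_iff_unique_mem.mpr ⟨?_, fun y hy => ?_⟩
      · exact (Polynomial.mem_rootSet).mpr ⟨minpoly.ne_zero hinteg, minpoly.aeval _ _⟩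
      · obtain ⟨σ, hσ, rfl⟩ := Complex.exists_algEquiv_of_aeval_minpoly M hinteg
          ((Polynomial.mem_rootSet).mp hy).2
        exact h σ hσ
    rw [← h1, ← Nat.card_eq_fintype_card, h2]
    simp
  obtain ⟨m, hm⟩ := minpoly.natDegree_eq_one_iff.mp hdeg
  rw [← hm]
  exact m.2

end Extension

end

section

namespace NumberField

open IsDedekindDomain

section Center

variable {M : Type*} [Field M] [NumberField M] {Γ₀ : Type*} [LinearOrderedCommGroupWithZero Γ₀]
  (u : Valuation M Γ₀)

omit [NumberField M] in
theorem map_ringOfIntegers_le_one (x : 𝓞 M) : u x ≤ 1 := by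
  have hx : IsIntegral ℤ (x : M) := x.2
  have h1 : IsIntegral u.valuationSubring (x : M) := hx.tower_top
  obtain ⟨y, hy⟩ := IsIntegrallyClosed.isIntegral_iff.mp h1
  rw [← hy]
  exact y.2

/-- The center of a valuation on the ring of integers of a number field. -/
def center : Ideal (𝓞 M) where
  carrier := {x | u x < 1}
  add_mem' := fun {a b} ha hb => by
    simpa using u.map_add_lt ha hb
  zero_mem' := by simp
  smul_mem' := fun c {x} hx => by
    simpa using (mul_le_of_le_one_left' (map_ringOfIntegers_le_one u c)).trans_lt hx

omit [NumberField M] in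
theorem mem_center {x : 𝓞 M} : x ∈ center u ↔ u x < 1 := Iff.rfl

instance center_isPrime : (center u).IsPrime := by
  refine Ideal.isPrime_iff.mpr ⟨?_, fun {x y} h => ?_⟩
  · rw [Ne, Ideal.eq_top_iff_one, mem_center]
    simp
  · simp only [mem_center, map_mul] at h ⊢
    by_contra! hcon
    have h1 := (map_ringOfIntegers_le_one u x).antisymm hcon.1
    have h2 := (map_ringOfIntegers_le_one u y).antisymm hcon.2
    rw [h1, h2, one_mul] at h
    exact lt_irrefl _ h

omit [NumberField M] in
theorem map_eq_one_of_not_mem_center {x : 𝓞 M} (hx : x ∉ center u) : u x = 1 :=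
  (map_ringOfIntegers_le_one u x).antisymm (not_lt.mp hx)

variable {p : ℕ} (hp : p.Prime) (hup : u (p : M) < 1)

include hp hup

theorem center_ne_bot : center u ≠ ⊥ := by
  intro h
  have h1 : (p : 𝓞 M) ∈ center u := by simpa [mem_center] using hup
  rw [h, Ideal.mem_bot] at h1
  exact hp.ne_zero (by exact_mod_cast h1)

theorem exists_div_of_map_le_one {b : M} (hb : u b ≤ 1) :
    ∃ x y : 𝓞 M, u y = 1 ∧ b = x / y := by
  let P : HeightOneSpectrum (𝓞 M) := ⟨center u, inferInstance, center_ne_bot u hp hup⟩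
  obtain ⟨n, d, h⟩ := P.exists_primeCompl_mul_eq_or_mul_eq (K := M) b
  have hd : u (algebraMap (𝓞 M) M d) = 1 := map_eq_one_of_not_mem_center u d.2
  obtain h | h := h
  · refine ⟨n, d, hd, ?_⟩
    rw [eq_div_iff, h]
    exact fun h0 => by simp [show algebraMap (𝓞 M) M d = 0 from h0] at hd
  · have hn : u (algebraMap (𝓞 M) M n) = 1 := by
      refine (map_ringOfIntegers_le_one u n).antisymm ?_
      rw [← hd, ← h, map_mul]
      exact mul_le_of_le_one_left' hb
    refine ⟨d, n, hn, ?_⟩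
    rw [eq_div_iff, h]
    exact fun h0 => by simp [show algebraMap (𝓞 M) M n = 0 from h0] at hn

/-- Integral elements fall in finitely many residue classes. -/
theorem exists_map_sub_lt_one {b : ℕ → M × M} (hb : ∀ i, u (b i).1 ≤ 1 ∧ u (b i).2 ≤ 1) :
    ∃ i j, i < j ∧ u ((b i).1 - (b j).1) < 1 ∧ u ((b i).2 - (b j).2) < 1 := by
  choose x y hy hxy using fun i => exists_div_of_map_le_one u hp hup (hb i).1
  choose z w hw hzw using fun i => exists_div_of_map_le_one u hp hup (hb i).2
  have : Finite (𝓞 M ⧸ center u) := Ideal.finiteQuotientOfFreeOfNeBot _ (center_ne_bot u hp hup)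
  let f : ℕ → (𝓞 M ⧸ center u) × (𝓞 M ⧸ center u) × (𝓞 M ⧸ center u) × (𝓞 M ⧸ center u) :=
    fun i => (Ideal.Quotient.mk _ (x i), Ideal.Quotient.mk _ (y i), Ideal.Quotient.mk _ (z i),
      Ideal.Quotient.mk _ (w i))
  have key : ∀ {x y x' y' : 𝓞 M}, u y = 1 → u y' = 1 →
      Ideal.Quotient.mk (center u) x = Ideal.Quotient.mk _ x' →
      Ideal.Quotient.mk (center u) y = Ideal.Quotient.mk _ y' →
      u ((x : M) / y - x' / y') < 1 := by
    intro x y x' y' hy hy' h1 h2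
    rw [Ideal.Quotient.eq, mem_center] at h1 h2
    have hy0 : (y : M) ≠ 0 := fun h0 => by rw [h0, map_zero] at hy; exact zero_ne_one hy
    have hy0' : (y' : M) ≠ 0 := fun h0 => by rw [h0, map_zero] at hy'; exact zero_ne_one hy'
    have e : (x : M) / y - x' / y'
        = ((x - x' : 𝓞 M) * (y : M) - x * (y - y' : 𝓞 M)) / (y * y') := by
      push_cast; field_simp; ring
    rw [e, map_div₀, map_mul, hy, hy', one_mul, div_one]
    refine u.map_sub_lt ?_ ?_
    · rw [map_mul, hy, mul_one]; exact h1
    · rw [map_mul]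
      exact (mul_le_of_le_one_left' (map_ringOfIntegers_le_one u x)).trans_lt h2
  obtain ⟨i, j, hij, hf⟩ : ∃ i j, i < j ∧ f i = f j := by
    obtain ⟨i, j, hij, hf⟩ := Finite.exists_ne_map_eq_of_infinite f
    obtain h | h := lt_or_gt_of_ne hij
    · exact ⟨i, j, h, hf⟩
    · exact ⟨j, i, h, hf.symm⟩
  simp only [f, Prod.mk.injEq] at hf
  refine ⟨i, j, hij, ?_, ?_⟩
  · rw [hxy, hxy]; exact key (hy i) (hy j) hf.1 hf.2.1
  · rw [hzw, hzw]; exact key (hw i) (hw j) hf.2.2.1 hf.2.2.2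

end Center

section Galois

variable {k M : Type*} [Field k] [NumberField k] [Field M] [NumberField M] [Algebra k M]
  [IsGalois k M] {Γ₀ : Type*} [LinearOrderedCommGroupWithZero Γ₀] (u : Valuation M Γ₀) {p : ℕ}

/-- If inertia is trivial and `p` does not ramify in the base field, then `p` is a
uniformizer. -/
theorem exists_map_eq_zpow (hp : p.Prime) (hup : u (p : M) < 1)
    (hdisc : ¬ (p : ℤ) ∣ discr k)
    (hinert : ∀ σ : M ≃ₐ[k] M, (∀ b, u b ≤ 1 → u (σ b - b) < 1) → σ = 1) {a : M} (ha : a ≠ 0) :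
    ∃ n : ℤ, u a = u p ^ n := by
  have hpz : Prime (p : ℤ) := Nat.prime_iff_prime_int.mp hp
  let P : HeightOneSpectrum (𝓞 M) := ⟨center u, inferInstance, center_ne_bot u hp hup⟩
  let v : HeightOneSpectrum ℤ := ⟨Ideal.span {(p : ℤ)},
    (Ideal.span_singleton_prime hpz.ne_zero).mpr hpz, by
      simpa using hp.ne_zero⟩
  have hover : P.asIdeal.LiesOver v.asIdeal :=
    (Ideal.liesOver_span_iff P.isPrime.ne_top hpz).mpr (by
      change ((p : ℤ) : 𝓞 M) ∈ center u
      rw [mem_center]; simpa using hup)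
  let Q : Ideal (𝓞 k) := P.asIdeal.under (𝓞 k)
  have hinert1 : Nat.card (P.asIdeal.inertia Gal(M/k)) = 1 := by
    rw [Nat.card_eq_one_iff_unique]
    refine ⟨⟨fun a b => ?_⟩, ⟨1⟩⟩
    have : ∀ σ : P.asIdeal.inertia Gal(M/k), σ = 1 := by
      rintro ⟨σ, hσ⟩
      refine Subtype.ext (hinert σ fun b hb => ?_)
      obtain ⟨x, y, hy, rfl⟩ := exists_div_of_map_le_one u hp hup hb
      have h1 : ∀ x : 𝓞 M, u (σ x - x) < 1 := fun x => hσ x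
      have hσy : u (σ y) = 1 := by
        have e : σ (y : M) = (σ y - y) + y := by ring
        rw [e, u.map_add_eq_of_lt_right (by rw [hy]; exact h1 y), hy]
      have hy0 : (y : M) ≠ 0 := fun h0 => by rw [h0, map_zero] at hy; exact zero_ne_one hy
      have hy0' : σ (y : M) ≠ 0 := fun h0 => by rw [h0, map_zero] at hσy; exact zero_ne_one hσy
      have e : σ ((x : M) / y) - x / y
        = ((σ x - x) * (y : M) - x * (σ y - y)) / (σ y * y) := by
        rw [map_div₀]; field_simp; ring
      rw [e, map_div₀, map_mul, hy, hσy, one_mul, div_one]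
      refine u.map_sub_lt ?_ ?_
      · rw [map_mul, hy, mul_one]; exact h1 x
      · rw [map_mul]
        exact (mul_le_of_le_one_left' (map_ringOfIntegers_le_one u x)).trans_lt (h1 y)
    rw [this a, this b]
  have he1 : P.asIdeal.ramificationIdx (𝓞 k) = 1 := by
    have : IsGaloisGroup Gal(M/k) (𝓞 k) (𝓞 M) := IsGaloisGroup.of_isFractionRing Gal(M/k) (𝓞 k) (𝓞 M) k M
    rw [← Ideal.ramificationIdxIn_eq_ramificationIdx Q P.asIdeal Gal(M/k),
      ← Ideal.card_inertia_eq_ramificationIdxIn (G := Gal(M/k)) Q P.asIdeal, hinert1]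
  have he2 : Q.ramificationIdx ℤ = 1 := by
    have := (not_dvd_discr_iff_forall_mem k (𝓞 k) hpz).mp hdisc Q inferInstance (by
      change ((p : ℤ) : 𝓞 k) ∈ Ideal.comap (algebraMap (𝓞 k) (𝓞 M)) (center u)
      rw [Ideal.mem_comap, mem_center]; simpa using hup)
    exact Q.ramificationIdx_eq_one ℤ
  have he : v.asIdeal.ramificationIdx' P.asIdeal = 1 := by
    rw [Ideal.ramificationIdx'_eq_ramificationIdx _ _ v.ne_bot,
      Ideal.ramificationIdx_tower Q P.asIdeal, he1, he2]
  have hval : P.valuation M (p : M) = WithZero.exp (-1 : ℤ) := by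
    have := HeightOneSpectrum.intValuation_liesOver v P (p : ℤ)
    rw [he, pow_one, v.intValuation_singleton hpz.ne_zero rfl] at this
    rw [this, ← HeightOneSpectrum.valuation_of_algebraMap (K := M)]
    simp
  have ha0 : P.valuation M a ≠ 0 := (Valuation.ne_zero_iff _).mpr ha
  have hp0 : (p : M) ≠ 0 := by exact_mod_cast hp.ne_zero
  have hup0 : u (p : M) ≠ 0 := (Valuation.ne_zero_iff _).mpr hp0
  refine ⟨- WithZero.log (P.valuation M a), ?_⟩
  set n := - WithZero.log (P.valuation M a) with hn
  have hb : P.valuation M (a / p ^ n) = 1 := by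
    rw [map_div₀, map_zpow₀, hval, ← WithZero.exp_zsmul, hn, div_eq_one_iff_eq (by simp)]
    simp [WithZero.exp_log ha0]
  suffices u (a / p ^ n) = 1 by
    rwa [map_div₀, map_zpow₀, div_eq_one_iff_eq (zpow_ne_zero _ hup0)] at this
  have hunit : ∀ x : 𝓞 M, P.valuation M (x : M) = 1 → u x = 1 := fun x hx =>
    map_eq_one_of_not_mem_center u fun hmem => by
      have := (HeightOneSpectrum.valuation_lt_one_iff_mem (K := M) P x).mpr hmem
      exact absurd hx this.ne
  obtain ⟨m, d, h⟩ := P.exists_primeCompl_mul_eq_or_mul_eq (K := M) (a / p ^ n)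
  have hd : u (algebraMap (𝓞 M) M d) = 1 := map_eq_one_of_not_mem_center u d.2
  have hd' : P.valuation M (algebraMap (𝓞 M) M d) = 1 :=
    (P.valuation_le_one _).antisymm (not_lt.mp fun hlt =>
      d.2 ((HeightOneSpectrum.valuation_lt_one_iff_mem (K := M) P _).mp hlt))
  obtain h | h := h
  · have hm : u (algebraMap (𝓞 M) M m) = 1 := hunit m (by
      change P.valuation M (algebraMap (𝓞 M) M m) = 1
      rw [← h, map_mul, hb, hd', one_mul])
    rw [← h, map_mul, hd, mul_one] at hm
    exact hm
  · have hm : u (algebraMap (𝓞 M) M m) = 1 := hunit m (by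
      change P.valuation M (algebraMap (𝓞 M) M m) = 1
      rw [← h, map_mul, hb, one_mul] at hd'
      exact hd')
    rw [← h, map_mul, hm, mul_one] at hd
    exact hd

end Galois

end NumberField

end

section

section TorsionIndex

open MulAction

variable {G A : Type*} [Group G] [AddCommGroup A] [DistribMulAction G A]

/-- The elements of `G` acting trivially on the `m`-torsion of `A`. -/
def torsionFixer (G A : Type*) [Group G] [AddCommGroup A] [DistribMulAction G A] (m : ℕ) :
    Subgroup G where
  carrier := {g | ∀ P : A, m • P = 0 → g • P = P}
  mul_mem' := fun {a b} ha hb P hP => by rw [mul_smul, hb P hP, ha P hP]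
  one_mem' := fun P _ => one_smul G P
  inv_mem' := fun {a} ha P hP => by rw [inv_smul_eq_iff, ha P hP]

theorem torsionFixer_le {m m' : ℕ} (h : m ∣ m') : torsionFixer G A m' ≤ torsionFixer G A m := by
  intro g hg P hP
  obtain ⟨d, rfl⟩ := h
  exact hg P (by rw [mul_comm, mul_smul, hP, smul_zero])

theorem stabilizer_le_stabilizer_nsmul (n : ℕ) (P : A) :
    stabilizer G P ≤ stabilizer G (n • P) := by
  intro g hg
  rw [mem_stabilizer_iff] at hg ⊢
  rw [smul_comm, hg]

theorem stabilizer_index_ne_zero (hfin : ∀ n : ℕ, 0 < n → {P : A | n • P = 0}.Finite) {n : ℕ}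
    (hn : 0 < n) {P : A} (hP : n • P = 0) : (stabilizer G P).index ≠ 0 := by
  rw [index_stabilizer]
  have hsub : orbit G P ⊆ {P : A | n • P = 0} := by
    rintro _ ⟨g, rfl⟩
    change n • g • P = 0
    rw [smul_comm, hP, smul_zero]
  exact (Set.ncard_pos ((hfin n hn).subset hsub)).mpr ⟨P, mem_orbit_self P⟩ |>.ne'

theorem stabilizer_relIndex_ne_zero (hfin : ∀ n : ℕ, 0 < n → {P : A | n • P = 0}.Finite) {n : ℕ}
    (hn : 0 < n) {P : A} (hP : n • P = 0) (K : Subgroup G) : (stabilizer G P).relIndex K ≠ 0 := by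
  have : (stabilizer G P).FiniteIndex := ⟨stabilizer_index_ne_zero hfin hn hP⟩
  exact (inferInstance : ((stabilizer G P).subgroupOf K).FiniteIndex).index_ne_zero

variable {m₀ p : ℕ}

theorem fixed_or_exists_translate (hp2 : p ^ 2 ∣ m₀) (n : ℕ) {ξ : A}
    (hξ : p ^ n • ξ = 0) : (∀ g ∈ torsionFixer G A m₀, g • ξ = ξ) ∨
      ∃ g ∈ torsionFixer G A m₀, ∃ η : A, η ≠ 0 ∧ p • η = 0 ∧ g • ξ = ξ + η := by
  induction n generalizing ξ with
  | zero =>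
    rw [pow_zero, one_smul] at hξ
    left
    intro g _
    rw [hξ, smul_zero]
  | succ n ih =>
    obtain h | ⟨g, hg, η, hη0, hη, hgη⟩ := ih (ξ := p • ξ) (by rw [smul_smul, ← pow_succ, hξ])
    · by_cases hfix : ∀ g ∈ torsionFixer G A m₀, g • ξ = ξ
      · exact Or.inl hfix
      push Not at hfix
      obtain ⟨g, hg, hgξ⟩ := hfix
      refine Or.inr ⟨g, hg, g • ξ - ξ, sub_ne_zero.mpr hgξ, ?_, by abel⟩
      rw [smul_sub, smul_comm, h g hg, sub_self]
    · right
      have h1 : p • (g • ξ - ξ) = η := by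
        rw [smul_sub, smul_comm, hgη]; abel
      have h2 : g • (g • ξ - ξ) = g • ξ - ξ := by
        refine torsionFixer_le hp2 hg _ ?_
        rw [pow_two, mul_smul, h1, hη]
      have h3 : ∀ i : ℕ, g ^ i • ξ = ξ + i • (g • ξ - ξ) := by
        intro i
        induction i with
        | zero => simp
        | succ i ihi =>
          rw [pow_succ', mul_smul, ihi, smul_add, smul_comm g i, h2, succ_nsmul]
          abel
      exact ⟨g ^ p, pow_mem hg p, η, hη0, hη, by rw [h3, h1]⟩

theorem prime_dvd_relIndex (hp : p.Prime) (hpm : p ∣ m₀) {ξ η : A} {g : G}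
    (hg : g ∈ torsionFixer G A m₀) (hη0 : η ≠ 0) (hη : p • η = 0) (hgη : g • ξ = ξ + η) :
    p ∣ (stabilizer G ξ).relIndex (stabilizer G (p • ξ) ⊓ torsionFixer G A m₀) := by
  let K := stabilizer G (p • ξ) ⊓ torsionFixer G A m₀
  have hK : ∀ h : K, p • ((h : G) • ξ - ξ) = 0 := by
    intro h
    have := h.2.1
    change (h : G) • p • ξ = p • ξ at this
    rw [smul_sub, smul_comm, this, sub_self]
  let f : K →* Multiplicative A :=
    { toFun := fun h => Multiplicative.ofAdd ((h : G) • ξ - ξ)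
      map_one' := by simp
      map_mul' := by
        intro a b
        rw [← ofAdd_add]
        congr 1
        have := torsionFixer_le hpm a.2.2 _ (hK b)
        rw [smul_sub] at this
        rw [Subgroup.coe_mul, mul_smul]
        rw [sub_eq_iff_eq_add] at this
        rw [this]
        abel }
  have hker : f.ker = (stabilizer G ξ).subgroupOf K := by
    ext h
    rw [MonoidHom.mem_ker, Subgroup.mem_subgroupOf, mem_stabilizer_iff]
    change Multiplicative.ofAdd ((h : G) • ξ - ξ) = 1 ↔ _
    rw [ofAdd_eq_one, sub_eq_zero]
  have hgK : g ∈ K := by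
    refine ⟨?_, hg⟩
    change g • p • ξ = p • ξ
    rw [smul_comm, hgη, smul_add, hη, add_zero]
  change p ∣ ((stabilizer G ξ).subgroupOf K).index
  rw [← hker, Subgroup.index_ker]
  have h1 : f ⟨g, hgK⟩ = Multiplicative.ofAdd η := by
    change Multiplicative.ofAdd (g • ξ - ξ) = _
    rw [hgη]; congr 1; abel
  have h2 : orderOf (f ⟨g, hgK⟩) = p := by
    rw [h1]
    have : Fact p.Prime := ⟨hp⟩
    refine orderOf_eq_prime ?_ (by simpa using hη0)
    rw [← ofAdd_nsmul, hη]; rfl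
  rw [← h2, ← Subgroup.orderOf_mk (H := f.range) _ ⟨_, rfl⟩]
  exact orderOf_dvd_natCard _

theorem relIndex_mul_relIndex_inf {P Q : A} (h : stabilizer G P ≤ stabilizer G Q)
    (H : Subgroup G) : (stabilizer G Q).relIndex H * (stabilizer G P).relIndex (stabilizer G Q ⊓ H)
      = (stabilizer G P).relIndex H := by
  have h1 := Subgroup.relIndex_mul_relIndex (stabilizer G P ⊓ H) (stabilizer G Q ⊓ H) H
    (inf_le_inf_right H h) inf_le_right
  rw [Subgroup.inf_relIndex_right, Subgroup.inf_relIndex_right] at h1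
  rw [← h1, mul_comm]
  congr 1
  rw [← Subgroup.inf_relIndex_right (stabilizer G P), ← Subgroup.inf_relIndex_right (stabilizer G P ⊓ H)]
  congr 1
  ext g
  simp only [Subgroup.mem_inf]
  tauto

theorem pow_dvd_relIndex (hp : p.Prime) (hp2 : p ^ 2 ∣ m₀) {e : ℕ}
    (he : ∀ (n : ℕ) (ξ : A), p ^ n • ξ = 0 → (∀ g : G, g ∈ torsionFixer G A m₀ → g • ξ = ξ) →
      p ^ e • ξ = 0) (n : ℕ) {ξ : A} (hξ : addOrderOf ξ = p ^ n) :
    p ^ n ∣ p ^ e * (stabilizer G ξ).relIndex (torsionFixer G A m₀) := by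
  induction n generalizing ξ with
  | zero => simp
  | succ n ih =>
    have hξ0 : p ^ (n + 1) • ξ = 0 := by rw [← hξ]; exact addOrderOf_nsmul_eq_zero ξ
    obtain h | ⟨g, hg, η, hη0, hη, hgη⟩ :=
      fixed_or_exists_translate (G := G) hp2 (n + 1) hξ0
    · rw [← hξ]
      exact Dvd.dvd.mul_right (addOrderOf_dvd_of_nsmul_eq_zero (he _ ξ hξ0 h)) _
    · have h1 := prime_dvd_relIndex hp ((dvd_pow_self p two_ne_zero).trans hp2) hg hη0 hη hgη
      have h2 : addOrderOf (p • ξ) = p ^ n := by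
        rw [addOrderOf_nsmul' ξ hp.ne_zero, hξ, Nat.gcd_eq_right (dvd_pow_self p (by omega)),
          pow_succ, Nat.mul_div_cancel _ hp.pos]
      rw [← relIndex_mul_relIndex_inf (stabilizer_le_stabilizer_nsmul p ξ), ← mul_assoc, pow_succ]
      exact mul_dvd_mul (ih h2) h1

/-- The main counting argument: lower bounds for orbits of points of prime power order combine to
a lower bound for all torsion points. -/
theorem exists_totient_le_index (hm₀ : 0 < m₀)
    (hfin : ∀ n : ℕ, 0 < n → {P : A | n • P = 0}.Finite)
    (hsq : ∀ p : ℕ, p.Prime → p ∣ m₀ → p ^ 2 ∣ m₀)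
    (hbad : ∀ p : ℕ, p.Prime → p ∣ m₀ → ∃ e : ℕ, ∀ (n : ℕ) (ξ : A), p ^ n • ξ = 0 →
      (∀ g : G, g ∈ torsionFixer G A m₀ → g • ξ = ξ) → p ^ e • ξ = 0)
    (hgood : ∀ p : ℕ, p.Prime → ¬ p ∣ m₀ → ∀ m : ℕ, 0 < m → m₀ ∣ m → ¬ p ∣ m → ∀ (n : ℕ) (ξ : A),
      p ^ n • ξ ≠ 0 → p ^ (n + 1) • ξ = 0 →
      p ^ n * (p - 1) ≤ (stabilizer G ξ).relIndex (torsionFixer G A m)) :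
    ∃ C : ℕ, 0 < C ∧ ∀ (N : ℕ) (ξ : A), 0 < N → addOrderOf ξ = N →
      N.totient ≤ C * (stabilizer G ξ).index := by
  choose! e he using hbad
  set C := ∏ p ∈ m₀.primeFactors, p ^ e p with hC
  have hC0 : 0 < C := Finset.prod_pos fun p hp => pow_pos (Nat.prime_of_mem_primeFactors hp).pos _
  have key : ∀ (N : ℕ) (ξ : A), 0 < N → addOrderOf ξ = N →
      N.totient ≤ C * (stabilizer G ξ).relIndex (torsionFixer G A m₀) := by
    intro N
    induction N using Nat.strong_induction_on with
    | _ N ih =>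
    intro ξ hN hξ
    have hNξ : N • ξ = 0 := by rw [← hξ]; exact addOrderOf_nsmul_eq_zero ξ
    have hr0 := stabilizer_relIndex_ne_zero hfin hN hNξ (torsionFixer G A m₀)
    by_cases hall : ∀ p : ℕ, p.Prime → p ∣ N → p ∣ m₀
    · refine (Nat.totient_le N).trans (Nat.le_of_dvd (Nat.pos_of_ne_zero
        (mul_ne_zero hC0.ne' hr0)) ?_)
      rw [Nat.dvd_iff_prime_pow_dvd_dvd]
      intro p j hp hj
      obtain rfl | hj0 := Nat.eq_zero_or_pos j
      · simp
      have hpm : p ∣ m₀ := hall p hp ((dvd_pow_self p hj0.ne').trans hj)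
      obtain ⟨d, hd⟩ := hj
      have hd0 : d ≠ 0 := fun h => by simp [h] at hd; omega
      have h1 : addOrderOf (d • ξ) = p ^ j := by
        rw [addOrderOf_nsmul' ξ hd0, hξ, Nat.gcd_eq_right ⟨_, by rw [hd, mul_comm]⟩, hd,
          Nat.mul_div_cancel _ (Nat.pos_of_ne_zero hd0)]
      have h2 := pow_dvd_relIndex hp (hsq p hp hpm) (he p hp hpm) j h1
      refine h2.trans (mul_dvd_mul ?_ ?_)
      · exact Finset.dvd_prod_of_mem (fun p => p ^ e p)
          (Nat.mem_primeFactors.mpr ⟨hp, hpm, hm₀.ne'⟩)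
      · exact Subgroup.relIndex_dvd_of_le_left _ (stabilizer_le_stabilizer_nsmul d ξ)
    · push Not at hall
      obtain ⟨p, hp, hpN, hpm⟩ := hall
      obtain ⟨j, N', hN', hNN'⟩ := Nat.exists_eq_pow_mul_and_not_dvd hN.ne' p hp.ne_one
      have hj : j ≠ 0 := by
        rintro rfl
        rw [pow_zero, one_mul] at hNN'
        exact hN' (hNN' ▸ hpN)
      obtain ⟨n, rfl⟩ := Nat.exists_eq_succ_of_ne_zero hj
      rw [Nat.succ_eq_add_one] at hNN'
      have hN'0 : N' ≠ 0 := fun h => by simp [h] at hN'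
      have hpn0 : p ^ (n + 1) ≠ 0 := pow_ne_zero _ hp.ne_zero
      have hcop : Nat.Coprime (p ^ (n + 1)) N' :=
        Nat.Coprime.pow_left _ ((Nat.Prime.coprime_iff_not_dvd hp).mpr hN')
      have ho1 : addOrderOf (p ^ (n + 1) • ξ) = N' := by
        rw [addOrderOf_nsmul' ξ hpn0, hξ, Nat.gcd_eq_right ⟨_, hNN'⟩, hNN',
          Nat.mul_div_cancel_left _ (Nat.pos_of_ne_zero hpn0)]
      have ho2 : addOrderOf (N' • ξ) = p ^ (n + 1) := by
        rw [addOrderOf_nsmul' ξ hN'0, hξ, Nat.gcd_eq_right ⟨_, by rw [hNN', mul_comm]⟩, hNN',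
          Nat.mul_div_cancel _ (Nat.pos_of_ne_zero hN'0)]
      have hlt : N' < N := by
        rw [hNN']
        exact lt_mul_of_one_lt_left (Nat.pos_of_ne_zero hN'0) (Nat.one_lt_pow (by omega) hp.one_lt)
      have hζ0 : p ^ (n + 1) • N' • ξ = 0 := by rw [← ho2]; exact addOrderOf_nsmul_eq_zero _
      have hζ1 : p ^ n • N' • ξ ≠ 0 := by
        intro h
        have := addOrderOf_dvd_of_nsmul_eq_zero h
        rw [ho2] at this
        exact absurd ((Nat.pow_dvd_pow_iff_le_right hp.one_lt).mp this) (by omega)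
      have h1 := hgood p hp hpm (m₀ * N') (Nat.mul_pos hm₀ (Nat.pos_of_ne_zero hN'0))
        (dvd_mul_right _ _) (fun h => (hp.dvd_mul.mp h).elim hpm hN') n (N' • ξ) hζ1 hζ0
      have h2 := ih N' hlt (p ^ (n + 1) • ξ) (Nat.pos_of_ne_zero hN'0) ho1
      rw [hNN', Nat.totient_mul hcop, Nat.totient_prime_pow_succ hp,
        ← relIndex_mul_relIndex_inf (stabilizer_le_stabilizer_nsmul (p ^ (n + 1)) ξ),
        mul_comm (p ^ n * (p - 1)) N'.totient, ← mul_assoc C]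
      refine Nat.mul_le_mul h2 (h1.trans ?_)
      refine le_trans ?_ (Nat.le_of_dvd (Nat.pos_of_ne_zero ?_)
        (Subgroup.relIndex_dvd_of_le_left _ (stabilizer_le_stabilizer_nsmul N' ξ)))
      · refine Subgroup.relIndex_le_of_le_right (le_inf ?_ (torsionFixer_le (dvd_mul_right _ _))) ?_
        · intro g hg
          refine torsionFixer_le (dvd_mul_left N' m₀) hg _ ?_
          rw [← ho1]; exact addOrderOf_nsmul_eq_zero _
        · exact stabilizer_relIndex_ne_zero hfin (pow_pos hp.pos _) hζ0 _
      · exact stabilizer_relIndex_ne_zero hfin hN hNξ _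
  refine ⟨C, hC0, fun N ξ hN hξ => (key N ξ hN hξ).trans (Nat.mul_le_mul_left _ ?_)⟩
  have hNξ : N • ξ = 0 := by rw [← hξ]; exact addOrderOf_nsmul_eq_zero ξ
  rw [← Subgroup.relIndex_top_right]
  exact Subgroup.relIndex_le_of_le_right le_top (stabilizer_relIndex_ne_zero hfin hN hNξ ⊤)

end TorsionIndex

end

section

theorem Valuation.map_le_one_of_isIntegral {F Γ₀ : Type*} [Field F]
    [LinearOrderedCommGroupWithZero Γ₀] (v : Valuation F Γ₀) {x : F} (hx : IsIntegral ℤ x) :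
    v x ≤ 1 := by
  have h1 : IsIntegral v.valuationSubring x := hx.tower_top
  obtain ⟨y, hy⟩ := IsIntegrallyClosed.isIntegral_iff.mp h1
  rw [← hy]
  exact y.2

theorem Complex.exists_valuation_lt_one {p : ℕ} (hp : p.Prime) :
    ∃ (Γ₀ : Type) (_ : LinearOrderedCommGroupWithZero Γ₀) (v : Valuation ℂ Γ₀), v (p : ℂ) < 1 := by
  have hI : Ideal.span {((p : ℤ) : (Int.castRingHom ℂ).range)} ≠ ⊤ := by
    rw [Ne, Ideal.eq_top_iff_one, Ideal.mem_span_singleton]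
    rintro ⟨⟨_, n, rfl⟩, hn⟩
    have h1 := congrArg Subtype.val hn
    simp only [eq_intCast, Subring.coe_mul, Subring.coe_one] at h1
    have h2 : (1 : ℤ) = p * n := by exact_mod_cast h1
    have h3 : (p : ℤ) ∣ 1 := ⟨n, h2⟩
    exact hp.one_lt.ne' (by exact_mod_cast Int.eq_one_of_dvd_one (by positivity) h3)
  obtain ⟨V, -, hV⟩ := Ideal.image_subset_nonunits_valuationSubring _ hI
  refine ⟨V.ValueGroup, inferInstance, V.valuation, ?_⟩
  have := hV ⟨_, Ideal.mem_span_singleton_self _, rfl⟩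
  rw [SetLike.mem_coe, ValuationSubring.mem_nonunits_iff] at this
  simpa using this

variable {k : Subfield ℂ} [NumberField k]

theorem NumberField.exists_map_le_one {x : ℂ} (hx : x ∈ k) : ∃ d : ℕ, 0 < d ∧
    ∀ (Γ₀ : Type) [LinearOrderedCommGroupWithZero Γ₀] (v : Valuation ℂ Γ₀) (p : ℕ), p.Prime →
      v (p : ℂ) < 1 → ¬ p ∣ d → v x ≤ 1 := by
  have halg : IsAlgebraic ℤ x := by
    have h1 : IsAlgebraic ℚ (⟨x, hx⟩ : k) := Algebra.IsAlgebraic.isAlgebraic _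
    have h2 : IsAlgebraic ℚ x := h1.algebraMap (A := ℂ)
    exact (IsFractionRing.isAlgebraic_iff ℤ ℚ ℂ).mpr h2
  obtain ⟨y, hy0, hy⟩ := halg.exists_integral_multiple
  refine ⟨y.natAbs, Int.natAbs_pos.mpr hy0, fun Γ₀ _ v p hp hv hd => ?_⟩
  have h1 := v.map_le_one_of_isIntegral hy
  have h2 : v (y : ℂ) = 1 := WeierstrassCurve.Affine.Point.map_intCast_eq_one hp hv
    fun h => hd (Int.natCast_dvd.mp h)
  rwa [zsmul_eq_mul, map_mul, h2, one_mul] at h1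

namespace WeierstrassCurve.Affine

open scoped WeierstrassCurve.Affine

variable {W₀ : WeierstrassCurve.Affine k}

instance baseChange_isShortNF {R A : Type*} [CommRing R] [CommRing A] [Algebra R A]
    (W₀ : WeierstrassCurve.Affine R) [W₀.IsShortNF] : (W₀⁄A).IsShortNF :=
  ⟨by simp, by simp, by simp⟩

namespace Point

/-- Field automorphisms act on the points of a curve. -/
noncomputable instance galoisAction : DistribMulAction (ℂ ≃ₐ[k] ℂ) (W₀⁄ℂ).Point where
  smul σ P := map (σ : ℂ →ₐ[k] ℂ) P
  one_smul P := by cases P <;> rfl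
  mul_smul σ τ P := by cases P <;> rfl
  smul_zero σ := rfl
  smul_add σ P Q := _root_.map_add (map (σ : ℂ →ₐ[k] ℂ)) P Q

omit [NumberField k] in
@[simp] theorem xc_smul (σ : ℂ ≃ₐ[k] ℂ) (P : (W₀⁄ℂ).Point) : (σ • P).xc = σ P.xc := by
  cases P
  · exact (_root_.map_zero σ).symm
  · rfl

omit [NumberField k] in
@[simp] theorem yc_smul (σ : ℂ ≃ₐ[k] ℂ) (P : (W₀⁄ℂ).Point) : (σ • P).yc = σ P.yc := by
  cases P
  · exact (_root_.map_zero σ).symm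
  · rfl

omit [NumberField k] in
@[simp] theorem tc_smul (σ : ℂ ≃ₐ[k] ℂ) (P : (W₀⁄ℂ).Point) : (σ • P).tc = σ P.tc := by
  simp [tc]

theorem exists_goodAt (hdisc : 4 * (W₀⁄ℂ).a₄ ^ 3 + 27 * (W₀⁄ℂ).a₆ ^ 2 ≠ 0) :
    ∃ B : ℕ, 0 < B ∧ ∀ (Γ₀ : Type) [LinearOrderedCommGroupWithZero Γ₀] (v : Valuation ℂ Γ₀) (p : ℕ),
      p.Prime → v (p : ℂ) < 1 → ¬ p ∣ B → GoodAt v (W₀⁄ℂ) := by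
  have h4 : (W₀⁄ℂ).a₄ ∈ k := W₀.a₄.2
  have h6 : (W₀⁄ℂ).a₆ ∈ k := W₀.a₆.2
  have hd : (4 * (W₀⁄ℂ).a₄ ^ 3 + 27 * (W₀⁄ℂ).a₆ ^ 2)⁻¹ ∈ k := by
    refine inv_mem (add_mem (mul_mem ?_ (pow_mem h4 3)) (mul_mem ?_ (pow_mem h6 2)))
    · exact ofNat_mem k 4
    · exact ofNat_mem k 27
  obtain ⟨d1, hd1, H1⟩ := NumberField.exists_map_le_one h4
  obtain ⟨d2, hd2, H2⟩ := NumberField.exists_map_le_one h6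
  obtain ⟨d3, hd3, H3⟩ := NumberField.exists_map_le_one hd
  refine ⟨2 * (d1 * (d2 * d3)), by positivity, fun Γ₀ _ v p hp hv hB => ?_⟩
  have e1 : ¬ p ∣ 2 := fun h => hB (h.mul_right _)
  have e2 : ¬ p ∣ d1 := fun h => hB ((h.mul_right _).mul_left _)
  have e3 : ¬ p ∣ d2 := fun h => hB (((h.mul_right _).mul_left _).mul_left _)
  have e4 : ¬ p ∣ d3 := fun h => hB (((h.mul_left _).mul_left _).mul_left _)
  have h1 := H1 Γ₀ v p hp hv e2
  have h2 := H2 Γ₀ v p hp hv e3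
  have h3 := H3 Γ₀ v p hp hv e4
  refine ⟨h1, h2, by simpa using map_natCast_eq_one hp hv e1, le_antisymm ?_ ?_⟩
  · refine v.map_add_le ?_ ?_
    · rw [map_mul, map_pow]
      exact mul_le_one' (by exact_mod_cast natCast_le_one v 4) (pow_le_one₀ zero_le h1)
    · rw [map_mul, map_pow]
      exact mul_le_one' (by exact_mod_cast natCast_le_one v 27) (pow_le_one₀ zero_le h2)
  · rw [map_inv₀] at h3
    exact (inv_le_one₀ (zero_lt_iff.mpr ((Valuation.ne_zero_iff _).mpr hdisc))).mp h3

section Torsion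

variable (W₀)

/-- The field generated over the base by the coordinates of the `m`-torsion points. -/
noncomputable def torsionField (m : ℕ) : IntermediateField k ℂ :=
  IntermediateField.adjoin k (xc '' {P : (W₀⁄ℂ).Point | m • P = 0} ∪
    yc '' {P : (W₀⁄ℂ).Point | m • P = 0})

variable {W₀} {m : ℕ}

omit [NumberField k] in
theorem xc_mem_torsionField {P : (W₀⁄ℂ).Point} (hP : m • P = 0) : P.xc ∈ torsionField W₀ m :=
  IntermediateField.subset_adjoin _ _ (Or.inl ⟨P, hP, rfl⟩)

omit [NumberField k] in
theorem yc_mem_torsionField {P : (W₀⁄ℂ).Point} (hP : m • P = 0) : P.yc ∈ torsionField W₀ m :=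
  IntermediateField.subset_adjoin _ _ (Or.inr ⟨P, hP, rfl⟩)

omit [NumberField k] in
theorem smul_torsion (σ : ℂ ≃ₐ[k] ℂ) {P : (W₀⁄ℂ).Point} (hP : m • P = 0) : m • σ • P = 0 := by
  rw [smul_comm, hP, smul_zero]

omit [NumberField k] in
theorem smul_eq_of_coord {σ : ℂ ≃ₐ[k] ℂ} {P : (W₀⁄ℂ).Point} (hx : σ P.xc = P.xc)
    (hy : σ P.yc = P.yc) : σ • P = P := by
  obtain rfl | hP := eq_or_ne P 0
  · exact smul_zero σ
  · exact ext_coord (by simpa [smul_eq_zero_iff_eq] using hP) hP (by simpa) (by simpa)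

omit [NumberField k] in
theorem mem_torsionFixer_iff {σ : ℂ ≃ₐ[k] ℂ} :
    σ ∈ torsionFixer (ℂ ≃ₐ[k] ℂ) (W₀⁄ℂ).Point m ↔ ∀ x ∈ torsionField W₀ m, σ x = x := by
  constructor
  · intro h x hx
    have hle : torsionField W₀ m ≤ IntermediateField.fixedField (Subgroup.zpowers σ) := by
      refine IntermediateField.adjoin_le_iff.mpr ?_
      have key : ∀ x : ℂ, σ x = x → x ∈ IntermediateField.fixedField (Subgroup.zpowers σ) := by
        intro x hx
        rw [IntermediateField.mem_fixedField_iff]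
        intro f hf
        have : Subgroup.zpowers σ ≤ MulAction.stabilizer (ℂ ≃ₐ[k] ℂ) x := by
          rw [Subgroup.zpowers_le]; exact hx
        exact this hf
      rintro _ (⟨P, hP, rfl⟩ | ⟨P, hP, rfl⟩)
      · exact key _ (by rw [← xc_smul, h P hP])
      · exact key _ (by rw [← yc_smul, h P hP])
    exact (IntermediateField.mem_fixedField_iff _ _).mp (hle hx) σ (Subgroup.mem_zpowers σ)
  · intro h P hP
    exact smul_eq_of_coord (h _ (xc_mem_torsionField hP)) (h _ (yc_mem_torsionField hP))

variable (hfin : ∀ n : ℕ, 0 < n → {P : (W₀⁄ℂ).Point | n • P = 0}.Finite)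

include hfin

theorem isAlgebraic_coord {n : ℕ} (hn : 0 < n) {P : (W₀⁄ℂ).Point} (hP : n • P = 0) :
    IsAlgebraic k P.xc ∧ IsAlgebraic k P.yc := by
  constructor
  · refine Complex.isAlgebraic_of_finite_orbit ((hfin n hn).image xc) fun σ => ?_
    exact ⟨σ • P, smul_torsion σ hP, xc_smul σ P⟩
  · refine Complex.isAlgebraic_of_finite_orbit ((hfin n hn).image yc) fun σ => ?_
    exact ⟨σ • P, smul_torsion σ hP, yc_smul σ P⟩

theorem finiteDimensional_torsionField (hm : 0 < m) :
    FiniteDimensional k (torsionField W₀ m) := by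
  have := (((hfin m hm).image xc).union ((hfin m hm).image yc)).to_subtype
  refine IntermediateField.finiteDimensional_adjoin ?_
  rintro _ (⟨P, hP, rfl⟩ | ⟨P, hP, rfl⟩)
  · exact (isAlgebraic_coord hfin hm hP).1.isIntegral
  · exact (isAlgebraic_coord hfin hm hP).2.isIntegral

omit [NumberField k] hfin in
theorem map_mem_torsionField (σ : ℂ ≃ₐ[k] ℂ) {x : ℂ} (hx : x ∈ torsionField W₀ m) :
    σ x ∈ torsionField W₀ m := by
  have hle : torsionField W₀ m ≤ (torsionField W₀ m).comap (σ : ℂ →ₐ[k] ℂ) := by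
    refine IntermediateField.adjoin_le_iff.mpr ?_
    rintro _ (⟨P, hP, rfl⟩ | ⟨P, hP, rfl⟩)
    · change σ P.xc ∈ torsionField W₀ m
      rw [← xc_smul]; exact xc_mem_torsionField (smul_torsion σ hP)
    · change σ P.yc ∈ torsionField W₀ m
      rw [← yc_smul]; exact yc_mem_torsionField (smul_torsion σ hP)
  exact hle hx

theorem isGalois_torsionField (hm : 0 < m) : IsGalois k (torsionField W₀ m) := by
  have := finiteDimensional_torsionField hfin hm
  refine IsGalois.of_fixedField_eq_bot _ _ (eq_bot_iff.mpr fun x hx => ?_)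
  rw [IntermediateField.mem_fixedField_iff] at hx
  have h1 : (x : ℂ) ∈ (⊥ : IntermediateField k ℂ) := by
    refine Complex.mem_of_forall_algEquiv ⊥ (fun σ _ => ?_)
      ((Algebra.IsAlgebraic.isAlgebraic (R := k) x).algebraMap (A := ℂ))
    let f : torsionField W₀ m →ₐ[k] torsionField W₀ m :=
      ((σ : ℂ →ₐ[k] ℂ).comp (torsionField W₀ m).val).codRestrict (torsionField W₀ m).toSubalgebra
        fun y => map_mem_torsionField σ y.2
    have := hx (AlgEquiv.ofBijective f (Algebra.IsAlgebraic.algHom_bijective f)) trivial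
    exact congrArg Subtype.val this
  obtain ⟨y, hy⟩ := IntermediateField.mem_bot.mp h1
  exact IntermediateField.mem_bot.mpr ⟨y, Subtype.ext hy⟩

end Torsion

end Point

end WeierstrassCurve.Affine

end

section

/-- An element of small valuation has large degree over a field in which `p` is a uniformizer. -/
theorem Valuation.le_natDegree_minpoly {K M L Γ₀ : Type*} [Field K] [Field L] [Field M]
    [Algebra M L] [LinearOrderedCommGroupWithZero Γ₀] (v : Valuation L Γ₀) {p : L}
    (hp0 : p ≠ 0) (hp : v p < 1)
    (hM : ∀ a : M, a ≠ 0 → ∃ n : ℤ, v (algebraMap M L a) = v p ^ n) {t : L} (ht : IsIntegral M t)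
    (ht1 : v t < 1) {φ : ℕ} (htp : v p ≤ v t ^ φ) : φ ≤ (minpoly M t).natDegree := by
  by_contra! hlt
  set f := minpoly M t with hf
  have hvp0 : 0 < v p := zero_lt_iff.mpr ((Valuation.ne_zero_iff _).mpr hp0)
  have ht0 : 0 < v t := by
    rw [zero_lt_iff]
    intro h
    rw [h, zero_pow (by omega)] at htp
    exact absurd htp (not_le.mpr hvp0)
  have hroot : ∑ i ∈ Finset.range (f.natDegree + 1), algebraMap M L (f.coeff i) * t ^ i = 0 := by
    have := minpoly.aeval M t
    rw [Polynomial.aeval_eq_sum_range] at this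
    simpa [Algebra.smul_def] using this
  set g : ℕ → L := fun i => algebraMap M L (f.coeff i) * t ^ i with hg
  have hne : ∀ i j, i < j → j ≤ f.natDegree → g i ≠ 0 → g j ≠ 0 → v (g i) ≠ v (g j) := by
    intro i j hij hj hi0 hj0 heq
    obtain ⟨a, ha⟩ := hM (f.coeff i) (fun h => hi0 (by simp [hg, h]))
    obtain ⟨b, hb⟩ := hM (f.coeff j) (fun h => hj0 (by simp [hg, h]))
    simp only [hg, map_mul, map_pow, ha, hb] at heq
    obtain ⟨d, rfl⟩ := Nat.exists_eq_add_of_lt hij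
    have h1 : v t ^ (d + 1) = v p ^ (a - b) := by
      rw [zpow_sub₀ hvp0.ne', eq_div_iff (zpow_pos hvp0 _).ne']
      rw [add_assoc, pow_add] at heq
      have := mul_right_cancel₀ (pow_pos ht0 i).ne'
        (heq.trans (show v p ^ b * (v t ^ i * v t ^ (d + 1)) = (v t ^ (d + 1) * v p ^ b) * v t ^ i by
          ac_rfl))
      exact this.symm
    have h2 : v t ^ (d + 1) < 1 := pow_lt_one₀ zero_le ht1 (by omega)
    have h3 : v t ^ φ < v t ^ (d + 1) := pow_lt_pow_right_of_lt_one₀ ht0 ht1 (by omega)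
    have h4 : v p < v t ^ (d + 1) := htp.trans_lt h3
    rw [h1] at h2 h4
    have h5 : 0 < a - b := by
      by_contra! h
      exact absurd h2 (not_lt.mpr (one_le_zpow_of_nonpos₀ hvp0 hp.le h))
    have h6 : v p ^ (a - b) ≤ v p ^ (1 : ℤ) := zpow_le_zpow_right_of_le_one₀ hvp0 hp.le (by omega)
    rw [zpow_one] at h6
    exact absurd h4 (not_lt.mpr h6)
  obtain ⟨i, hi, hmax⟩ := Finset.exists_max_image (Finset.range (f.natDegree + 1)) (fun i => v (g i))
    ⟨0, by simp⟩
  have htop : g f.natDegree ≠ 0 := by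
    simp only [hg]
    rw [Polynomial.coeff_natDegree, (minpoly.monic ht).leadingCoeff, map_one, one_mul]
    exact pow_ne_zero _ fun h => by simp [h] at ht0
  have hgi : g i ≠ 0 := by
    intro h
    have := hmax f.natDegree (by simp)
    simp only [h, map_zero, le_zero_iff, map_eq_zero] at this
    exact htop this
  have hlt' : v (∑ j ∈ (Finset.range (f.natDegree + 1)).erase i, g j) < v (g i) := by
    refine v.map_sum_lt ((Valuation.ne_zero_iff _).mpr hgi) fun j hj => ?_
    rw [Finset.mem_erase] at hj
    by_cases hgj : g j = 0
    · rw [hgj, map_zero, zero_lt_iff]; exact (Valuation.ne_zero_iff _).mpr hgi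
    refine lt_of_le_of_ne (hmax j hj.2) fun h => ?_
    rw [Finset.mem_range] at hi hj
    obtain h' | h' := lt_or_gt_of_ne hj.1
    · exact hne j i h' (by omega) hgj hgi h
    · exact hne i j h' (by omega) hgi hgj h.symm
  rw [← Finset.add_sum_erase _ _ hi, add_eq_zero_iff_neg_eq] at hroot
  rw [← hroot, Valuation.map_neg] at hlt'
  exact lt_irrefl _ hlt'

namespace WeierstrassCurve.Affine.Point

open scoped WeierstrassCurve.Affine

variable {k : Subfield ℂ} [NumberField k] {W₀ : WeierstrassCurve.Affine k} [W₀.IsShortNF] {m : ℕ}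
  (hfin : ∀ n : ℕ, 0 < n → {P : (W₀⁄ℂ).Point | n • P = 0}.Finite)
  {Γ₀ : Type*} [LinearOrderedCommGroupWithZero Γ₀] {v : Valuation ℂ Γ₀}

omit [NumberField k] in
theorem eq_of_map_sub_lt_one (hgood : GoodAt v (W₀⁄ℂ)) (hvm : v (m : ℂ) = 1)
    {P Q : (W₀⁄ℂ).Point} (hP : m • P = 0) (hQ : m • Q = 0) (hP0 : P ≠ 0) (hQ0 : Q ≠ 0)
    (hx : v (P.xc - Q.xc) < 1) (hy : v (P.yc - Q.yc) < 1) : P = Q := by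
  have h := inKer_sub hgood (fun h => hP0 (h.eq_zero_of_nsmul hgood hvm hP))
    (fun h => hQ0 (h.eq_zero_of_nsmul hgood hvm hQ)) hx hy
  exact sub_eq_zero.mp (h.eq_zero_of_nsmul hgood hvm (by rw [smul_sub, hP, hQ, sub_zero]))

include hfin

/-- `p` is a uniformizer of the `m`-torsion field at a place of good reduction. -/
theorem map_torsionField_eq_zpow (hgood : GoodAt v (W₀⁄ℂ)) {p : ℕ} (hp : p.Prime)
    (hv : v (p : ℂ) < 1) (hm : 0 < m) (hpm : ¬ p ∣ m) (hdisc : ¬ (p : ℤ) ∣ NumberField.discr k)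
    (a : torsionField W₀ m) (ha0 : a ≠ 0) : ∃ n : ℤ, v a = v p ^ n := by
  have := finiteDimensional_torsionField hfin hm
  have := isGalois_torsionField hfin hm
  have : FiniteDimensional ℚ (torsionField W₀ m) := FiniteDimensional.trans ℚ k _
  have : NumberField (torsionField W₀ m) := {}
  have : Countable (torsionField W₀ m) := NumberField.countable _
  have hvm : v (m : ℂ) = 1 := map_natCast_eq_one hp hv hpm
  let u := v.comap (algebraMap (torsionField W₀ m) ℂ)
  have hu : ∀ a, u a = v (a : ℂ) := fun a => rfl
  have hup : u (p : torsionField W₀ m) = v (p : ℂ) := by rw [hu]; simp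
  have key := NumberField.exists_map_eq_zpow (k := k) u hp (by rw [hup]; exact hv) hdisc ?_ ha0
  · rwa [hup] at key
  intro τ hτ
  obtain ⟨σ, hσ⟩ := Complex.exists_algEquiv_comp_eq (f := (torsionField W₀ m).val)
    (g := (torsionField W₀ m).val.comp (τ : torsionField W₀ m →ₐ[k] torsionField W₀ m))
    Subtype.val_injective (Subtype.val_injective.comp τ.injective)
  have hσ' : ∀ x : torsionField W₀ m, σ (x : ℂ) = τ x := hσ
  have hmem : σ ∈ torsionFixer (ℂ ≃ₐ[k] ℂ) (W₀⁄ℂ).Point m := by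
    intro P hP
    obtain rfl | hP0 := eq_or_ne P 0
    · exact smul_zero σ
    have hinteg := integral_of_not_inKer hgood (fun h => hP0 (h.eq_zero_of_nsmul hgood hvm hP))
    refine eq_of_map_sub_lt_one hgood hvm (smul_torsion σ hP) hP
      (by simpa [smul_eq_zero_iff_eq] using hP0) hP0 ?_ ?_
    · rw [xc_smul]
      have := hτ ⟨P.xc, xc_mem_torsionField hP⟩ hinteg.2.1
      rw [hu] at this
      simpa [← hσ'] using this
    · rw [yc_smul]
      have := hτ ⟨P.yc, yc_mem_torsionField hP⟩ hinteg.2.2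
      rw [hu] at this
      simpa [← hσ'] using this
  ext x
  rw [← hσ' x, mem_torsionFixer_iff.mp hmem _ x.2]
  rfl

/-- Unboundedly divisible points are not all fixed by the automorphisms fixing the `m`-torsion. -/
theorem exists_pow_smul_eq_zero (hm : 0 < m) (hgood : GoodAt v (W₀⁄ℂ)) {ℓ : ℕ} (hℓ : ℓ.Prime)
    (hv : v (ℓ : ℂ) < 1) {p : ℕ} (hp : p.Prime) (hpℓ : p ≠ ℓ) :
    ∃ e : ℕ, ∀ (n : ℕ) (ξ : (W₀⁄ℂ).Point), p ^ n • ξ = 0 →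
      (∀ g : ℂ ≃ₐ[k] ℂ, g ∈ torsionFixer (ℂ ≃ₐ[k] ℂ) (W₀⁄ℂ).Point m → g • ξ = ξ) →
        p ^ e • ξ = 0 := by
  have := finiteDimensional_torsionField hfin hm
  have : FiniteDimensional ℚ (torsionField W₀ m) := FiniteDimensional.trans ℚ k _
  have : NumberField (torsionField W₀ m) := {}
  let s : Set (W₀⁄ℂ).Point := {ξ | ξ ≠ 0 ∧ (∃ n : ℕ, p ^ n • ξ = 0) ∧
    ∀ g : ℂ ≃ₐ[k] ℂ, g ∈ torsionFixer (ℂ ≃ₐ[k] ℂ) (W₀⁄ℂ).Point m → g • ξ = ξ}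
  have hs : s.Finite := by
    by_contra hinf
    have hinf : s.Infinite := hinf
    let ξ : ℕ → s := hinf.natEmbedding
    have hξ : Function.Injective ξ := hinf.natEmbedding.injective
    have hvp : ∀ n : ℕ, v ((p ^ n : ℕ) : ℂ) = 1 := fun n => map_natCast_eq_one hℓ hv fun h =>
      hpℓ ((Nat.prime_dvd_prime_iff_eq hℓ hp).mp (hℓ.dvd_of_dvd_pow h)).symm
    have hmem : ∀ i, (ξ i : (W₀⁄ℂ).Point).xc ∈ torsionField W₀ m ∧
        (ξ i : (W₀⁄ℂ).Point).yc ∈ torsionField W₀ m := by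
      intro i
      obtain ⟨-, ⟨n, hn⟩, hfix⟩ := (ξ i).2
      have halg := isAlgebraic_coord hfin (pow_pos hp.pos n) hn
      constructor
      · refine Complex.mem_of_forall_algEquiv _ (fun σ hσ => ?_) halg.1
        rw [← xc_smul, hfix σ (mem_torsionFixer_iff.mpr hσ)]
      · refine Complex.mem_of_forall_algEquiv _ (fun σ hσ => ?_) halg.2
        rw [← yc_smul, hfix σ (mem_torsionFixer_iff.mpr hσ)]
    let u := v.comap (algebraMap (torsionField W₀ m) ℂ)
    have hu : ∀ a, u a = v (a : ℂ) := fun a => rfl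
    obtain ⟨i, j, hij, h1, h2⟩ := NumberField.exists_map_sub_lt_one u hℓ (by rw [hu]; simpa using hv)
      (b := fun i => (⟨_, (hmem i).1⟩, ⟨_, (hmem i).2⟩)) (fun i => by
        obtain ⟨h0, ⟨n, hn⟩, -⟩ := (ξ i).2
        exact (integral_of_not_inKer hgood
          (fun h => h0 (h.eq_zero_of_nsmul hgood (hvp n) hn))).2)
    obtain ⟨hi0, ⟨n, hn⟩, -⟩ := (ξ i).2
    obtain ⟨hj0, ⟨n', hn'⟩, -⟩ := (ξ j).2
    have h3 := eq_of_map_sub_lt_one (m := p ^ (n + n')) hgood (hvp _)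
      (by rw [pow_add, mul_comm, mul_smul, hn, _root_.nsmul_zero])
      (by rw [pow_add, mul_smul, hn', _root_.nsmul_zero]) hi0 hj0 h1 h2
    exact hij.ne (hξ (Subtype.ext h3))
  choose! e he using fun (ξ : (W₀⁄ℂ).Point) (hξ : ξ ∈ s) => hξ.2.1
  refine ⟨hs.toFinset.sup e, fun n ξ hn hfix => ?_⟩
  obtain rfl | h0 := eq_or_ne ξ 0
  · simp
  have hξ : ξ ∈ s := ⟨h0, ⟨n, hn⟩, hfix⟩
  obtain ⟨d, hd⟩ := Nat.exists_eq_add_of_le (Finset.le_sup (f := e) (hs.mem_toFinset.mpr hξ))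
  rw [hd, pow_add, mul_comm, mul_smul, he ξ hξ, _root_.nsmul_zero]

/-- Points with large ramification have many conjugates. -/
theorem le_relIndex_of_le_tc_pow (hgood : GoodAt v (W₀⁄ℂ)) {p : ℕ} (hp : p.Prime)
    (hv : v (p : ℂ) < 1) (hm : 0 < m) (hpm : ¬ p ∣ m) (hdisc : ¬ (p : ℤ) ∣ NumberField.discr k)
    {α : (W₀⁄ℂ).Point →+ (W₀⁄ℂ).Point}
    (hα : ∀ g : ℂ ≃ₐ[k] ℂ, g ∈ torsionFixer (ℂ ≃ₐ[k] ℂ) (W₀⁄ℂ).Point m → ∀ P, α (g • P) = g • α P)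
    {ξ : (W₀⁄ℂ).Point} {n : ℕ} (hn : 0 < n) (hξ : n • ξ = 0) {i j : ℤ} {φ : ℕ}
    (h1 : v (tc (i • α ξ + j • ξ)) < 1) (h2 : v (p : ℂ) ≤ v (tc (i • α ξ + j • ξ)) ^ φ) :
    φ ≤ (MulAction.stabilizer (ℂ ≃ₐ[k] ℂ) ξ).relIndex (torsionFixer (ℂ ≃ₐ[k] ℂ) (W₀⁄ℂ).Point m) := by
  have := finiteDimensional_torsionField hfin hm
  set ξ' := i • α ξ + j • ξ with hξ'
  have hnξ' : n • ξ' = 0 := by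
    rw [hξ', _root_.nsmul_add, smul_comm n i, smul_comm n j, ← map_nsmul, hξ, _root_.map_zero, _root_.zsmul_zero,
      _root_.zsmul_zero, add_zero]
  have halg := isAlgebraic_coord hfin hn hnξ'
  have hinteg : _root_.IsIntegral (torsionField W₀ m) (tc ξ' : ℂ) := by
    have : IsAlgebraic k (tc ξ' : ℂ) := by
      rw [tc, div_eq_mul_inv]; exact halg.1.mul halg.2.inv
    exact this.isIntegral.tower_top
  have hdeg := v.le_natDegree_minpoly (K := k) (M := torsionField W₀ m) (p := (p : ℂ))
    (by exact_mod_cast hp.ne_zero) hv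
    (fun a ha => map_torsionField_eq_zpow hfin hgood hp hv hm hpm hdisc a ha) hinteg h1 h2
  refine hdeg.trans ?_
  have hcard : ((minpoly (torsionField W₀ m) (tc ξ')).rootSet ℂ).ncard
      = (minpoly (torsionField W₀ m) (tc ξ')).natDegree := by
    rw [← Nat.card_coe_set_eq, Nat.card_eq_fintype_card, Polynomial.card_rootSet_eq_natDegree
      (minpoly.irreducible hinteg).separable (IsAlgClosed.splits _)]
  rw [← hcard]
  let H := torsionFixer (ℂ ≃ₐ[k] ℂ) (W₀⁄ℂ).Point m
  have hstab : (MulAction.stabilizer (ℂ ≃ₐ[k] ℂ) ξ).relIndex H = (MulAction.orbit H ξ).ncard := by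
    rw [← MulAction.index_stabilizer]
    rfl
  rw [hstab]
  have hfinorb : (MulAction.orbit H ξ).Finite := by
    refine (hfin n hn).subset ?_
    rintro _ ⟨g, rfl⟩
    exact smul_torsion (g : ℂ ≃ₐ[k] ℂ) hξ
  refine (Set.ncard_le_ncard ?_ (hfinorb.image fun P => tc (i • α P + j • P))).trans
    (Set.ncard_image_le hfinorb)
  intro y hy
  rw [Polynomial.mem_rootSet] at hy
  obtain ⟨σ, hσ, hσy⟩ := Complex.exists_algEquiv_of_aeval_minpoly _ hinteg hy.2
  have hσH : σ ∈ H := mem_torsionFixer_iff.mpr hσ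
  refine ⟨σ • ξ, ⟨⟨σ, hσH⟩, rfl⟩, ?_⟩
  simp only
  rw [hα σ hσH, smul_comm i σ, smul_comm j σ, ← _root_.smul_add, tc_smul, ← hξ', hσy]

end WeierstrassCurve.Affine.Point

end

section

namespace WeierstrassCurve.Affine.Point

open scoped WeierstrassCurve.Affine

variable {k : Subfield ℂ} [NumberField k] {W₀ : WeierstrassCurve.Affine k}

/-- The facts about an elliptic curve with complex multiplication `α` used in the argument. -/
structure IsCMCurve (W₀ : WeierstrassCurve.Affine k) (α : (W₀⁄ℂ).Point →+ (W₀⁄ℂ).Point)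
    (c : ℂ) (T D : ℤ) : Prop where
  nonsing : 4 * (W₀⁄ℂ).a₄ ^ 3 + 27 * (W₀⁄ℂ).a₆ ^ 2 ≠ 0
  mem : c ∈ k
  conj : starRingEnd ℂ c = T - c
  quad : c ^ 2 - T * c + D = 0
  trace_ne : T ≠ 0
  norm_ne : D ≠ 0
  disc_ne : T ^ 2 - 4 * D ≠ 0
  quad_apply : ∀ P, α (α P) - T • α P + D • P = 0
  isoC : IsoFormula α c
  isoN : ∀ p : ℕ, p.Prime → p ≠ 2 → IsoFormula (nsmulAddMonoidHom (α := (W₀⁄ℂ).Point) p) (p : ℂ)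
  card : ∀ n : ℕ, 0 < n → {P : (W₀⁄ℂ).Point | n • P = 0}.ncard = n ^ 2
  div : ∀ n : ℕ, 0 < n → ∀ P : (W₀⁄ℂ).Point, ∃ R, n • R = P
  scalar : ∀ p : ℕ, p.Prime → ¬ (p : ℤ) ∣ T ^ 2 - 4 * D →
    ∀ b : ℤ, ∃ P : (W₀⁄ℂ).Point, p • P = 0 ∧ α P ≠ b • P

variable {α : (W₀⁄ℂ).Point →+ (W₀⁄ℂ).Point} {c : ℂ} {T D : ℤ}

namespace IsCMCurve

omit [NumberField k] in
theorem finite (h : IsCMCurve W₀ α c T D) {n : ℕ} (hn : 0 < n) :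
    {P : (W₀⁄ℂ).Point | n • P = 0}.Finite :=
  Set.finite_of_ncard_pos (by rw [h.card n hn]; positivity)

omit [NumberField k] in
theorem norm_smul_eq_zero (h : IsCMCurve W₀ α c T D) {P : (W₀⁄ℂ).Point} (hP : α P = 0) :
    D.natAbs • P = 0 := by
  have h1 := h.quad_apply P
  rw [hP, _root_.map_zero, zsmul_zero, sub_zero, zero_add] at h1
  rwa [← natCast_zsmul, Int.natCast_natAbs, abs_zsmul_eq_zero] 

omit [NumberField k] in
/-- Automorphisms fixing enough torsion points commute with the complex multiplication. -/
theorem apply_smul [W₀.IsShortNF] (h : IsCMCurve W₀ α c T D) {m q : ℕ} (hD : D.natAbs ∣ m)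
    (hqm : q ∣ m) (hq : q.Prime) (hq5 : 5 ≤ q) (hqD : ¬ q ∣ D.natAbs) {σ : ℂ ≃ₐ[k] ℂ}
    (hσ : σ ∈ torsionFixer (ℂ ≃ₐ[k] ℂ) (W₀⁄ℂ).Point m) (P : (W₀⁄ℂ).Point) :
    α (σ • P) = σ • α P := by
  obtain ⟨Q, hQ, hQ0⟩ : ∃ Q : (W₀⁄ℂ).Point, q • Q = 0 ∧ Q ≠ 0 := by
    have h1 : 1 < {P : (W₀⁄ℂ).Point | q • P = 0}.ncard := by
      rw [h.card q hq.pos]; nlinarith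
    obtain ⟨Q, hQ, hQ0⟩ := Set.exists_ne_of_one_lt_ncard h1 0
    exact ⟨Q, hQ, hQ0⟩
  have hfix : ∀ d : ℕ, d ∣ m → ∀ P : (W₀⁄ℂ).Point, d • P = 0 → σ • P = P := by
    rintro d ⟨e, rfl⟩ P hP
    exact hσ P (by rw [mul_comm, mul_nsmul', hP, nsmul_zero])
  have hker : ∀ P, α P = 0 → σ • P = P := fun P hP => hfix _ hD P (h.norm_smul_eq_zero hP)
  have hαQ : q • α Q = 0 := by rw [← map_nsmul, hQ, _root_.map_zero]
  have h2Q : α (2 • Q) ≠ 0 := by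
    intro h0
    have h1 := h.norm_smul_eq_zero h0
    rw [← mul_nsmul'] at h1
    have h2 := addOrderOf_eq_prime_iff (p := q) (x := Q) (hp := ⟨hq⟩) |>.mpr ⟨hQ, hQ0⟩
    have h3 := addOrderOf_dvd_of_nsmul_eq_zero h1
    rw [h2, hq.dvd_mul] at h3
    obtain h3 | h3 := h3
    · exact hqD h3
    · have := Nat.le_of_dvd two_pos h3
      omega
  have hc0 : c ≠ 0 := by
    rintro rfl
    have := h.quad
    simp only [ne_eq, OfNat.ofNat_ne_zero, not_false_eq_true, zero_pow, mul_zero, sub_zero,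
      zero_add, Int.cast_eq_zero] at this
    exact h.norm_ne this
  have hσc : σ c = c := σ.commutes ⟨c, h.mem⟩
  obtain ⟨S, hS, hform⟩ := h.isoC
  have key : ∀ P : (W₀⁄ℂ).Point, α (σ • P) = σ • α P ∨ α (σ • P) = -(σ • α P) := by
    intro P
    by_cases hP : α P = 0
    · left; rw [hker P hP, hP, _root_.smul_zero]
    have hσP : α (σ • P) ≠ 0 := by
      intro h0
      have h1 := hker _ h0
      rw [smul_left_cancel_iff] at h1
      exact hP (by rwa [h1] at h0)
    have hσαP : σ • α P ≠ 0 := by rwa [Ne, smul_eq_zero_iff_eq]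
    refine eq_or_eq_neg_of_xc_eq hσP hσαP ?_
    have e1 := congrArg σ (hform P Q hP h2Q)
    have e2 := hform (σ • P) Q hσP h2Q
    simp only [map_mul, map_pow, map_sub, map_prod, hσc, ← xc_smul] at e1
    rw [hfix q hqm _ hαQ, Finset.prod_congr rfl (g := fun τ => (σ • P).xc - τ.xc)
      (fun τ hτ => by rw [hker τ ((hS τ).mp (Finset.mem_filter.mp hτ).1)]),
      Finset.prod_congr rfl (s₁ := S) (g := fun τ => (σ • P).xc - (Q + τ).xc)
      (fun τ hτ => by rw [_root_.smul_add, hker τ ((hS τ).mp hτ), hfix q hqm Q hQ]), ← e2] at e1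
    have hprod : ∏ τ ∈ S with τ ≠ 0, ((σ • P).xc - τ.xc) ≠ 0 := by
      refine Finset.prod_ne_zero_iff.mpr fun τ hτ h0 => ?_
      rw [Finset.mem_filter, hS] at hτ
      have hP0 : σ • P ≠ 0 := fun h0 => hσP (by rw [h0, _root_.map_zero])
      obtain h1 | h1 := eq_or_eq_neg_of_xc_eq hP0 hτ.2 (sub_eq_zero.mp h0)
      · exact hσP (by rw [h1, hτ.1])
      · exact hσP (by rw [h1, _root_.map_neg, hτ.1, neg_zero])
    have e3 := mul_left_cancel₀ (pow_ne_zero 2 hc0) (mul_right_cancel₀ hprod e1)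
    linear_combination -e3
  obtain hP | hP := key P
  · exact hP
  obtain h1 | h1 := key (P + Q)
  · rw [_root_.smul_add, _root_.map_add, _root_.map_add, _root_.smul_add, hfix q hqm Q hQ,
      hfix q hqm _ hαQ] at h1
    exact add_right_cancel h1
  · rw [_root_.smul_add, _root_.map_add, _root_.map_add, _root_.smul_add, hfix q hqm Q hQ,
      hfix q hqm _ hαQ, hP, neg_add, add_right_inj] at h1
    refine absurd ?_ h2Q
    rw [map_nsmul, two_nsmul]
    nth_rewrite 1 [h1]
    exact neg_add_cancel _

/-- The totient of the order of a torsion point is bounded by its number of conjugates. -/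
theorem exists_totient_le_ncard_orbit [W₀.IsShortNF] (h : IsCMCurve W₀ α c T D) :
    ∃ C : ℕ, 0 < C ∧ ∀ (N : ℕ) (ξ : (W₀⁄ℂ).Point), 0 < N → addOrderOf ξ = N →
      N.totient ≤ C * (MulAction.orbit (ℂ ≃ₐ[k] ℂ) ξ).ncard := by
  obtain ⟨B, hB, hgoodAt⟩ := exists_goodAt h.nonsing
  obtain ⟨q, hq, hqp⟩ := Nat.exists_infinite_primes (D.natAbs + 5)
  have hqD : ¬ q ∣ D.natAbs := fun hd => by
    have := Nat.le_of_dvd (Int.natAbs_pos.mpr h.norm_ne) hd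
    omega
  set m₁ := 2 * B * D.natAbs * T.natAbs * (T ^ 2 - 4 * D).natAbs * (NumberField.discr k).natAbs * q
    with hm₁
  have hm₁0 : 0 < m₁ := by
    have h1 := Int.natAbs_pos.mpr h.norm_ne
    have h2 := Int.natAbs_pos.mpr h.trace_ne
    have h3 := Int.natAbs_pos.mpr h.disc_ne
    have h4 := Int.natAbs_pos.mpr (NumberField.discr_ne_zero k)
    have h5 := hqp.pos
    positivity
  have hprime : ∀ p : ℕ, p.Prime → p ∣ m₁ ^ 2 → p ∣ m₁ := fun p hp hd => hp.dvd_of_dvd_pow hd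
  have hfin : ∀ n : ℕ, 0 < n → {P : (W₀⁄ℂ).Point | n • P = 0}.Finite := fun n hn => h.finite hn
  simp only [← MulAction.index_stabilizer]
  refine exists_totient_le_index (m₀ := m₁ ^ 2) (pow_pos hm₁0 2) hfin
    (fun p hp hd => pow_dvd_pow_of_dvd (hprime p hp hd) 2) ?_ ?_
  · intro p hp hd
    obtain ⟨ℓ, hℓ, hℓp⟩ := Nat.exists_infinite_primes (p + B + 1)
    obtain ⟨Γ₀, _, v, hv⟩ := Complex.exists_valuation_lt_one hℓp
    refine exists_pow_smul_eq_zero hfin (pow_pos hm₁0 2) (hgoodAt Γ₀ v ℓ hℓp hv fun hd => ?_) hℓp hv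
      hp (by omega)
    have := Nat.le_of_dvd hB hd
    omega
  · intro p hp hd m hm hdm hpm n ξ h1 h2
    have hnd : ∀ d : ℕ, d ∣ m₁ → ¬ p ∣ d := fun d hdm₁ hpd =>
      hd ((hpd.trans hdm₁).trans (dvd_pow_self _ two_ne_zero))
    have hmm : m₁ ∣ m := (dvd_pow_self _ two_ne_zero).trans hdm
    have dB : B ∣ m₁ := ⟨2 * D.natAbs * T.natAbs * (T ^ 2 - 4 * D).natAbs *
      (NumberField.discr k).natAbs * q, by rw [hm₁]; ring⟩
    have d2 : 2 ∣ m₁ := ⟨B * D.natAbs * T.natAbs * (T ^ 2 - 4 * D).natAbs *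
      (NumberField.discr k).natAbs * q, by rw [hm₁]; ring⟩
    have dD : D.natAbs ∣ m₁ := ⟨2 * B * T.natAbs * (T ^ 2 - 4 * D).natAbs *
      (NumberField.discr k).natAbs * q, by rw [hm₁]; ring⟩
    have dT : T.natAbs ∣ m₁ := ⟨2 * B * D.natAbs * (T ^ 2 - 4 * D).natAbs *
      (NumberField.discr k).natAbs * q, by rw [hm₁]; ring⟩
    have dE : (T ^ 2 - 4 * D).natAbs ∣ m₁ := ⟨2 * B * D.natAbs * T.natAbs *
      (NumberField.discr k).natAbs * q, by rw [hm₁]; ring⟩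
    have dK : (NumberField.discr k).natAbs ∣ m₁ := ⟨2 * B * D.natAbs * T.natAbs *
      (T ^ 2 - 4 * D).natAbs * q, by rw [hm₁]; ring⟩
    have dq : q ∣ m₁ := Dvd.intro_left _ rfl
    have hp2 : p ≠ 2 := by rintro rfl; exact hnd 2 d2 dvd_rfl
    have hpq : p ≠ q := by rintro rfl; exact hnd p dq dvd_rfl
    have hinteg : ∀ a : ℤ, a.natAbs ∣ m₁ → ¬ (p : ℤ) ∣ a := fun a ha hpa =>
      hnd _ ha (Int.natCast_dvd.mp hpa)
    obtain ⟨Q, hQ, hQ0⟩ : ∃ Q : (W₀⁄ℂ).Point, q • Q = 0 ∧ Q ≠ 0 := by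
      have h1 : 1 < {P : (W₀⁄ℂ).Point | q • P = 0}.ncard := by
        rw [h.card q hqp.pos]; nlinarith [hqp.two_le]
      obtain ⟨Q, hQ, hQ0⟩ := Set.exists_ne_of_one_lt_ncard h1 0
      exact ⟨Q, hQ, hQ0⟩
    obtain ⟨S, hS, hform⟩ := h.isoN p hp hp2
    have hcard : S.card = p ^ 2 := by
      rw [← h.card p hp.pos, ← Set.ncard_coe_finset]
      congr 1
      ext τ
      exact hS τ
    have hdata : ∀ (Γ₀ : Type) [LinearOrderedCommGroupWithZero Γ₀] (v : Valuation ℂ Γ₀),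
        v (p : ℂ) < 1 → CMData v (W₀⁄ℂ) p q S Q α c T D := fun Γ₀ _ v hv =>
      { good := hgoodAt Γ₀ v p hp hv (hnd B dB)
        prime := hp
        lt := hv
        primeq := hqp
        five_le := by omega
        ne := hpq
        ne_zero := hQ0
        smul := hQ
        mem := hS
        iso := fun P v₀ hP hv₀ => hform P v₀ hP hv₀
        quad := h.quad
        quad_apply := h.quad_apply
        isoC := h.isoC
        norm := hinteg D dD
        trace := hinteg T dT
        disc := hinteg _ dE
        normq := fun hd => hqD (Int.natCast_dvd.mp hd)
        div := h.div p hp.pos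
        card := hcard
        scalar := h.scalar p hp (hinteg _ dE) }
    obtain ⟨Γ₀, _, v, hv⟩ := Complex.exists_valuation_lt_one hp
    let v' : Valuation ℂ Γ₀ := v.comap (starRingEnd ℂ)
    have hv' : v' (p : ℂ) < 1 := by
      change v (starRingEnd ℂ (p : ℂ)) < 1
      rwa [map_natCast]
    obtain ⟨i, j, u, hu, h3, h4⟩ := (hdata Γ₀ v hv).exists_le_tc_pow (hdata Γ₀ v' hv')
      (fun b hb => by
        change v (starRingEnd ℂ (c - (T - b : ℤ))) < 1
        rw [_root_.map_sub, h.conj, map_intCast, Valuation.map_sub_swap]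
        convert hb using 2
        push_cast
        ring) h1 h2
    have hup : u (p : ℂ) < 1 := by
      obtain rfl | rfl := hu
      · exact hv
      · exact hv'
    exact le_relIndex_of_le_tc_pow hfin (hgoodAt Γ₀ u p hp hup (hnd B dB)) hp hup hm hpm
      (hinteg _ dK) (fun g hg P => h.apply_smul (dD.trans hmm) (dq.trans hmm) hqp (by omega) hqD hg P)
      (pow_pos hp.pos (n + 1)) h2 h3 h4

end IsCMCurve

end WeierstrassCurve.Affine.Point

end

section

open Filter Topology

namespace PeriodPair

variable (L : PeriodPair)

open scoped PeriodPair

theorem isOpen_compl_lattice : IsOpen ((L.lattice : Set ℂ)ᶜ) := L.isClosed_lattice.isOpen_compl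

theorem eventually_notMem_lattice (z : ℂ) : ∀ᶠ t in 𝓝[≠] z, t ∉ L.lattice := by
  filter_upwards [nhdsWithin_le_nhds (L.compl_lattice_sdiff_singleton_mem_nhds z),
    self_mem_nhdsWithin] with t ht htz hmem
  exact ht ⟨hmem, htz⟩

theorem isPreconnected_compl_lattice : IsPreconnected ((L.lattice : Set ℂ)ᶜ) := by
  have hc : (L.lattice : Set ℂ).Countable := by
    have : Countable L.lattice := L.latticeEquivProd.toEquiv.countable_iff.mpr inferInstance
    exact Set.countable_coe_iff.mp this
  exact (hc.isConnected_compl_of_one_lt_rank (by rw [Complex.rank_real_complex]; norm_num)).2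

variable {L}

theorem hasDerivAt_weierstrassP {z : ℂ} (hz : z ∉ L.lattice) : HasDerivAt ℘[L] (℘'[L] z) z := by
  have h := (L.analyticOnNhd_weierstrassP z hz).differentiableAt.hasDerivAt
  rwa [L.deriv_weierstrassP] at h

variable (L)

theorem weierstrassP_eq_add (z : ℂ) : ℘[L] z = ℘[L - (0 : ℂ)] z + 1 / z ^ 2 := by
  simpa using (L.weierstrassPExcept_add 0 z).symm

theorem derivWeierstrassP_eq_sub (z : ℂ) : ℘'[L] z = ℘'[L - (0 : ℂ)] z - 2 / z ^ 3 := by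
  simpa using (L.derivWeierstrassPExcept_sub 0 z).symm

theorem tendsto_weierstrassP {l : ℂ} (hl : l ∈ L.lattice) :
    Tendsto ℘[L] (𝓝[≠] l) (Bornology.cobounded ℂ) := by
  refine tendsto_cobounded_of_meromorphicOrderAt_neg ?_
  rw [L.order_weierstrassP l hl]
  decide

theorem eventually_weierstrassP_ne {l : ℂ} (hl : l ∈ L.lattice) {f : ℂ → ℂ}
    (hf : ContinuousAt f l) : ∀ᶠ t in 𝓝[≠] l, ℘[L] t ≠ f t := by
  have h1 := (tendsto_norm_cobounded_atTop.comp (L.tendsto_weierstrassP hl)).eventually_gt_atTop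
    (‖f l‖ + 1)
  have h2 : ∀ᶠ t in 𝓝[≠] l, ‖f t‖ < ‖f l‖ + 1 :=
    nhdsWithin_le_nhds (hf.norm.eventually_lt_const (by linarith))
  filter_upwards [h1, h2] with t ht1 ht2 h
  simp only [Function.comp_apply, h] at ht1
  linarith

variable {L}

theorem hasDerivAt_derivWeierstrassP {z : ℂ} (hz : z ∉ L.lattice) :
    HasDerivAt ℘'[L] (6 * ℘[L] z ^ 2 - L.g₂ / 2) z := by
  have han := L.analyticOnNhd_weierstrassP
  have han' := L.analyticOnNhd_derivWeierstrassP
  have key : (∀ z ∈ (L.lattice : Set ℂ)ᶜ, ℘'[L] z = 0) ∨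
      (∀ z ∈ (L.lattice : Set ℂ)ᶜ, deriv ℘'[L] z - (6 * ℘[L] z ^ 2 - L.g₂ / 2) = 0) := by
    refine AnalyticOnNhd.eq_zero_or_eq_zero_of_mul_eq_zero han'
      (han'.deriv.sub (((analyticOnNhd_const (v := (6 : ℂ))).mul (han.pow 2)).sub
        analyticOnNhd_const)) (fun w hw => ?_) L.isPreconnected_compl_lattice
    have h1 : HasDerivAt ℘[L] _ w := hasDerivAt_weierstrassP hw
    have h2 : HasDerivAt ℘'[L] (deriv ℘'[L] w) w := (han' w hw).differentiableAt.hasDerivAt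
    have h3 := h2.pow 2
    have h4 := (((h1.pow 3).const_mul 4).sub (h1.const_mul L.g₂)).sub_const L.g₃
    have h5 : (fun z => ℘'[L] z ^ 2) =ᶠ[𝓝 w]
        (fun z => 4 * ℘[L] z ^ 3 - L.g₂ * ℘[L] z - L.g₃) := by
      filter_upwards [L.isOpen_compl_lattice.mem_nhds hw] with t ht
      exact L.derivWeierstrassP_sq t ht
    have h6 := h3.unique (h4.congr_of_eventuallyEq h5)
    norm_num at h6
    linear_combination h6 / 2
  obtain key | key := key
  · exfalso
    obtain ⟨a, ha⟩ := L.isOpen_compl_lattice.exists_is_const_of_deriv_eq_zero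
      L.isPreconnected_compl_lattice L.differentiableOn_weierstrassP
      (fun w hw => by rw [L.deriv_weierstrassP]; exact key w hw)
    have h1 := L.eventually_weierstrassP_ne L.lattice.zero_mem (f := fun _ => a) continuousAt_const
    obtain ⟨t, ht1, ht2⟩ := (h1.and (L.eventually_notMem_lattice 0)).exists
    exact ht1 (ha t ht2)
  · have h := (han' z hz).differentiableAt.hasDerivAt
    have h1 := key z hz
    rwa [sub_eq_zero.mp h1] at h

end PeriodPair

end

section

open Filter Topology

theorem eventually_eq_of_hasDerivAt_zero {F : ℂ → ℂ} {z c : ℂ}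
    (hF : ∀ᶠ u in 𝓝[≠] z, HasDerivAt F 0 u) (hc : Tendsto F (𝓝[≠] z) (𝓝 c)) :
    ∀ᶠ u in 𝓝[≠] z, F u = c := by
  set G := Function.update F z c with hG
  have hGc : ContinuousAt G z := continuousAt_update_same.mpr hc
  have hGd : ∀ᶠ u in 𝓝[≠] z, HasDerivAt G 0 u := by
    filter_upwards [hF, self_mem_nhdsWithin] with u hu hne
    refine hu.congr_of_eventuallyEq ?_
    filter_upwards [isOpen_ne.mem_nhds hne] with t ht
    exact Function.update_of_ne ht _ _
  have han : AnalyticAt ℂ G z :=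
    Complex.analyticAt_of_differentiable_on_punctured_nhds_of_continuousAt
      (hGd.mono fun u hu => hu.differentiableAt) hGc
  have hd : ∀ᶠ u in 𝓝 z, deriv G u = 0 :=
    han.deriv.frequently_zero_iff_eventually_zero.mp (hGd.mono fun u hu => hu.deriv).frequently
  have hd' := hd.and han.eventually_analyticAt
  obtain ⟨r, hr, hball⟩ := Metric.eventually_nhds_iff_ball.mp hd'
  have hcst : ∀ᶠ u in 𝓝 z, G u = c := by
    filter_upwards [Metric.ball_mem_nhds z hr] with u hu
    obtain ⟨a, ha⟩ := Metric.isOpen_ball.exists_is_const_of_deriv_eq_zero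
      (convex_ball z r).isPreconnected
      (fun w hw => (hball w hw).2.differentiableAt.differentiableWithinAt)
      (fun w hw => (hball w hw).1)
    rw [ha u hu, ← ha z (Metric.mem_ball_self hr), hG, Function.update_self]
  filter_upwards [nhdsWithin_le_nhds hcst, self_mem_nhdsWithin] with u hu hne
  rwa [hG, Function.update_of_ne hne] at hu

namespace PeriodPair

variable {L : PeriodPair}

open scoped PeriodPair

theorem eventually_weierstrassP_ne_const (z e : ℂ) : ∀ᶠ t in 𝓝[≠] z, ℘[L] t ≠ e := by
  by_cases hz : z ∈ L.lattice
  · exact L.eventually_weierstrassP_ne hz (f := fun _ => e) continuousAt_const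
  have han := (L.analyticOnNhd_weierstrassP z hz).sub (analyticAt_const (v := e))
  obtain h | h := han.eventually_eq_zero_or_eventually_ne_zero
  · exfalso
    have h0 := (L.analyticOnNhd_weierstrassP.sub
      (analyticOnNhd_const (v := e))).eqOn_zero_of_preconnected_of_eventuallyEq_zero
      L.isPreconnected_compl_lattice hz h
    have h1 := L.eventually_weierstrassP_ne L.lattice.zero_mem (f := fun _ => e) continuousAt_const
    obtain ⟨t, ht1, ht2⟩ := (h1.and (L.eventually_notMem_lattice 0)).exists
    exact ht1 (sub_eq_zero.mp (h0 ht2))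
  · exact h.mono fun t ht => sub_ne_zero.mp ht

theorem weierstrassP_nonsingular {z : ℂ} (hz : z ∉ L.lattice) (h1 : ℘'[L] z = 0) :
    6 * ℘[L] z ^ 2 - L.g₂ / 2 ≠ 0 := by
  intro h2
  set e := ℘[L] z with he
  have ha := L.analyticOnNhd_weierstrassP z hz
  have ha' := L.analyticOnNhd_derivWeierstrassP z hz
  have hf : AnalyticAt ℂ (fun t => ℘[L] t - e) z := ha.sub analyticAt_const
  have hg : AnalyticAt ℂ (fun t => 4 * (℘[L] t + 2 * e)) z :=
    analyticAt_const.mul (ha.add analyticAt_const)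
  have hord := ha.analyticOrderAt_deriv_add_one
  rw [L.deriv_weierstrassP] at hord
  have hsq := L.derivWeierstrassP_sq z hz
  have heq : (℘'[L] ^ 2) =ᶠ[𝓝 z]
      ((fun t => ℘[L] t - e) ^ 2 * (fun t => 4 * (℘[L] t + 2 * e))) := by
    filter_upwards [L.isOpen_compl_lattice.mem_nhds hz] with t ht
    have := L.derivWeierstrassP_sq t ht
    simp only [Pi.pow_apply, Pi.mul_apply]
    rw [h1, ← he] at hsq
    linear_combination this + (℘[L] t - e) * 2 * h2 - hsq
  have ho := analyticOrderAt_congr heq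
  rw [analyticOrderAt_mul (hf.pow 2) hg, analyticOrderAt_pow ha', analyticOrderAt_pow hf] at ho
  have hne : analyticOrderAt (fun t => ℘[L] t - e) z ≠ ⊤ := by
    rw [Ne, analyticOrderAt_eq_top]
    intro h
    obtain ⟨t, ht1, ht2⟩ := ((eventually_weierstrassP_ne_const z e).and
      (nhdsWithin_le_nhds h)).exists
    exact ht1 (sub_eq_zero.mp ht2)
  rw [← he] at hord
  change _ = analyticOrderAt (fun t => ℘[L] t - e) z at hord
  rw [← hord] at ho hne
  generalize analyticOrderAt ℘'[L] z = m at *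
  generalize analyticOrderAt (fun t => 4 * (℘[L] t + 2 * e)) z = p at *
  have hm : m ≠ ⊤ := by rintro rfl; simp at hne
  lift m to ℕ using hm
  cases p with
  | top => simp at ho; exact absurd ho (by exact_mod_cast ENat.natCast_ne_top (2 * m))
  | coe p =>
    simp only [nsmul_eq_mul] at ho
    norm_cast at ho
    omega

/-- The two addition formulas for the Weierstrass function, valid near the origin. -/
theorem eventually_weierstrassP_addition {s : ℂ} (hs : s ∉ L.lattice) :
    ∀ᶠ t in 𝓝[≠] (0 : ℂ), t ∉ L.lattice ∧ s - t ∉ L.lattice ∧ ℘[L] t ≠ ℘[L] (s - t) ∧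
      ((℘'[L] t - ℘'[L] (s - t)) / (℘[L] t - ℘[L] (s - t))) ^ 2 / 4 - ℘[L] t - ℘[L] (s - t)
        = ℘[L] s ∧
      -(℘'[L] (s - t) + (℘'[L] t - ℘'[L] (s - t)) / (℘[L] t - ℘[L] (s - t)) *
        (℘[L] s - ℘[L] (s - t))) = ℘'[L] s := by
  have hcs : ContinuousAt (fun t : ℂ => s - t) 0 := by fun_prop
  have hs0 : s - 0 ∉ L.lattice := by simpa using hs
  have hZd : ∀ {t : ℂ}, s - t ∉ L.lattice →
      HasDerivAt (fun t => ℘[L] (s - t)) (-℘'[L] (s - t)) t := by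
    intro t ht
    have := (hasDerivAt_weierstrassP ht).comp t ((hasDerivAt_id t).const_sub s)
    simpa using! this
  have hWd : ∀ {t : ℂ}, s - t ∉ L.lattice → HasDerivAt (fun t => ℘'[L] (s - t))
      (-(6 * ℘[L] (s - t) ^ 2 - L.g₂ / 2)) t := by
    intro t ht
    have := (hasDerivAt_derivWeierstrassP ht).comp t ((hasDerivAt_id t).const_sub s)
    simpa using! this
  have hZc : ContinuousAt (fun t => ℘[L] (s - t)) 0 := (hZd hs0).continuousAt
  have hWc : ContinuousAt (fun t => ℘'[L] (s - t)) 0 := (hWd hs0).continuousAt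
  have hε : ContinuousAt ℘[L - (0 : ℂ)] 0 := (L.analyticAt_weierstrassPExcept 0).continuousAt
  have hδ : ContinuousAt ℘'[L - (0 : ℂ)] 0 :=
    (L.analyticAt_derivWeierstrassPExcept 0).continuousAt
  have ev1 := L.eventually_notMem_lattice 0
  have ev2 : ∀ᶠ t in 𝓝[≠] (0 : ℂ), s - t ∉ L.lattice :=
    nhdsWithin_le_nhds (hcs.eventually (L.isOpen_compl_lattice.mem_nhds hs0))
  have ev3 : ∀ᶠ t in 𝓝[≠] (0 : ℂ), ℘[L] t ≠ ℘[L] (s - t) :=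
    L.eventually_weierstrassP_ne L.lattice.zero_mem hZc
  set Λ : ℂ → ℂ := fun t => (℘'[L] t - ℘'[L] (s - t)) / (℘[L] t - ℘[L] (s - t)) with hΛ
  have hLd : ∀ t, t ∉ L.lattice → s - t ∉ L.lattice → ℘[L] t ≠ ℘[L] (s - t) →
      HasDerivAt Λ (2 * (℘[L] t - ℘[L] (s - t))) t := by
    intro t h1 h2 h3
    have h3' := sub_ne_zero.mpr h3
    have hX := L.derivWeierstrassP_sq t h1
    have hZ := L.derivWeierstrassP_sq _ h2
    have := ((hasDerivAt_derivWeierstrassP h1).sub (hWd h2)).div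
      ((hasDerivAt_weierstrassP h1).sub (hZd h2)) h3'
    refine this.congr_deriv ?_
    simp only [Pi.sub_apply]
    rw [div_eq_iff (pow_ne_zero 2 h3')]
    linear_combination -hX + hZ
  have hL1 : ∀ t, ℘[L] t ≠ ℘[L] (s - t) →
      Λ t * (℘[L] t - ℘[L] (s - t)) = ℘'[L] t - ℘'[L] (s - t) := by
    intro t h3
    exact div_mul_cancel₀ _ (sub_ne_zero.mpr h3)
  have hX0 : ∀ t : ℂ, t ≠ 0 → t ^ 2 * ℘[L] t = 1 + t ^ 2 * ℘[L - (0 : ℂ)] t := by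
    intro t ht
    rw [L.weierstrassP_eq_add]
    field_simp
    ring
  have hY0 : ∀ t : ℂ, t ≠ 0 → t ^ 3 * ℘'[L] t = -2 + t ^ 3 * ℘'[L - (0 : ℂ)] t := by
    intro t ht
    rw [L.derivWeierstrassP_eq_sub]
    field_simp
    ring
  have hDc : ContinuousAt (fun t => 1 + t ^ 2 * (℘[L - (0 : ℂ)] t - ℘[L] (s - t))) 0 := by
    fun_prop
  have ev4 : ∀ᶠ t in 𝓝[≠] (0 : ℂ), 1 + t ^ 2 * (℘[L - (0 : ℂ)] t - ℘[L] (s - t)) ≠ 0 :=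
    nhdsWithin_le_nhds (hDc.eventually_ne (by simp))
  have hLform : ∀ t : ℂ, t ≠ 0 → ℘[L] t ≠ ℘[L] (s - t) →
      1 + t ^ 2 * (℘[L - (0 : ℂ)] t - ℘[L] (s - t)) ≠ 0 →
      t * Λ t = (-2 + t ^ 3 * (℘'[L - (0 : ℂ)] t - ℘'[L] (s - t))) /
        (1 + t ^ 2 * (℘[L - (0 : ℂ)] t - ℘[L] (s - t))) := by
    intro t h0 h3 h4
    rw [eq_div_iff h4]
    linear_combination t ^ 3 * hL1 t h3 - t * Λ t * hX0 t h0 + hY0 t h0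
  have ev5 : ∀ᶠ t in 𝓝[≠] (0 : ℂ), Λ t ^ 2 / 4 - ℘[L] t - ℘[L] (s - t) = ℘[L] s := by
    refine eventually_eq_of_hasDerivAt_zero ?_ ?_
    · filter_upwards [ev1, ev2, ev3] with t h1 h2 h3
      have := ((((hLd t h1 h2 h3).pow 2).div_const 4).sub (hasDerivAt_weierstrassP h1)).sub
        (hZd h2)
      refine this.congr_deriv ?_
      simp only [Nat.cast_ofNat, Nat.add_one_sub_one, pow_one]
      linear_combination hL1 t h3
    · set G : ℂ → ℂ := fun t =>
        (-t * (℘'[L - (0 : ℂ)] t - ℘'[L] (s - t)) +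
          t ^ 4 * (℘'[L - (0 : ℂ)] t - ℘'[L] (s - t)) ^ 2 / 4
          - 2 * (℘[L - (0 : ℂ)] t - ℘[L] (s - t))
          - t ^ 2 * (℘[L - (0 : ℂ)] t - ℘[L] (s - t)) ^ 2) /
          (1 + t ^ 2 * (℘[L - (0 : ℂ)] t - ℘[L] (s - t))) ^ 2
          - ℘[L - (0 : ℂ)] t - ℘[L] (s - t) with hG
      have hGc : ContinuousAt G 0 := by
        refine ContinuousAt.sub (ContinuousAt.sub (ContinuousAt.div₀ ?_ (hDc.pow 2) ?_) hε) hZc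
        · fun_prop
        · simp
      have hG0 : G 0 = ℘[L] s := by
        simp only [hG, sub_zero, L.weierstrassPExcept_zero]
        ring
      have ht := hGc.tendsto
      rw [hG0] at ht
      refine (ht.mono_left nhdsWithin_le_nhds).congr' ?_
      filter_upwards [self_mem_nhdsWithin, ev3, ev4] with t h0 h3 h4
      have h0' : t ≠ 0 := h0
      have h5 := hLform t h0' h3 h4
      have h6 : Λ t = (-2 + t ^ 3 * (℘'[L - (0 : ℂ)] t - ℘'[L] (s - t))) /
        (1 + t ^ 2 * (℘[L - (0 : ℂ)] t - ℘[L] (s - t))) / t := by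
        rw [← h5]; field_simp
      rw [h6, L.weierstrassP_eq_add t, hG]
      simp only
      generalize ℘[L - (0 : ℂ)] t = e at *
      generalize ℘'[L - (0 : ℂ)] t = d at *
      generalize ℘[L] (s - t) = Z at *
      generalize ℘'[L] (s - t) = V at *
      field_simp
      ring
  have ev6 : ∀ᶠ t in 𝓝[≠] (0 : ℂ),
      -(℘'[L] (s - t) + Λ t * (℘[L] s - ℘[L] (s - t))) = ℘'[L] s := by
    refine eventually_eq_of_hasDerivAt_zero ?_ ?_
    · filter_upwards [ev1, ev2, ev3, ev5] with t h1 h2 h3 h5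
      have := ((hWd h2).add ((hLd t h1 h2 h3).mul ((hZd h2).const_sub (℘[L] s)))).neg
      refine this.congr_deriv ?_
      have hX := L.derivWeierstrassP_sq t h1
      have hZ := L.derivWeierstrassP_sq _ h2
      have h6 : (℘'[L] t + ℘'[L] (s - t)) * Λ t
          = 4 * (℘[L] t ^ 2 + ℘[L] t * ℘[L] (s - t) + ℘[L] (s - t) ^ 2) - L.g₂ := by
        refine mul_right_cancel₀ (sub_ne_zero.mpr h3) ?_
        linear_combination (℘'[L] t + ℘'[L] (s - t)) * hL1 t h3 + hX - hZ
      linear_combination 2 * (℘[L] t - ℘[L] (s - t)) * h5 - Λ t / 2 * hL1 t h3 - h6 / 2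
    · have hsl := hasDerivAt_iff_tendsto_slope_zero.mp (hZd hs0)
      simp only [zero_add, sub_zero, smul_eq_mul] at hsl
      have hcL : Tendsto (fun t => t * Λ t) (𝓝[≠] 0) (𝓝 (-2)) := by
        have hc : ContinuousAt (fun t => (-2 + t ^ 3 * (℘'[L - (0 : ℂ)] t - ℘'[L] (s - t))) /
          (1 + t ^ 2 * (℘[L - (0 : ℂ)] t - ℘[L] (s - t)))) 0 := by
          refine ContinuousAt.div₀ ?_ hDc (by simp)
          fun_prop
        have ht := hc.tendsto
        simp only [ne_eq, OfNat.ofNat_ne_zero, not_false_eq_true, zero_pow, zero_mul, add_zero,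
          div_one] at ht
        refine (ht.mono_left nhdsWithin_le_nhds).congr' ?_
        filter_upwards [self_mem_nhdsWithin, ev3, ev4] with t h0 h3 h4
        exact (hLform t h0 h3 h4).symm
      have hW := hWc.tendsto.mono_left (nhdsWithin_le_nhds (s := {0}ᶜ))
      have := (hW.sub (hcL.mul hsl)).neg
      simp only [sub_zero] at this
      rw [show -(℘'[L] s - -2 * -℘'[L] s) = ℘'[L] s by ring] at this
      refine this.congr' ?_
      filter_upwards [self_mem_nhdsWithin] with t h0
      have h0' : t ≠ 0 := h0
      field_simp
      ring
  filter_upwards [ev1, ev2, ev3, ev5, ev6] with t h1 h2 h3 h5 h6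
  exact ⟨h1, h2, h3, h5, h6⟩

end PeriodPair

end

section

open Filter Topology

namespace PeriodPair

open scoped PeriodPair
open WeierstrassCurve.Affine WeierstrassCurve.Affine.Point

/-- The short Weierstrass curve `W` is the curve `y² = x³ - (g₂/4) x - g₃/4` attached to the
lattice of `L`. -/
structure Uniformizes (L : PeriodPair) (W : WeierstrassCurve.Affine ℂ) : Prop where
  short : W.IsShortNF
  a₄ : W.a₄ = -L.g₂ / 4
  a₆ : W.a₆ = -L.g₃ / 4

variable (L : PeriodPair) (W : WeierstrassCurve.Affine ℂ)

open scoped Classical in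
/-- The point `(℘(z), ℘'(z)/2)`, with the origin as its value at lattice points. -/
noncomputable def toPoint (z : ℂ) : W.Point :=
  if h : z ∉ L.lattice ∧ W.Nonsingular (℘[L] z) (℘'[L] z / 2) then .some _ _ h.2 else 0

variable {L W}

theorem toPoint_of_mem {z : ℂ} (hz : z ∈ L.lattice) : L.toPoint W z = 0 :=
  dif_neg fun h => h.1 hz

namespace Uniformizes

theorem nonsingular_of_notMem (h : L.Uniformizes W) {z : ℂ} (hz : z ∉ L.lattice) :
    W.Nonsingular (℘[L] z) (℘'[L] z / 2) := by
  have := h.short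
  have hsq := L.derivWeierstrassP_sq z hz
  rw [WeierstrassCurve.Affine.nonsingular_iff', WeierstrassCurve.Affine.equation_iff]
  simp only [W.a₁_of_isShortNF, W.a₂_of_isShortNF, W.a₃_of_isShortNF, h.a₄, h.a₆]
  refine ⟨by linear_combination hsq / 4, ?_⟩
  by_cases h1 : ℘'[L] z = 0
  · left
    have h2 := weierstrassP_nonsingular hz h1
    contrapose! h2
    linear_combination -2 * h2
  · right
    contrapose! h1
    linear_combination h1

theorem toPoint_of_notMem (h : L.Uniformizes W) {z : ℂ} (hz : z ∉ L.lattice) :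
    L.toPoint W z = .some _ _ (h.nonsingular_of_notMem hz) :=
  dif_pos ⟨hz, h.nonsingular_of_notMem hz⟩

theorem toPoint_eq_zero_iff (h : L.Uniformizes W) {z : ℂ} :
    L.toPoint W z = 0 ↔ z ∈ L.lattice := by
  refine ⟨fun h0 => ?_, toPoint_of_mem⟩
  by_contra hz
  rw [h.toPoint_of_notMem hz] at h0
  exact Point.some_ne_zero _ h0

theorem xc_toPoint (h : L.Uniformizes W) (z : ℂ) : (L.toPoint W z).xc = ℘[L] z := by
  by_cases hz : z ∈ L.lattice
  · rw [toPoint_of_mem hz]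
    exact (L.weierstrassP_coe ⟨z, hz⟩).symm
  · rw [h.toPoint_of_notMem hz]
    rfl

theorem yc_toPoint (h : L.Uniformizes W) (z : ℂ) : (L.toPoint W z).yc = ℘'[L] z / 2 := by
  by_cases hz : z ∈ L.lattice
  · rw [toPoint_of_mem hz]
    have := L.derivWeierstrassP_coe ⟨z, hz⟩
    simp only at this
    simp [this]
  · rw [h.toPoint_of_notMem hz]
    rfl

theorem toPoint_neg (h : L.Uniformizes W) (z : ℂ) : L.toPoint W (-z) = -L.toPoint W z := by
  have := h.short
  by_cases hz : z ∈ L.lattice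
  · rw [toPoint_of_mem hz, toPoint_of_mem (L.lattice.neg_mem hz), _root_.neg_zero]
  · have h1 : L.toPoint W z ≠ 0 := fun h0 => hz (h.toPoint_eq_zero_iff.mp h0)
    have h2 : L.toPoint W (-z) ≠ 0 := fun h0 => hz (neg_mem_iff.mp (h.toPoint_eq_zero_iff.mp h0))
    refine ext_coord h2 (neg_ne_zero.mpr h1) ?_ ?_
    · rw [xc_neg, h.xc_toPoint, h.xc_toPoint, L.weierstrassP_neg]
    · rw [yc_neg, h.yc_toPoint, h.yc_toPoint, L.derivWeierstrassP_neg]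
      ring

theorem toPoint_add_of_mem (h : L.Uniformizes W) (z : ℂ) {l : ℂ} (hl : l ∈ L.lattice) :
    L.toPoint W (z + l) = L.toPoint W z := by
  by_cases hz : z ∈ L.lattice
  · rw [toPoint_of_mem hz, toPoint_of_mem (L.lattice.add_mem hz hl)]
  · have h1 : L.toPoint W z ≠ 0 := fun h0 => hz (h.toPoint_eq_zero_iff.mp h0)
    have h2 : L.toPoint W (z + l) ≠ 0 := fun h0 =>
      hz ((add_mem_cancel_right hl).mp (h.toPoint_eq_zero_iff.mp h0))
    refine ext_coord h2 h1 ?_ ?_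
    · rw [h.xc_toPoint, h.xc_toPoint]
      exact L.weierstrassP_add_coe z ⟨l, hl⟩
    · rw [h.yc_toPoint, h.yc_toPoint]
      exact congrArg (· / 2) (L.derivWeierstrassP_add_coe z ⟨l, hl⟩)

theorem eventually_toPoint_add (h : L.Uniformizes W) (s : ℂ) :
    ∀ᶠ t in 𝓝 (0 : ℂ), L.toPoint W t + L.toPoint W (s - t) = L.toPoint W s := by
  have := h.short
  by_cases hs : s ∈ L.lattice
  · refine Eventually.of_forall fun t => ?_
    rw [toPoint_of_mem hs, show s - t = -t + s by ring, h.toPoint_add_of_mem _ hs, h.toPoint_neg,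
      add_neg_cancel]
  · have key : ∀ᶠ t in 𝓝[≠] (0 : ℂ),
        L.toPoint W t + L.toPoint W (s - t) = L.toPoint W s := by
      filter_upwards [eventually_weierstrassP_addition hs] with t ⟨h1, h2, h3, h4, h5⟩
      rw [h.toPoint_of_notMem h1, h.toPoint_of_notMem h2, h.toPoint_of_notMem hs,
        add_of_X_ne h3, Point.some.injEq]
      have hsl : W.slope (℘[L] t) (℘[L] (s - t)) (℘'[L] t / 2) (℘'[L] (s - t) / 2) =
          (℘'[L] t - ℘'[L] (s - t)) / (℘[L] t - ℘[L] (s - t)) / 2 := by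
        rw [slope_of_X_ne h3]
        ring
      have h3' := sub_ne_zero.mpr h3
      have hX : W.addX (℘[L] t) (℘[L] (s - t))
          (W.slope (℘[L] t) (℘[L] (s - t)) (℘'[L] t / 2) (℘'[L] (s - t) / 2)) = ℘[L] s := by
        rw [hsl, addX, W.a₁_of_isShortNF, W.a₂_of_isShortNF, ← h4]
        ring
      refine ⟨hX, ?_⟩
      rw [addY, negAddY, hX, negY_of_short, hsl, ← h5]
      field_simp
      ring
    rw [← nhdsNE_sup_pure, eventually_sup]
    refine ⟨key, ?_⟩
    rw [eventually_pure, toPoint_of_mem L.lattice.zero_mem, zero_add, sub_zero]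

theorem toPoint_add_toPoint_sub (h : L.Uniformizes W) (s u : ℂ) :
    L.toPoint W u + L.toPoint W (s - u) = L.toPoint W s := by
  have := h.short
  have hloc : IsLocallyConstant fun u => L.toPoint W u + L.toPoint W (s - u) := by
    rw [IsLocallyConstant.iff_eventually_eq]
    intro u
    have h1 : ∀ᶠ t in 𝓝 (0 : ℂ), L.toPoint W (-t) + L.toPoint W (u - -t) = L.toPoint W u :=
      (continuous_neg.tendsto' (0 : ℂ) 0 _root_.neg_zero).eventually (h.eventually_toPoint_add u)
    have h2 := h1.and (h.eventually_toPoint_add (s - u))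
    have h3 : Tendsto (fun y => y - u) (𝓝 u) (𝓝 0) :=
      (continuous_id.sub continuous_const).tendsto' u 0 (sub_self u)
    filter_upwards [h3.eventually h2] with y hy
    obtain ⟨hy1, hy2⟩ := hy
    rw [show u - -(y - u) = y by ring, h.toPoint_neg] at hy1
    rw [show s - u - (y - u) = s - y by ring] at hy2
    rw [← hy1, ← hy2]
    abel
  have := hloc.apply_eq_of_preconnectedSpace u 0
  simpa [toPoint_of_mem L.lattice.zero_mem] using this

/-- The uniformization `ℂ → E(ℂ)` as a homomorphism of groups. -/
noncomputable def hom (h : L.Uniformizes W) : ℂ →+ W.Point where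
  toFun := L.toPoint W
  map_zero' := toPoint_of_mem L.lattice.zero_mem
  map_add' u v := by
    rw [← h.toPoint_add_toPoint_sub (u + v) u, add_sub_cancel_left]

theorem hom_eq_zero_iff (h : L.Uniformizes W) {z : ℂ} : h.hom z = 0 ↔ z ∈ L.lattice :=
  h.toPoint_eq_zero_iff

theorem xc_hom (h : L.Uniformizes W) (z : ℂ) : (h.hom z).xc = ℘[L] z := h.xc_toPoint z

theorem yc_hom (h : L.Uniformizes W) (z : ℂ) : (h.hom z).yc = ℘'[L] z / 2 := h.yc_toPoint z

theorem hom_eq_iff (h : L.Uniformizes W) {z w : ℂ} : h.hom z = h.hom w ↔ z - w ∈ L.lattice := by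
  rw [← sub_eq_zero, ← _root_.map_sub, h.hom_eq_zero_iff]

theorem derivWeierstrassP_ne_zero (h : L.Uniformizes W) {z : ℂ} (hz : 2 * z ∉ L.lattice) :
    ℘'[L] z ≠ 0 := by
  have := h.short
  intro h0
  have hz' : h.hom z ≠ 0 := fun h1 => hz (by
    rw [two_mul]
    exact L.lattice.add_mem (h.hom_eq_zero_iff.mp h1) (h.hom_eq_zero_iff.mp h1))
  have : h.hom z = -h.hom z := by
    refine ext_coord hz' (neg_ne_zero.mpr hz') (by rw [xc_neg]) ?_
    rw [yc_neg, h.yc_hom, h0]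
    simp
  refine hz (h.hom_eq_zero_iff.mp ?_)
  rw [two_mul, _root_.map_add]
  exact add_eq_zero_iff_eq_neg.mpr this

end Uniformizes

end PeriodPair

end

section

open Filter Topology

namespace PeriodPair

open scoped PeriodPair

variable {L : PeriodPair}

/-- A bounded set of representatives of `ℂ` modulo the lattice. -/
theorem exists_bounded_representative (L : PeriodPair) :
    ∃ K : Set ℂ, Bornology.IsBounded K ∧ ∀ z, ∃ l ∈ L.lattice, z + l ∈ K := by
  refine ⟨_, ZSpan.fundamentalDomain_isBounded L.basis, fun z => ?_⟩
  refine ⟨-(ZSpan.floor L.basis z : ℂ), ?_, ?_⟩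
  · rw [L.lattice_eq_span_range_basis]
    exact neg_mem (ZSpan.floor L.basis z).2
  · have := ZSpan.fract_mem_fundamentalDomain L.basis z
    rwa [ZSpan.fract_apply, sub_eq_add_neg] at this

/-- **Liouville's theorem** for elliptic functions. -/
theorem exists_eventuallyEq_const {f : ℂ → ℂ} (hf : Meromorphic f)
    (hper : ∀ l ∈ L.lattice, ∀ z, f (z + l) = f z)
    (hord : ∀ z, 0 ≤ meromorphicOrderAt f z) :
    ∃ c, ∀ z, ∀ᶠ t in 𝓝[≠] z, f t = c := by
  have hf' : MeromorphicOn f Set.univ := fun z _ => hf z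
  set g := toMeromorphicNFOn f Set.univ with hg
  have hgf : ∀ z, g =ᶠ[𝓝[≠] z] f := fun z => hf'.toMeromorphicNFOn_eq_self_on_nhdsNE trivial
  have han : ∀ z, AnalyticAt ℂ g z := fun z => by
    have hN : MeromorphicNFAt g z := meromorphicNFOn_toMeromorphicNFOn f Set.univ trivial
    rw [← hN.meromorphicOrderAt_nonneg_iff_analyticAt, meromorphicOrderAt_congr (hgf z)]
    exact hord z
  have hlim : ∀ z, Tendsto f (𝓝[≠] z) (𝓝 (g z)) := fun z =>
    ((han z).continuousAt.tendsto.mono_left nhdsWithin_le_nhds).congr' (hgf z)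
  have hgper : ∀ l ∈ L.lattice, ∀ z, g (z + l) = g z := by
    intro l hl z
    have h1 : Tendsto (fun t => t + l) (𝓝[≠] z) (𝓝[≠] (z + l)) := by
      refine tendsto_nhdsWithin_iff.mpr ⟨((continuous_add_const l).tendsto z).mono_left
        nhdsWithin_le_nhds, ?_⟩
      filter_upwards [self_mem_nhdsWithin] with t ht h
      exact ht (add_right_cancel h)
    refine tendsto_nhds_unique ?_ (hlim z)
    refine ((hlim (z + l)).comp h1).congr fun t => ?_
    exact hper l hl t
  have hdiff : Differentiable ℂ g := fun z => (han z).differentiableAt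
  obtain ⟨K, hK, hrep⟩ := L.exists_bounded_representative
  have hbd : Bornology.IsBounded (Set.range g) := by
    refine (hK.isCompact_closure.image hdiff.continuous).isBounded.subset ?_
    rintro _ ⟨z, rfl⟩
    obtain ⟨l, hl, hz⟩ := hrep z
    exact ⟨z + l, subset_closure hz, hgper l hl z⟩
  refine ⟨g 0, fun z => ?_⟩
  filter_upwards [hgf z] with t ht
  rw [← ht]
  exact hdiff.apply_eq_apply_of_bounded hbd t 0

theorem exists_weierstrassP_eq (L : PeriodPair) (x : ℂ) : ∃ z ∉ L.lattice, ℘[L] z = x := by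
  by_contra! hne
  have htend : ∀ z ∈ L.lattice, Tendsto (fun t => (℘[L] t - x)⁻¹) (𝓝[≠] z) (𝓝 0) := by
    intro z hz
    refine tendsto_inv₀_cobounded.comp ?_
    have := (L.tendsto_weierstrassP hz)
    rw [← tendsto_norm_atTop_iff_cobounded] at this ⊢
    refine tendsto_atTop_mono (fun t => ?_) (tendsto_atTop_add_const_right _ (-‖x‖) this)
    have := norm_sub_norm_le (℘[L] t) x
    linarith
  have hmer : Meromorphic fun t => (℘[L] t - x)⁻¹ := by fun_prop
  obtain ⟨c, hc⟩ := exists_eventuallyEq_const (L := L) hmer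
    (fun l hl z => by
      have : ℘[L] (z + l) = ℘[L] z := L.weierstrassP_add_coe z ⟨l, hl⟩
      rw [this])
    (fun z => by
      rw [← tendsto_nhds_iff_meromorphicOrderAt_nonneg (hmer z)]
      by_cases hz : z ∈ L.lattice
      · exact ⟨0, htend z hz⟩
      · refine ⟨(℘[L] z - x)⁻¹, Tendsto.mono_left ?_ nhdsWithin_le_nhds⟩
        exact ((L.analyticOnNhd_weierstrassP z hz).continuousAt.sub
          continuousAt_const).inv₀ (sub_ne_zero.mpr (hne z hz)))
  have h0 := htend 0 L.lattice.zero_mem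
  have hc0 : c = 0 := tendsto_nhds_unique
    (tendsto_const_nhds.congr' ((hc 0).mono fun t ht => ht.symm)) h0
  obtain ⟨t, ht1, ht2⟩ := ((hc 0).and (eventually_weierstrassP_ne_const (L := L) 0 x)).exists
  rw [hc0, inv_eq_zero] at ht1
  exact ht2 (sub_eq_zero.mp ht1)

open WeierstrassCurve.Affine.Point

variable {W : WeierstrassCurve.Affine ℂ}

theorem Uniformizes.hom_surjective (h : L.Uniformizes W) : Function.Surjective h.hom := by
  have := h.short
  intro P
  by_cases hP : P = 0
  · exact ⟨0, by rw [hP, _root_.map_zero]⟩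
  obtain ⟨z, hz, hx⟩ := L.exists_weierstrassP_eq P.xc
  rw [← h.xc_hom] at hx
  have hz' : h.hom z ≠ 0 := fun h0 => hz (h.hom_eq_zero_iff.mp h0)
  rcases eq_or_eq_neg_of_xc_eq hz' hP hx with he | he
  · exact ⟨z, he⟩
  · exact ⟨-z, by rw [_root_.map_neg, he, neg_neg]⟩

open scoped Classical in
theorem Uniformizes.meromorphicOrderAt_sub_xc (h : L.Uniformizes W) {Q : W.Point}
    (hQ : 2 • Q ≠ 0) (z : ℂ) :
    meromorphicOrderAt (fun t => ℘[L] t - Q.xc) z =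
      (((-2) * (if h.hom z = 0 then 1 else 0) + (if h.hom z = Q then 1 else 0) +
        (if h.hom z = -Q then 1 else 0) : ℤ) : WithTop ℤ) := by
  have := h.short
  have hQ0 : Q ≠ 0 := fun h0 => hQ (by rw [h0, _root_.nsmul_zero])
  by_cases hz : h.hom z = 0
  · have h1 : ¬ h.hom z = Q := fun h1 => hQ0 (h1 ▸ hz)
    have h2 : ¬ h.hom z = -Q := fun h2 => hQ0 (neg_eq_zero.mp (h2 ▸ hz))
    rw [if_pos hz, if_neg h1, if_neg h2]
    have ho := L.order_weierstrassP z (h.hom_eq_zero_iff.mp hz)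
    have : (fun t => ℘[L] t - Q.xc) = ℘[L] + fun _ => -Q.xc := by
      ext t; simp [sub_eq_add_neg]
    rw [this, meromorphicOrderAt_add_eq_left_of_lt (by fun_prop), ho]
    · norm_num
    · rw [ho]
      refine lt_of_lt_of_le (b := 0) (by decide) ?_
      exact (tendsto_nhds_iff_meromorphicOrderAt_nonneg (by fun_prop)).mp
        ⟨_, tendsto_const_nhds⟩
  have hz' : z ∉ L.lattice := fun h0 => hz (h.hom_eq_zero_iff.mpr h0)
  have han := L.analyticOnNhd_weierstrassP z hz'
  have han2 : AnalyticAt ℂ (fun t => ℘[L] t - Q.xc) z := han.sub analyticAt_const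
  rw [if_neg hz, mul_zero, zero_add]
  by_cases hx : (h.hom z).xc = Q.xc
  · have hor := eq_or_eq_neg_of_xc_eq hz hQ0 hx
    have hne : Q ≠ -Q := fun he => hQ (by rw [two_nsmul]; exact add_eq_zero_iff_eq_neg.mpr he)
    have hsum : ((if h.hom z = Q then 1 else 0) + (if h.hom z = -Q then 1 else 0) : ℤ) = 1 := by
      rcases hor with he | he
      · rw [if_pos he, if_neg (he ▸ hne), add_zero]
      · rw [if_pos he, if_neg (he ▸ hne.symm), zero_add]
    rw [hsum, han2.meromorphicOrderAt_eq]
    have hd : ℘'[L] z ≠ 0 := by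
      refine h.derivWeierstrassP_ne_zero fun h2 => ?_
      have h3 := h.hom_eq_zero_iff.mpr h2
      rw [two_mul, _root_.map_add, ← two_nsmul] at h3
      rcases hor with he | he
      · exact hQ (he ▸ h3)
      · rw [he, two_nsmul, ← neg_add, neg_eq_zero, ← two_nsmul] at h3
        exact hQ h3
    have hord := han.analyticOrderAt_deriv_add_one
    rw [L.deriv_weierstrassP, (L.analyticOnNhd_derivWeierstrassP z hz').analyticOrderAt_eq_zero.mpr
      hd, zero_add, ← h.xc_hom z, hx] at hord
    rw [← hord]
    rfl
  · have h1 : ¬ h.hom z = Q := fun h1 => hx (by rw [h1])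
    have h2 : ¬ h.hom z = -Q := fun h2 => hx (by rw [h2, xc_neg])
    rw [if_neg h1, if_neg h2, han2.meromorphicOrderAt_eq, han2.analyticOrderAt_eq_zero.mpr]
    · rfl
    · rw [← h.xc_hom]
      exact sub_ne_zero.mpr hx

end PeriodPair

end

section

open Filter Topology

theorem AddMonoidHom.sum_order_count {G : Type*} [AddCommGroup G] [DecidableEq G] (α : G →+ G) (S : Finset G)
    (hS : ∀ τ, τ ∈ S ↔ α τ = 0) (P v : G) :
    (∑ τ ∈ S, ((-2) * (if P = 0 then 1 else 0) + (if P = v + τ then 1 else 0) +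
        (if P = -(v + τ) then 1 else 0)) : ℤ) =
      (∑ τ ∈ S with τ ≠ 0, ((-2) * (if P = 0 then 1 else 0) + (if P = τ then 1 else 0) +
        (if P = -τ then 1 else 0))) + ((-2) * (if α P = 0 then 1 else 0) +
        (if α P = α v then 1 else 0) + (if α P = -α v then 1 else 0)) := by
  have h0 : (0 : G) ∈ S := (hS 0).mpr (map_zero α)
  have hcard : ((S.filter (· ≠ 0)).card : ℤ) = S.card - 1 := by
    rw [Finset.filter_ne', Finset.card_erase_of_mem h0, Nat.cast_sub (Finset.card_pos.mpr ⟨0, h0⟩)]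
    rfl
  have s1 : (∑ τ ∈ S, (if P = v + τ then 1 else 0) : ℤ) = if α P = α v then 1 else 0 := by
    rw [Finset.sum_congr rfl fun τ _ => if_congr (P := P = v + τ) (Q := τ = P - v)
      (by rw [eq_sub_iff_add_eq', eq_comm]) rfl rfl, Finset.sum_ite_eq']
    exact if_congr (by rw [hS, map_sub, sub_eq_zero]) rfl rfl
  have s2 : (∑ τ ∈ S, (if P = -(v + τ) then 1 else 0) : ℤ) =
      if α P = -α v then 1 else 0 := by
    rw [Finset.sum_congr rfl fun τ _ => if_congr (P := P = -(v + τ)) (Q := τ = -P - v)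
      (by rw [eq_sub_iff_add_eq', eq_neg_iff_add_eq_zero, eq_neg_iff_add_eq_zero, add_comm])
      rfl rfl, Finset.sum_ite_eq']
    exact if_congr (by rw [hS, map_sub, map_neg, sub_eq_zero, neg_eq_iff_eq_neg]) rfl rfl
  have s3 : (∑ τ ∈ S with τ ≠ 0, (if P = τ then 1 else 0) : ℤ) =
      if P ∈ S ∧ P ≠ 0 then 1 else 0 := by
    rw [Finset.sum_ite_eq]
    exact if_congr Finset.mem_filter rfl rfl
  have s4 : (∑ τ ∈ S with τ ≠ 0, (if P = -τ then 1 else 0) : ℤ) =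
      if P ∈ S ∧ P ≠ 0 then 1 else 0 := by
    rw [Finset.sum_congr rfl fun τ _ => if_congr (P := P = -τ) (Q := τ = -P)
      (by rw [eq_neg_iff_add_eq_zero, eq_neg_iff_add_eq_zero, add_comm])
      rfl rfl, Finset.sum_ite_eq']
    exact if_congr (by rw [Finset.mem_filter, hS, hS, map_neg, neg_eq_zero, ne_eq, neg_eq_zero])
      rfl rfl
  simp only [Finset.sum_add_distrib, Finset.sum_const, nsmul_eq_mul, hcard, s1, s2, s3, s4,
    ← hS P]
  by_cases hP : P = 0
  · subst hP
    simp only [h0, if_true, ne_eq, not_true, and_false, if_false]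
    ring
  · by_cases hPS : P ∈ S
    · simp only [hP, hPS, if_true, ne_eq, not_false_eq_true, and_true, if_false]
      ring
    · simp only [hP, hPS, ne_eq, not_false_eq_true, and_true, if_false]
      ring

namespace PeriodPair

open scoped PeriodPair
open WeierstrassCurve.Affine.Point

variable {L : PeriodPair} {W : WeierstrassCurve.Affine ℂ}

theorem tendsto_sq_mul_weierstrassP_sub (L : PeriodPair) (x : ℂ) :
    Tendsto (fun t => t ^ 2 * (℘[L] t - x)) (𝓝[≠] 0) (𝓝 1) := by
  have hε : ContinuousAt ℘[L - (0 : ℂ)] 0 := (L.analyticAt_weierstrassPExcept 0).continuousAt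
  have hc : ContinuousAt (fun t => 1 + t ^ 2 * (℘[L - (0 : ℂ)] t - x)) 0 := by fun_prop
  have ht := hc.tendsto
  simp only [ne_eq, OfNat.ofNat_ne_zero, not_false_eq_true, zero_pow, zero_mul, add_zero] at ht
  refine (ht.mono_left nhdsWithin_le_nhds).congr' ?_
  filter_upwards [self_mem_nhdsWithin] with t h0
  have h0' : t ≠ 0 := h0
  rw [L.weierstrassP_eq_add t]
  field_simp
  ring

theorem tendsto_mul_nhdsNE {a : ℂ} (ha : a ≠ 0) (z : ℂ) :
    Tendsto (fun t => a * t) (𝓝[≠] z) (𝓝[≠] (a * z)) := by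
  refine tendsto_nhdsWithin_iff.mpr ⟨((continuous_const_mul a).tendsto z).mono_left
    nhdsWithin_le_nhds, ?_⟩
  filter_upwards [self_mem_nhdsWithin] with t ht h
  exact ht (mul_left_cancel₀ ha h)

theorem Uniformizes.isoFormula (h : L.Uniformizes W) {α : W.Point →+ W.Point} {a : ℂ} (ha : a ≠ 0)
    (hα : ∀ z, α (h.hom z) = h.hom (a * z)) (hfin : {P | α P = 0}.Finite)
    (h2 : ∀ P, α P = 0 → 2 • P = 0 → P = 0) : IsoFormula α a := by
  classical
  have := h.short
  refine ⟨hfin.toFinset, fun τ => by simp, fun P v hP hv => ?_⟩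
  have hS : ∀ τ, τ ∈ hfin.toFinset ↔ α τ = 0 := fun τ => by simp
  generalize hfin.toFinset = S at hS
  have h0S : (0 : W.Point) ∈ S := (hS 0).mpr (_root_.map_zero α)
  have hlat : ∀ l ∈ L.lattice, a * l ∈ L.lattice := fun l hl => by
    rw [← h.hom_eq_zero_iff, ← hα, h.hom_eq_zero_iff.mpr hl, _root_.map_zero]
  have hv2 : 2 • α v ≠ 0 := by rwa [← _root_.map_nsmul]
  have hvτ : ∀ τ ∈ S, 2 • (v + τ) ≠ 0 := fun τ hτ h0 => hv (by
    have h1 := congrArg α h0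
    rwa [_root_.nsmul_add, _root_.map_add, _root_.map_nsmul α 2 τ, (hS τ).mp hτ,
      _root_.nsmul_zero, add_zero, _root_.map_zero] at h1)
  have hτ2 : ∀ τ ∈ S.filter (· ≠ 0), 2 • τ ≠ 0 := fun τ hτ h0 =>
    (Finset.mem_filter.mp hτ).2 (h2 τ ((hS τ).mp (Finset.mem_filter.mp hτ).1) h0)
  set N : ℂ → ℂ := ∏ τ ∈ S, fun t => ℘[L] t - (v + τ).xc with hN
  set D : ℂ → ℂ := ∏ τ ∈ S with τ ≠ 0, fun t => ℘[L] t - τ.xc with hD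
  set E : ℂ → ℂ := (fun t => ℘[L] t - (α v).xc) ∘ (fun t => a * t) with hE
  have hmul : ∀ z, AnalyticAt ℂ (fun t : ℂ => a * t) z := fun z => by fun_prop
  have hdmul : ∀ z, deriv (fun t : ℂ => a * t) z ≠ 0 := fun z => by
    rw [deriv_const_mul_id']
    exact ha
  have hP0 : ∀ x : ℂ, Meromorphic fun t => ℘[L] t - x := fun x => by fun_prop
  have mN : Meromorphic N := fun z => MeromorphicAt.prod fun τ _ => hP0 _ z
  have mD : Meromorphic D := fun z => MeromorphicAt.prod fun τ _ => hP0 _ z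
  have mE : Meromorphic E := fun z =>
    (meromorphicAt_comp_iff_of_deriv_ne_zero (hmul z) (hdmul z)).mpr (hP0 _ _)
  have mF : Meromorphic (N * D⁻¹ * E⁻¹) := fun z => ((mN z).mul (mD z).inv).mul (mE z).inv
  obtain ⟨c, hc⟩ := exists_eventuallyEq_const (L := L) mF
    (fun l hl z => by
      have e1 : ℘[L] (z + l) = ℘[L] z := L.weierstrassP_add_coe z ⟨l, hl⟩
      have e2 : ℘[L] (a * (z + l)) = ℘[L] (a * z) := by
        rw [mul_add]
        exact L.weierstrassP_add_coe (a * z) ⟨_, hlat l hl⟩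
      simp only [hN, hD, hE, Pi.mul_apply, Pi.inv_apply, Finset.prod_apply, Function.comp_apply,
        e1, e2])
    (fun z => by
      have oN : meromorphicOrderAt N z = _ := (meromorphicOrderAt_prod fun τ _ => hP0 _ z).trans
        (Finset.sum_congr rfl fun τ hτ => h.meromorphicOrderAt_sub_xc (hvτ τ hτ) z)
      have oD : meromorphicOrderAt D z = _ := (meromorphicOrderAt_prod fun τ _ => hP0 _ z).trans
        (Finset.sum_congr rfl fun τ hτ => h.meromorphicOrderAt_sub_xc (hτ2 τ hτ) z)
      have oE : meromorphicOrderAt E z = _ :=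
        (meromorphicOrderAt_comp_of_deriv_ne_zero (hmul z) (hdmul z)).trans
        (h.meromorphicOrderAt_sub_xc hv2 (a * z))
      rw [meromorphicOrderAt_mul ((mN z).mul (mD z).inv) (mE z).inv,
        meromorphicOrderAt_mul (mN z) (mD z).inv, meromorphicOrderAt_inv, meromorphicOrderAt_inv,
        oN, oD, oE, ← hα]
      have key := α.sum_order_count S hS (h.hom z) v
      rw [← WithTop.coe_sum, ← WithTop.coe_sum, key]
      norm_cast
      refine le_of_eq ?_
      ring)
  have evD : ∀ z, ∀ᶠ t in 𝓝[≠] z, D t ≠ 0 := fun z => by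
    have : ∀ᶠ t in 𝓝[≠] z, ∀ τ ∈ S.filter (· ≠ 0), ℘[L] t ≠ τ.xc :=
      (Finset.eventually_all _).mpr fun τ _ => eventually_weierstrassP_ne_const z _
    filter_upwards [this] with t ht
    rw [hD, Finset.prod_apply]
    exact Finset.prod_ne_zero_iff.mpr fun τ hτ => sub_ne_zero.mpr (ht τ hτ)
  have evE : ∀ z, ∀ᶠ t in 𝓝[≠] z, E t ≠ 0 := fun z => by
    filter_upwards [(tendsto_mul_nhdsNE ha z).eventually
      (eventually_weierstrassP_ne_const (a * z) (α v).xc)] with t ht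
    exact sub_ne_zero.mpr ht
  have heq : ∀ z, ∀ᶠ t in 𝓝[≠] z, c * E t * D t = N t := fun z => by
    filter_upwards [hc z, evD z, evE z] with t h1 h2 h3
    rw [← h1]
    simp only [Pi.mul_apply, Pi.inv_apply]
    field_simp
  have hca : c = a ^ 2 := by
    have tN : Tendsto (fun t => (t ^ 2) ^ S.card * N t) (𝓝[≠] 0) (𝓝 1) := by
      have := tendsto_finsetProd S fun τ _ => L.tendsto_sq_mul_weierstrassP_sub (v + τ).xc
      simpa [hN, Finset.prod_mul_distrib] using this
    have tD : Tendsto (fun t => (t ^ 2) ^ (S.filter (· ≠ 0)).card * D t) (𝓝[≠] 0) (𝓝 1) := by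
      have := tendsto_finsetProd (S.filter (· ≠ 0))
        fun τ _ => L.tendsto_sq_mul_weierstrassP_sub τ.xc
      simpa only [hD, Finset.prod_mul_distrib, Finset.prod_const, one_pow,
        Finset.prod_apply] using this
    have tE : Tendsto (fun t => (a * t) ^ 2 * E t) (𝓝[≠] 0) (𝓝 1) := by
      have h1 := tendsto_mul_nhdsNE ha 0
      rw [mul_zero] at h1
      exact (L.tendsto_sq_mul_weierstrassP_sub (α v).xc).comp h1
    have hcard : S.card = (S.filter (· ≠ 0)).card + 1 := by
      rw [Finset.filter_ne', Finset.card_erase_of_mem h0S,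
        Nat.sub_add_cancel (Finset.card_pos.mpr ⟨0, h0S⟩)]
    have t1 : Tendsto (fun t => c * (((a * t) ^ 2 * E t) *
        ((t ^ 2) ^ (S.filter (· ≠ 0)).card * D t))) (𝓝[≠] 0) (𝓝 (c * (1 * 1))) :=
      (tE.mul tD).const_mul c
    have t2 : Tendsto (fun t => a ^ 2 * ((t ^ 2) ^ S.card * N t)) (𝓝[≠] 0) (𝓝 (a ^ 2 * 1)) :=
      tN.const_mul _
    have := tendsto_nhds_unique (t1.congr' ?_) t2
    · simpa using this
    · filter_upwards [heq 0] with t ht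
      rw [← ht, hcard]
      ring
  obtain ⟨z, rfl⟩ := h.hom_surjective P
  rw [hα] at hP
  have haz : a * z ∉ L.lattice := fun h0 => hP (h.hom_eq_zero_iff.mpr h0)
  have hz : z ∉ L.lattice := fun h0 => haz (hlat z h0)
  have cP : ContinuousAt ℘[L] z := (L.analyticOnNhd_weierstrassP z hz).continuousAt
  have caP : ContinuousAt (fun t => ℘[L] (a * t)) z :=
    ContinuousAt.comp (L.analyticOnNhd_weierstrassP _ haz).continuousAt (by fun_prop)
  have t1 : Tendsto (fun t => a ^ 2 * (℘[L] (a * t) - (α v).xc) *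
      ∏ τ ∈ S with τ ≠ 0, (℘[L] t - τ.xc)) (𝓝 z) (𝓝 (a ^ 2 * (℘[L] (a * z) - (α v).xc) *
      ∏ τ ∈ S with τ ≠ 0, (℘[L] z - τ.xc))) := by
    refine ((caP.tendsto.sub_const _).const_mul _).mul ?_
    exact tendsto_finsetProd _ fun τ _ => cP.tendsto.sub_const _
  have t2 : Tendsto (fun t => ∏ τ ∈ S, (℘[L] t - (v + τ).xc)) (𝓝 z)
      (𝓝 (∏ τ ∈ S, (℘[L] z - (v + τ).xc))) :=
    tendsto_finsetProd _ fun τ _ => cP.tendsto.sub_const _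
  have := tendsto_nhds_unique ((t1.mono_left nhdsWithin_le_nhds).congr' ?_)
    (t2.mono_left (nhdsWithin_le_nhds (s := {z}ᶜ)))
  · rw [hα, h.xc_hom, h.xc_hom]
    exact this
  · filter_upwards [heq z] with t ht
    rw [hca] at ht
    simpa only [hN, hD, hE, Finset.prod_apply, Function.comp_apply] using ht

end PeriodPair

end

section

namespace PeriodPair

open scoped PeriodPair ComplexConjugate
open WeierstrassCurve.Affine WeierstrassCurve.Affine.Point

/-- Multiplication by `c` preserves the lattice of `L`. -/
def IsMultiplier (L : PeriodPair) (c : ℂ) : Prop := ∀ z ∈ L.lattice, c * z ∈ L.lattice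

variable {L : PeriodPair} {W : WeierstrassCurve.Affine ℂ} {c : ℂ}

theorem int_eq_zero_of_add_eq_zero (L : PeriodPair) {m n : ℤ} (h : m * L.ω₁ + n * L.ω₂ = 0) :
    m = 0 ∧ n = 0 := by
  have := LinearIndependent.pair_iff.mp L.indep m n (by simpa [Complex.real_smul] using h)
  exact_mod_cast this

namespace IsMultiplier

theorem two_mul_add_intCast (hc : L.IsMultiplier c) (e : ℤ) : L.IsMultiplier (2 * c + e) :=
  fun z hz => by
  have : (2 * c + e) * z = c * z + c * z + e • z := by
    rw [zsmul_eq_mul]; ring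
  rw [this]
  exact add_mem (add_mem (hc z hz) (hc z hz)) (zsmul_mem hz e)

/-- A nonreal multiplier of a lattice is an imaginary quadratic integer. -/
theorem exists_trace_norm (hc : L.IsMultiplier c) (him : c.im ≠ 0) :
    ∃ T D : ℤ, conj c = T - c ∧ c ^ 2 - T * c + D = 0 := by
  obtain ⟨A, B, h1⟩ := mem_lattice.mp (hc _ L.ω₁_mem_lattice)
  obtain ⟨C, E, h2⟩ := mem_lattice.mp (hc _ L.ω₂_mem_lattice)
  have hω : L.ω₁ * L.ω₂ ≠ 0 := mul_ne_zero (L.indep.ne_zero 0) (L.indep.ne_zero 1)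
  have hquad : c ^ 2 - ((A + E : ℤ) : ℂ) * c + ((A * E - B * C : ℤ) : ℂ) = 0 := by
    refine (mul_eq_zero.mp ?_).resolve_left hω
    push_cast
    linear_combination (-(c * L.ω₂) + E * L.ω₂) * h1 - B * L.ω₂ * h2
  refine ⟨A + E, A * E - B * C, ?_, hquad⟩
  have hi := congrArg Complex.im hquad
  have hre : 2 * c.re = ((A + E : ℤ) : ℝ) := by
    refine mul_right_cancel₀ him ?_
    simp [pow_two] at hi
    push_cast
    linear_combination hi
  apply Complex.ext
  · simp at hre ⊢
    linarith
  · simp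

theorem disc_ne_zero {T D : ℤ} (him : c.im ≠ 0)
    (hq : c ^ 2 - T * c + D = 0) : T ^ 2 - 4 * D ≠ 0 := by
  intro h0
  have h1 : (2 * c - T) ^ 2 = 0 := by
    have : ((T ^ 2 - 4 * D : ℤ) : ℂ) = 0 := by rw [h0, Int.cast_zero]
    push_cast at this
    linear_combination 4 * hq + this
  have h2 := congrArg Complex.im (pow_eq_zero_iff two_ne_zero |>.mp h1)
  simp at h2
  exact him h2

/-- A nonreal multiplier can be replaced by one of nonzero trace and odd norm. -/
theorem exists_odd_norm (hc : L.IsMultiplier c) (him : c.im ≠ 0) :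
    ∃ (e : ℤ) (T D : ℤ), conj (2 * c + e) = T - (2 * c + e) ∧
      (2 * c + e) ^ 2 - T * (2 * c + e) + D = 0 ∧ T ≠ 0 ∧ Odd D := by
  obtain ⟨t, d, h1, h2⟩ := hc.exists_trace_norm him
  have key : ∀ e : ℤ, conj (2 * c + e) = ((2 * t + 2 * e : ℤ) : ℂ) - (2 * c + e) ∧
      (2 * c + e) ^ 2 - ((2 * t + 2 * e : ℤ) : ℂ) * (2 * c + e) +
        ((4 * d + 2 * t * e + e ^ 2 : ℤ) : ℂ) = 0 := fun e => by
    refine ⟨?_, ?_⟩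
    · rw [map_add, map_mul, h1, Complex.conj_ofNat, map_intCast]
      push_cast
      ring
    · push_cast
      linear_combination 4 * h2
  by_cases ht : t = -1
  · refine ⟨-1, _, _, (key (-1)).1, (key (-1)).2, by omega, ⟨2 * d - t, by ring⟩⟩
  · refine ⟨1, _, _, (key 1).1, (key 1).2, by omega, ⟨2 * d + t, by ring⟩⟩

end IsMultiplier

namespace Uniformizes

theorem exists_hom_mul (h : L.Uniformizes W) (hc : L.IsMultiplier c) :
    ∃ α : W.Point →+ W.Point, ∀ z, α (h.hom z) = h.hom (c * z) := by
  have hker : h.hom.ker ≤ (h.hom.comp (AddMonoidHom.mulLeft c)).ker := fun z hz => by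
    rw [AddMonoidHom.mem_ker] at hz ⊢
    exact h.hom_eq_zero_iff.mpr (hc z (h.hom_eq_zero_iff.mp hz))
  refine ⟨h.hom.liftOfSurjective h.hom_surjective ⟨_, hker⟩, fun z => ?_⟩
  exact h.hom.liftOfRightInverse_comp_apply _ _ ⟨_, hker⟩ z

theorem nsmul_hom (h : L.Uniformizes W) (n : ℕ) (z : ℂ) : n • h.hom z = h.hom (n * z) := by
  rw [← _root_.map_nsmul, nsmul_eq_mul]

theorem zsmul_hom (h : L.Uniformizes W) (n : ℤ) (z : ℂ) : n • h.hom z = h.hom (n * z) := by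
  rw [← _root_.map_zsmul, zsmul_eq_mul]

theorem exists_nsmul_eq (h : L.Uniformizes W) {n : ℕ} (hn : 0 < n) (P : W.Point) :
    ∃ R, n • R = P := by
  obtain ⟨z, rfl⟩ := h.hom_surjective P
  refine ⟨h.hom (z / n), ?_⟩
  rw [h.nsmul_hom, mul_div_cancel₀ _ (Nat.cast_ne_zero.mpr hn.ne')]

theorem ncard_nsmul_eq_zero (h : L.Uniformizes W) {n : ℕ} (hn : 0 < n) :
    {P : W.Point | n • P = 0}.ncard = n ^ 2 := by
  classical
  have hn0 : (n : ℂ) ≠ 0 := Nat.cast_ne_zero.mpr hn.ne'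
  have hnz : (n : ℤ) ≠ 0 := Nat.cast_ne_zero.mpr hn.ne'
  let f : ℕ × ℕ → W.Point := fun p => h.hom ((p.1 * L.ω₁ + p.2 * L.ω₂) / n)
  have hset : {P : W.Point | n • P = 0} = ↑((Finset.range n ×ˢ Finset.range n).image f) := by
    ext P
    simp only [Set.mem_ofPred_eq, Finset.coe_image, Set.mem_image, Finset.mem_coe,
      Finset.mem_product, Finset.mem_range]
    constructor
    · intro hP
      obtain ⟨z, rfl⟩ := h.hom_surjective P
      rw [h.nsmul_hom, h.hom_eq_zero_iff, mem_lattice] at hP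
      obtain ⟨i, j, hij⟩ := hP
      have e : ∀ i : ℤ, (((i % n).toNat : ℕ) : ℤ) = i % n := fun i =>
        Int.toNat_of_nonneg (Int.emod_nonneg i hnz)
      have e' : ∀ i : ℤ, (((i % n).toNat : ℕ) : ℂ) = i - n * (i / n : ℤ) := fun i => by
        rw [← Int.cast_natCast, e, Int.emod_def]
        push_cast
        rfl
      have hlt : ∀ i : ℤ, (i % n).toNat < n := fun i => by
        have := Int.emod_lt_of_pos i (b := n) (by exact_mod_cast hn)
        have := e i
        omega
      refine ⟨((i % n).toNat, (j % n).toNat), ⟨hlt i, hlt j⟩, ?_⟩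
      refine h.hom_eq_iff.mpr (mem_lattice.mpr ⟨-(i / n), -(j / n), ?_⟩)
      simp only [e']
      field_simp
      push_cast
      linear_combination -hij
    · rintro ⟨⟨i, j⟩, -, rfl⟩
      rw [h.nsmul_hom, mul_div_cancel₀ _ hn0, h.hom_eq_zero_iff, mem_lattice]
      exact ⟨i, j, by simp⟩
  rw [hset, Set.ncard_coe_finset, Finset.card_image_of_injOn, Finset.card_product,
    Finset.card_range, pow_two]
  rintro ⟨i, j⟩ hij ⟨i', j'⟩ hij' hf
  simp only [Finset.coe_product, Finset.coe_range, Set.mem_prod, Set.mem_Iio] at hij hij'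
  obtain ⟨a, b, hab⟩ := mem_lattice.mp (h.hom_eq_iff.mp hf)
  simp only at hab
  rw [← sub_div, eq_div_iff hn0] at hab
  have := L.int_eq_zero_of_add_eq_zero (m := i - i' - n * a) (n := j - j' - n * b) (by
    push_cast
    linear_combination -hab)
  have aux : ∀ x y : ℕ, x < n → y < n → ∀ a : ℤ, (x : ℤ) - y - n * a = 0 → x = y := by
    intro x y hx hy a ha
    have h1 : (x : ℤ) ≡ y [ZMOD n] := (Int.modEq_iff_dvd.mpr ⟨-a, by linear_combination -ha⟩)
    exact (Nat.ModEq.eq_of_lt_of_lt ((Int.natCast_modEq_iff).mp h1) hx hy)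
  exact Prod.ext (aux i i' hij.1 hij'.1 a this.1) (aux j j' hij.2 hij'.2 b this.2)

theorem discr_ne_zero (h : L.Uniformizes W) : 4 * W.a₄ ^ 3 + 27 * W.a₆ ^ 2 ≠ 0 := by
  intro h0
  have := h.short
  obtain ⟨x, hx1, hx2⟩ : ∃ x : ℂ, x ^ 3 + W.a₄ * x + W.a₆ = 0 ∧ 3 * x ^ 2 + W.a₄ = 0 := by
    by_cases h4 : W.a₄ = 0
    · have h6 : W.a₆ = 0 := by simpa [h4] using h0
      exact ⟨0, by simp [h6], by simp [h4]⟩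
    · have e : 3 * (-3 * W.a₆ / (2 * W.a₄)) ^ 2 + W.a₄ = 0 := by
        field_simp
        linear_combination h0
      refine ⟨-3 * W.a₆ / (2 * W.a₄), ?_, e⟩
      have e2 : W.a₄ * (-3 * W.a₆ / (2 * W.a₄)) = -3 * W.a₆ / 2 := by field_simp
      linear_combination (-3 * W.a₆ / (2 * W.a₄)) / 3 * e + 2 / 3 * e2
  obtain ⟨z, hz, rfl⟩ := L.exists_weierstrassP_eq x
  have hns := h.nonsingular_of_notMem hz
  rw [WeierstrassCurve.Affine.nonsingular_iff', WeierstrassCurve.Affine.equation_iff] at hns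
  simp only [W.a₁_of_isShortNF, W.a₂_of_isShortNF, W.a₃_of_isShortNF] at hns
  obtain ⟨h1, h2⟩ := hns
  have hy : ℘'[L] z = 0 := by
    have : ℘'[L] z ^ 2 = 0 := by linear_combination 4 * h1 + 4 * hx1
    exact pow_eq_zero_iff two_ne_zero |>.mp this
  rw [hy] at h2
  obtain h2 | h2 := h2
  · exact h2 (by linear_combination -hx2)
  · exact h2 (by ring)

theorem exists_ne_zsmul (h : L.Uniformizes W) {α : W.Point →+ W.Point}
    (hα : ∀ z, α (h.hom z) = h.hom (c * z)) (him : c.im ≠ 0) {T D : ℤ} (hconj : conj c = T - c)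
    (hq : c ^ 2 - T * c + D = 0) {p : ℕ} (hp : p.Prime) (hpD : ¬ (p : ℤ) ∣ T ^ 2 - 4 * D)
    (b : ℤ) : ∃ P : W.Point, p • P = 0 ∧ α P ≠ b • P := by
  by_contra! hall
  have hp0 : (p : ℂ) ≠ 0 := Nat.cast_ne_zero.mpr hp.ne_zero
  have hm : L.IsMultiplier ((c - b) / p) := fun z hz => by
    have h1 := hall (h.hom (z / p)) (by
      rw [h.nsmul_hom, mul_div_cancel₀ _ hp0]
      exact h.hom_eq_zero_iff.mpr hz)
    rw [hα, h.zsmul_hom, h.hom_eq_iff] at h1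
    convert h1 using 1
    ring
  have him' : ((c - b) / p).im ≠ 0 := by
    rw [Complex.div_natCast_im]
    simp [him, hp.ne_zero]
  obtain ⟨T', D', h1, h2⟩ := hm.exists_trace_norm him'
  have hT : (T : ℂ) = 2 * b + p * T' := by
    rw [map_div₀, map_sub, hconj, map_intCast, map_natCast] at h1
    field_simp at h1
    linear_combination h1
  refine hpD ⟨p * (T' ^ 2 - 4 * D'), ?_⟩
  have : (T : ℂ) ^ 2 - 4 * D = p * (p * (T' ^ 2 - 4 * D')) := by
    have h3 : ((c - b) / p) * p = c - b := div_mul_cancel₀ _ hp0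
    generalize (c - b) / p = γ at *
    obtain rfl : c = γ * p + b := by linear_combination -h3
    rw [hT] at hq ⊢
    linear_combination -4 * hq + 4 * p ^ 2 * h2
  exact_mod_cast this

end Uniformizes

end PeriodPair

namespace PeriodPair.Uniformizes

open scoped WeierstrassCurve.Affine
open WeierstrassCurve.Affine WeierstrassCurve.Affine.Point

variable {k : Subfield ℂ} {W₀ : WeierstrassCurve.Affine k} {L : PeriodPair}

theorem isCMCurve [NumberField k] (h : L.Uniformizes (W₀⁄ℂ)) {c : ℂ}
    (hck : c ∈ k) (him : c.im ≠ 0) {T D : ℤ} (hconj : starRingEnd ℂ c = T - c)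
    (hq : c ^ 2 - T * c + D = 0) (hT : T ≠ 0) (hD : Odd D)
    {α : (W₀⁄ℂ).Point →+ (W₀⁄ℂ).Point} (hα : ∀ z, α (h.hom z) = h.hom (c * z)) :
    IsCMCurve W₀ α c T D := by
  have hc0 : c ≠ 0 := fun h0 => him (by simp [h0])
  have hD0 : D ≠ 0 := by rintro rfl; simp at hD
  have hfin : ∀ n : ℕ, 0 < n → {P : (W₀⁄ℂ).Point | n • P = 0}.Finite := fun n hn =>
    Set.finite_of_ncard_pos (by rw [h.ncard_nsmul_eq_zero hn]; positivity)
  have hodd : ∀ (n : ℤ) (P : (W₀⁄ℂ).Point), Odd n → n • P = 0 → 2 • P = 0 → P = 0 := by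
    rintro n P ⟨m, rfl⟩ h1 h2
    have h3 : (2 : ℤ) • P = 0 := by exact_mod_cast h2
    rwa [add_zsmul, mul_comm, mul_zsmul, h3, _root_.zsmul_zero, zero_add, one_zsmul] at h1
  have hquad : ∀ P, α (α P) - T • α P + D • P = 0 := fun P => by
    obtain ⟨z, rfl⟩ := h.hom_surjective P
    rw [hα, hα, h.zsmul_hom, h.zsmul_hom, ← _root_.map_sub, ← _root_.map_add]
    have : c * (c * z) - T * (c * z) + D * z = 0 := by linear_combination z * hq
    rw [this, _root_.map_zero]
  have hker : ∀ P, α P = 0 → D • P = 0 := fun P hP => by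
    have h1 := hquad P
    rwa [hP, _root_.map_zero, _root_.zsmul_zero, sub_zero, zero_add] at h1
  refine
    { nonsing := h.discr_ne_zero
      mem := hck
      conj := hconj
      quad := hq
      trace_ne := hT
      norm_ne := hD0
      disc_ne := PeriodPair.IsMultiplier.disc_ne_zero him hq
      quad_apply := hquad
      isoC := ?_
      isoN := ?_
      card := fun n hn => h.ncard_nsmul_eq_zero hn
      div := fun n hn => h.exists_nsmul_eq hn
      scalar := fun p hp hpD => h.exists_ne_zsmul hα him hconj hq hp hpD }
  · refine h.isoFormula hc0 hα ((hfin D.natAbs (Int.natAbs_pos.mpr hD0)).subset ?_) ?_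
    · intro P hP
      rw [Set.mem_ofPred_eq, ← natCast_zsmul, Int.natCast_natAbs, abs_zsmul_eq_zero]
      exact hker P hP
    · exact fun P hP => hodd D P hD (hker P hP)
  · intro p hp hp2
    refine h.isoFormula (Nat.cast_ne_zero.mpr hp.ne_zero) (fun z => h.nsmul_hom p z)
      (hfin p hp.pos) fun P hP => ?_
    refine hodd p P (by exact_mod_cast hp.odd_of_ne_two hp2) ?_
    rw [natCast_zsmul]
    exact hP

end PeriodPair.Uniformizes

end

section

namespace PeriodPair

open scoped PeriodPair

variable {L : PeriodPair}

theorem coe_latticeEquivProd_symm (L : PeriodPair) (p : ℤ × ℤ) :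
    (L.latticeEquivProd.symm p : ℂ) = latticePoint L.ω₁ L.ω₂ p :=
  L.latticeEquiv_symm_apply p

theorem inLattice_iff (L : PeriodPair) {z : ℂ} : InLattice L.ω₁ L.ω₂ z ↔ z ∈ L.lattice := by
  rw [mem_lattice]
  exact ⟨fun ⟨m, n, h⟩ => ⟨m, n, h.symm⟩, fun ⟨m, n, h⟩ => ⟨m, n, h.symm⟩⟩

theorem wp'_eq (L : PeriodPair) (z : ℂ) : wp' L.ω₁ L.ω₂ z = ℘'[L] z := by
  rw [wp', derivWeierstrassP, ← L.latticeEquivProd.symm.toEquiv.tsum_eq, ← tsum_mul_left,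
    ← tsum_neg]
  refine tsum_congr fun p => ?_
  rw [LinearEquiv.coe_toEquiv, L.coe_latticeEquivProd_symm, zpow_neg, div_eq_mul_inv, ← neg_mul]
  norm_cast

theorem wp_eq (L : PeriodPair) (z : ℂ) : wp L.ω₁ L.ω₂ z = ℘[L] z := by
  let f : ℤ × ℤ → ℂ := fun p =>
    (z - latticePoint L.ω₁ L.ω₂ p) ^ (-2 : ℤ) - (latticePoint L.ω₁ L.ω₂ p) ^ (-2 : ℤ)
  have hf : HasSum f (℘[L] z) := by
    convert L.latticeEquivProd.symm.toEquiv.hasSum_iff.mpr (L.hasSum_weierstrassP z) using 1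
    funext p
    simp only [f, Function.comp_apply, LinearEquiv.coe_toEquiv, L.coe_latticeEquivProd_symm,
      zpow_neg, one_div]
    norm_cast
  have hsupp : Function.support (fun p => if p = 0 then 0 else f p) ⊆ {p | p ≠ 0} := by
    intro p hp h0
    exact hp (if_pos h0)
  have h0 : f 0 = z ^ (-2 : ℤ) := by simp [f, latticePoint]
  rw [← hf.tsum_eq, hf.summable.tsum_eq_add_tsum_ite 0, h0, wp,
    ← tsum_subtype_eq_of_support_subset hsupp]
  congr 1
  exact tsum_congr fun p => (if_neg p.2).symm

theorem tsum_zpow_neg_eq_G (L : PeriodPair) {n : ℕ} (hn : n ≠ 0) :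
    ∑' p : {p : ℤ × ℤ // p ≠ 0}, (latticePoint L.ω₁ L.ω₂ p.1) ^ (-(n : ℤ)) = L.G n := by
  have hsupp : Function.support (fun p => (latticePoint L.ω₁ L.ω₂ p) ^ (-(n : ℤ))) ⊆
      {p | p ≠ 0} := by
    rintro p hp rfl
    exact hp (by simp [latticePoint, hn])
  have := tsum_subtype_eq_of_support_subset hsupp
  rw [G, ← L.latticeEquivProd.symm.toEquiv.tsum_eq]
  refine this.trans (tsum_congr fun p => ?_)
  rw [LinearEquiv.coe_toEquiv, L.coe_latticeEquivProd_symm, zpow_neg, zpow_natCast]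

theorem g2_eq (L : PeriodPair) : g2 L.ω₁ L.ω₂ = L.g₂ := by
  rw [g2, g₂, ← L.tsum_zpow_neg_eq_G four_ne_zero]
  rfl

theorem g3_eq (L : PeriodPair) : g3 L.ω₁ L.ω₂ = L.g₃ := by
  rw [g3, g₃, ← L.tsum_zpow_neg_eq_G (n := 6) (by norm_num)]
  rfl

end PeriodPair

namespace WeierstrassCurve.Affine.Point

open scoped WeierstrassCurve.Affine

variable {k : Subfield ℂ} {W₀ : WeierstrassCurve.Affine k}

/-- The orbit of an algebraic point is at most as large as the degree of any field containing
its coordinates. -/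
theorem ncard_orbit_le_finrank (F : IntermediateField k ℂ) [FiniteDimensional k F]
    {P : (W₀⁄ℂ).Point} (hx : P.xc ∈ F) (hy : P.yc ∈ F) :
    (MulAction.orbit (ℂ ≃ₐ[k] ℂ) P).ncard ≤ Module.finrank k F := by
  obtain rfl | hP := eq_or_ne P 0
  · have : MulAction.orbit (ℂ ≃ₐ[k] ℂ) (0 : (W₀⁄ℂ).Point) = {0} := by
      ext Q
      simp [MulAction.mem_orbit_iff, eq_comm]
    rw [this, Set.ncard_singleton]
    exact Module.finrank_pos
  refine le_trans ?_ (card_algHom_le_finrank k F ℂ)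
  choose s hs using fun Q : MulAction.orbit (ℂ ≃ₐ[k] ℂ) P => Q.2
  refine Nat.card_le_card_of_injective
    (fun Q => ((s Q : ℂ ≃ₐ[k] ℂ) : ℂ →ₐ[k] ℂ).comp F.val) fun Q R hQR => ?_
  have hcoord : ∀ x ∈ F, s Q x = s R x := fun x hx => DFunLike.congr_fun hQR ⟨x, hx⟩
  refine Subtype.ext ((hs Q).symm.trans (Eq.trans ?_ (hs R)))
  have hne : ∀ σ : ℂ ≃ₐ[k] ℂ, σ • P ≠ 0 := fun σ => by
    rwa [Ne, smul_eq_zero_iff_eq]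
  exact ext_coord (hne _) (hne _) (by simpa using hcoord _ hx) (by simpa using hcoord _ hy)

end WeierstrassCurve.Affine.Point

open scoped WeierstrassCurve.Affine PeriodPair
open WeierstrassCurve.Affine.Point in
theorem exists_totient_le_paramDegree (k : Subfield ℂ) [NumberField k] (L : PeriodPair)
    (hg2 : L.g₂ ∈ k) (hg3 : L.g₃ ∈ k)
    (hCM : ∃ c : ℂ, c.im ≠ 0 ∧ c ∈ k ∧ L.IsMultiplier c) :
    ∃ C : ℕ, 0 < C ∧ ∀ (z : ℂ) (N : ℕ), 0 < N → (N : ℂ) * z ∈ L.lattice →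
      (∀ m : ℕ, 0 < m → (m : ℂ) * z ∈ L.lattice → N ≤ m) →
      N.totient ≤ C * paramDegree k L.ω₁ L.ω₂ z := by
  obtain ⟨c₀, him₀, hck₀, hc₀⟩ := hCM
  obtain ⟨e, T, D, hconj, hq, hT, hD⟩ := hc₀.exists_odd_norm him₀
  have hc := hc₀.two_mul_add_intCast e
  have hck : 2 * c₀ + e ∈ k := add_mem (mul_mem (ofNat_mem k 2) hck₀) (intCast_mem k e)
  have him : (2 * c₀ + e).im ≠ 0 := by simpa using him₀
  let W₀ : WeierstrassCurve.Affine k :=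
    { a₁ := 0, a₂ := 0, a₃ := 0, a₄ := -⟨L.g₂, hg2⟩ / 4, a₆ := -⟨L.g₃, hg3⟩ / 4 }
  have hs : W₀.IsShortNF := ⟨rfl, rfl, rfl⟩
  have h4 : ((-⟨L.g₂, hg2⟩ / 4 : k) : ℂ) = -L.g₂ / 4 := by push_cast; rfl
  have h6 : ((-⟨L.g₃, hg3⟩ / 4 : k) : ℂ) = -L.g₃ / 4 := by push_cast; rfl
  have hU : L.Uniformizes (W₀⁄ℂ) := ⟨inferInstance, h4, h6⟩
  obtain ⟨α, hα⟩ := hU.exists_hom_mul hc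
  have hcm := hU.isCMCurve hck him hconj hq hT hD hα
  obtain ⟨C, hC, hbound⟩ := hcm.exists_totient_le_ncard_orbit
  refine ⟨C, hC, fun z N hN hz hmin => ?_⟩
  have hN0 : N • hU.hom z = 0 := by
    rw [hU.nsmul_hom]
    exact hU.hom_eq_zero_iff.mpr hz
  have hord : addOrderOf (hU.hom z) = N := by
    refine (addOrderOf_eq_iff hN).mpr ⟨hN0, fun m hm hm0 h0 => ?_⟩
    rw [hU.nsmul_hom] at h0
    exact (hmin m hm0 (hU.hom_eq_zero_iff.mp h0)).not_gt hm
  refine (hbound N _ hN hord).trans (Nat.mul_le_mul_left C ?_)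
  rw [paramDegree]
  split_ifs with hlat
  · have : hU.hom z = 0 := hU.hom_eq_zero_iff.mpr (L.inLattice_iff.mp hlat)
    rw [this]
    have : MulAction.orbit (ℂ ≃ₐ[k] ℂ) (0 : (W₀⁄ℂ).Point) = {0} := by
      ext Q
      simp [MulAction.mem_orbit_iff, eq_comm]
    rw [this, Set.ncard_singleton]
  · rw [L.wp_eq, L.wp'_eq]
    have halg := isAlgebraic_coord (fun n hn => hcm.finite hn) hN hN0
    rw [hU.xc_hom, hU.yc_hom] at halg
    have h2 : IsAlgebraic k (℘'[L] z) := by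
      have := halg.2.mul (isAlgebraic_algebraMap (A := ℂ) (2 : k))
      rwa [_root_.map_ofNat, div_mul_cancel₀ _ two_ne_zero] at this
    have hfd : FiniteDimensional k (IntermediateField.adjoin k {℘[L] z, ℘'[L] z}) := by
      refine IntermediateField.finiteDimensional_adjoin ?_
      rintro _ (rfl | rfl)
      · exact halg.1.isIntegral
      · exact h2.isIntegral
    refine ncard_orbit_le_finrank _ ?_ ?_
    · rw [hU.xc_hom]
      exact IntermediateField.subset_adjoin _ _ (Set.mem_insert _ _)
    · rw [hU.yc_hom]
      exact div_mem (IntermediateField.subset_adjoin _ _ (Set.mem_insert_of_mem _ rfl))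
        (ofNat_mem _ 2)

end

/-- Let `k` be a number field and `E/k` an elliptic curve **with complex multiplication**
by an order `𝒪` in an imaginary quadratic field `K` with `K ⊂ k`, uniformized over `ℂ` as
`E(ℂ) ≅ ℂ/Λ` with `Λ = ℤω₁ ⊕ ℤω₂` and `g₂(Λ), g₃(Λ) ∈ k` via `z ↦ (℘(z), ℘′(z))`;  the CM
hypothesis together with `K ⊂ k` says that some nonreal `c ∈ k` is a complex multiplier of
`Λ` (then `K = ℚ(c)` and `𝒪 ⊇ ℤ[c]`).  Then there is `C₂ > 0`, depending only on `E` and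
`k`, such that every torsion point `ξ ∈ E(k̄)` of exact order `N`, with `N` large enough
that `log log N > 0`, satisfies `[k(ξ):k] ≥ C₂·N/(log log N)²`. -/
theorem stmt_17 (k : Subfield ℂ) [NumberField k] (ω₁ ω₂ : ℂ)
    (hindep : LinearIndependent ℝ ![ω₁, ω₂])
    (hg2 : g2 ω₁ ω₂ ∈ k) (hg3 : g3 ω₁ ω₂ ∈ k)
    (hCM : ∃ c : ℂ, c.im ≠ 0 ∧ c ∈ k ∧
      ∀ z : ℂ, InLattice ω₁ ω₂ z → InLattice ω₁ ω₂ (c * z)) :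
    ∃ C₂ : ℝ, 0 < C₂ ∧ ∀ (z : ℂ) (N : ℕ), 0 < N → InLattice ω₁ ω₂ ((N : ℂ) * z) →
      (∀ m : ℕ, 0 < m → InLattice ω₁ ω₂ ((m : ℂ) * z) → N ≤ m) →
      0 < Real.log (Real.log (N : ℝ)) →
      C₂ * (N : ℝ) / Real.log (Real.log (N : ℝ)) ^ 2 ≤ (paramDegree k ω₁ ω₂ z : ℝ) := by
  let L : PeriodPair := ⟨ω₁, ω₂, hindep⟩
  have hlat : ∀ z, InLattice ω₁ ω₂ z ↔ z ∈ L.lattice := fun z => L.inLattice_iff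
  obtain ⟨c, him, hck, hc⟩ := hCM
  simp only [hlat] at hc ⊢
  obtain ⟨C, hC, hdeg⟩ := exists_totient_le_paramDegree k L (L.g2_eq ▸ hg2) (L.g3_eq ▸ hg3)
    ⟨c, him, hck, hc⟩
  obtain ⟨C', hC', htot⟩ := exists_totient_lower_bound
  have hC0 : (0 : ℝ) < C := by exact_mod_cast hC
  refine ⟨C' / C, div_pos hC' hC0, fun z N hN hz hmin hlog => ?_⟩
  have h1 : (N.totient : ℝ) ≤ C * paramDegree k ω₁ ω₂ z := by
    exact_mod_cast hdeg z N hN hz hmin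
  have h2 := (htot N hN hlog).trans h1
  rw [← div_le_iff₀' hC0] at h2
  exact le_of_eq_of_le (by ring) h2
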